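/- arXiv:2201.06184 — 3 statements merged into one kernel-verified Lean document; each statement's English description precedes it below -/
import Mathlib

section
/- Suppose 1/2 < ω ≤ 1, where ω = sup{Re(s) : ζ(s) = 0}, and let c be a real number with c < 1 + ω. Then there exist arbitrarily large x such that ∫_2^x (Π(t) − li(t))/t^c dt > 0. -/
open MeasureTheory Filter

/-- `PiR x = ∑_{p^m ≤ x} 1/m`, the Riemann prime-counting function
(sum over prime powers `p^m ≤ x` with `m ≥ 1`). -/
noncomputable def PiR (x : ℝ) : ℝ :=
  ∑ n ∈ Finset.Icc 1 ⌊x⌋₊,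
    if IsPrimePow n then (1 : ℝ) / (n.factorization n.minFac) else 0

/-- `li x` is the logarithmic integral, defined for `x > 1` as the Cauchy principal value
`lim_{ε→0⁺} (∫_0^{1-ε} du/log u + ∫_{1+ε}^x du/log u)`. -/
noncomputable def li (x : ℝ) : ℝ :=
  limUnder (nhdsWithin (0:ℝ) (Set.Ioi 0)) (fun ε =>
    (∫ u in (0:ℝ)..(1 - ε), 1 / Real.log u) + ∫ u in (1 + ε)..x, 1 / Real.log u)

/-- `omegaZ = sup {Re s : ζ(s) = 0}`. -/
noncomputable def omegaZ : ℝ := sSup {r : ℝ | ∃ s : ℂ, riemannZeta s = 0 ∧ s.re = r}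

lemma landau_aux {Ω : Type*} [MeasurableSpace Ω] {μ : Measure Ω} {Y : Ω → ℝ} (hY : ∀ᵐ ω ∂μ, Y ω ≤ 0)
    {b y : ℝ} (hy : y ≤ 0) (hb : b ∈ interior (ProbabilityTheory.integrableExpSet Y μ))
    (hsum : Summable fun n : ℕ => (∫ ω, Y ω ^ n * Real.exp (b * Y ω) ∂μ) / n.factorial * y ^ n) :
    b + y ∈ ProbabilityTheory.integrableExpSet Y μ := by
  have hm := ProbabilityTheory.aemeasurable_of_mem_interior_integrableExpSet hb
  have hI : ∀ n : ℕ, Integrable (fun ω => (y * Y ω) ^ n / n.factorial * Real.exp (b * Y ω)) μ := by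
    intro n
    have := (ProbabilityTheory.integrable_pow_mul_exp_of_mem_interior_integrableExpSet hb n).const_mul
      (y ^ n / n.factorial)
    refine this.congr (Eventually.of_forall fun ω => ?_)
    simp only [mul_pow]; ring
  have hnn : ∀ n : ℕ, 0 ≤ᵐ[μ] (fun ω => (y * Y ω) ^ n / n.factorial * Real.exp (b * Y ω)) := by
    intro n
    filter_upwards [hY] with ω hω
    have : 0 ≤ y * Y ω := mul_nonneg_of_nonpos_of_nonpos hy hω
    simp only [Pi.zero_apply]
    positivity
  refine ⟨(by fun_prop : AEMeasurable _ μ).aestronglyMeasurable, ?_⟩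
  rw [hasFiniteIntegral_iff_ofReal (Eventually.of_forall fun ω => (Real.exp_pos _).le)]
  have h1 : ∫⁻ ω, ENNReal.ofReal (Real.exp ((b + y) * Y ω)) ∂μ =
      ∫⁻ ω, ∑' n : ℕ, ENNReal.ofReal ((y * Y ω) ^ n / n.factorial * Real.exp (b * Y ω)) ∂μ := by
    refine lintegral_congr_ae ?_
    filter_upwards [hY] with ω hω
    have h0 : 0 ≤ y * Y ω := mul_nonneg_of_nonpos_of_nonpos hy hω
    have hs : HasSum (fun n : ℕ => (y * Y ω) ^ n / n.factorial * Real.exp (b * Y ω))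
        (Real.exp (y * Y ω) * Real.exp (b * Y ω)) := by
      have := NormedSpace.expSeries_div_hasSum_exp (y * Y ω)
      rw [← Real.exp_eq_exp_ℝ] at this
      exact this.mul_right _
    rw [← ENNReal.ofReal_tsum_of_nonneg (fun n => by positivity) hs.summable, hs.tsum_eq,
      ← Real.exp_add]
    ring_nf
  rw [h1, lintegral_tsum (fun n => (hI n).1.aemeasurable.ennreal_ofReal)]
  have h2 : ∀ n : ℕ, ∫⁻ ω, ENNReal.ofReal ((y * Y ω) ^ n / n.factorial * Real.exp (b * Y ω)) ∂μ
      = ENNReal.ofReal ((∫ ω, Y ω ^ n * Real.exp (b * Y ω) ∂μ) / n.factorial * y ^ n) := by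
    intro n
    rw [← ofReal_integral_eq_lintegral_ofReal (hI n) (hnn n)]
    congr 1
    rw [div_mul_eq_mul_div, mul_div_assoc, ← integral_mul_const]
    congr 1
    ext ω
    simp only [mul_pow]; ring
  simp_rw [h2]
  exact hsum.tsum_ofReal_lt_top

lemma landau {Ω : Type*} [MeasurableSpace Ω] {μ : Measure Ω} {Y : Ω → ℝ} (hY : ∀ᵐ ω ∂μ, Y ω ≤ 0)
    (hm : AEMeasurable Y μ) {s0 s1 : ℝ}
    (hs1 : ∀ s > s1, s ∈ ProbabilityTheory.integrableExpSet Y μ) {H : ℝ → ℝ}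
    (hH : AnalyticOnNhd ℝ H (Set.Ioi s0))
    (heq : ∀ s > s1, ProbabilityTheory.mgf Y μ s = H s) :
    (∀ s > s0, s ∈ ProbabilityTheory.integrableExpSet Y μ) := by
  set S := ProbabilityTheory.integrableExpSet Y μ with hS
  have hup : ∀ s ∈ S, ∀ t, s ≤ t → t ∈ S := by
    intro s hs t hst
    refine Integrable.mono' (g := fun ω => Real.exp (s * Y ω)) hs
      (by fun_prop : AEMeasurable _ μ).aestronglyMeasurable ?_
    filter_upwards [hY] with ω hω
    rw [Real.norm_eq_abs, Real.abs_exp, Real.exp_le_exp]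
    exact mul_le_mul_of_nonpos_right hst hω
  by_contra! hcon
  obtain ⟨s, hs0, hsS⟩ := hcon
  have hlb : ∀ t ∈ S, s ≤ t := by
    intro t ht
    by_contra! h
    exact hsS (hup t ht s h.le)
  have hbdd : BddBelow S := ⟨s, hlb⟩
  have hne : S.Nonempty := ⟨s1 + 1, hs1 _ (by simp)⟩
  set σ := sInf S with hσ
  have hsσ : s ≤ σ := le_csInf hne hlb
  have hmem : ∀ t > σ, t ∈ S := by
    intro t ht
    obtain ⟨u, hu, hut⟩ := exists_lt_of_csInf_lt hne ht
    exact hup u hu t hut.le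
  have hIntr : Set.Ioi σ ⊆ interior S := interior_maximal hmem isOpen_Ioi
  have hEq : Set.EqOn (ProbabilityTheory.mgf Y μ) H (Set.Ioi σ) := by
    refine AnalyticOnNhd.eqOn_of_preconnected_of_eventuallyEq (z₀ := max s1 σ + 1)
      (ProbabilityTheory.analyticOnNhd_mgf.mono hIntr)
      (hH.mono (Set.Ioi_subset_Ioi (hs0.le.trans hsσ))) isPreconnected_Ioi ?_ ?_
    · simp only [Set.mem_Ioi]; linarith [le_max_right s1 σ]
    · filter_upwards [Ioi_mem_nhds (show s1 < max s1 σ + 1 by linarith [le_max_left s1 σ])] with t ht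
      exact heq t ht
  obtain ⟨p, r, hp⟩ := hH σ (lt_of_lt_of_le hs0 hsσ)
  obtain ⟨r', hr'0, hr'⟩ : ∃ r' : ℝ, 0 < r' ∧ ENNReal.ofReal r' ≤ r := by
    obtain ⟨q, hq0, hq⟩ := ENNReal.lt_iff_exists_nnreal_btwn.1 hp.r_pos
    exact ⟨q, by exact_mod_cast hq0, by simpa using hq.le⟩
  have hp' := hp.mono (by simpa using hr'0) hr'
  have hq := hp'.changeOrigin (y := r' / 4) (by
    rw [← enorm_eq_nnnorm, ← ofReal_norm, ENNReal.ofReal_lt_ofReal_iff hr'0,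
      Real.norm_eq_abs, abs_of_pos (by positivity)]
    linarith)
  have hbσ : σ + r' / 4 ∈ Set.Ioi σ := by simp [hr'0]
  have hq2 : HasFPowerSeriesAt H _ (σ + r' / 4) :=
    (ProbabilityTheory.hasFPowerSeriesAt_mgf (hIntr hbσ)).congr
      (by filter_upwards [isOpen_Ioi.mem_nhds hbσ] with t ht using hEq ht)
  have hqq := hq.hasFPowerSeriesAt.eq_formalMultilinearSeries hq2
  rw [hqq] at hq
  have hsum := (hq.hasSum (y := -(r' / 2)) (by
    have : ENNReal.ofReal r' - (‖r' / 4‖₊ : ENNReal) = ENNReal.ofReal (r' - r' / 4) := by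
      rw [ENNReal.ofReal_sub _ (by positivity), ← enorm_eq_nnnorm, ← ofReal_norm,
       Real.norm_eq_abs, abs_of_pos (by positivity)]
    rw [this, Metric.mem_eball, edist_zero_right, ← ofReal_norm,
      ENNReal.ofReal_lt_ofReal_iff (by linarith), Real.norm_eq_abs, abs_neg,
      abs_of_pos (by positivity)]
    linarith)).summable
  have hfin : σ + r' / 4 + -(r' / 2) ∈ S := by
    refine landau_aux hY (by linarith) (hIntr hbσ) ?_
    simpa [FormalMultilinearSeries.ofScalars_apply_eq, mul_comm] using hsum
  have := csInf_le hbdd hfin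
  linarith

lemma hh_bound {u : ℝ} (hu : 0 < u) (h1 : u ≠ 1) :
    0 ≤ 1 / Real.log u - 1 / (u - 1) ∧ 1 / Real.log u - 1 / (u - 1) ≤ 1 := by
  have ha : Real.log u ≤ u - 1 := Real.log_le_sub_one_of_pos hu
  have hb : 1 - 1 / u ≤ Real.log u := by
    have := Real.one_sub_inv_le_log_of_pos hu
    simpa using this
  have hb' : (u - 1) / u ≤ Real.log u := by
    have : (u - 1) / u = 1 - 1 / u := by field_simp
    rw [this]; exact hb
  have e : u / (u - 1) = 1 + 1 / (u - 1) := by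
    have : u - 1 ≠ 0 := sub_ne_zero.2 h1
    field_simp; ring
  rcases lt_or_gt_of_ne h1 with h | h
  · have hl : Real.log u < 0 := Real.log_neg hu h
    have h3 : 1 / (u - 1) ≤ 1 / Real.log u := one_div_le_one_div_of_neg_of_le (by linarith) ha
    have h4 : 1 / Real.log u ≤ 1 / ((u - 1) / u) := one_div_le_one_div_of_neg_of_le hl hb'
    rw [one_div_div, e] at h4
    constructor <;> linarith
  · have hl : 0 < Real.log u := Real.log_pos h
    have h3 : 1 / (u - 1) ≤ 1 / Real.log u := one_div_le_one_div_of_le hl ha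
    have h4 : 1 / Real.log u ≤ 1 / ((u - 1) / u) :=
      one_div_le_one_div_of_le (div_pos (by linarith) hu) hb'
    rw [one_div_div, e] at h4
    constructor <;> linarith

noncomputable def hhf (u : ℝ) : ℝ := 1 / Real.log u - 1 / (u - 1)

lemma hhf_meas : Measurable hhf := by unfold hhf; fun_prop

lemma hhf_nonneg {u : ℝ} (hu : 0 ≤ u) : 0 ≤ hhf u := by
  rcases hu.eq_or_lt with rfl | hu
  · simp [hhf]
  by_cases h1 : u = 1
  · simp [hhf, h1]
  exact (hh_bound hu h1).1

lemma hhf_le {u : ℝ} (hu : 0 ≤ u) : hhf u ≤ 1 := by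
  rcases hu.eq_or_lt with rfl | hu
  · simp [hhf]
  by_cases h1 : u = 1
  · simp [hhf, h1]
  exact (hh_bound hu h1).2

lemma hhf_int {a b : ℝ} (ha : 0 ≤ a) (hb : 0 ≤ b) : IntervalIntegrable hhf volume a b := by
  refine IntervalIntegrable.mono_fun (g := hhf) (f := fun _ => (1:ℝ)) (by simp)
    hhf_meas.aestronglyMeasurable ?_
  filter_upwards [ae_restrict_mem measurableSet_uIoc] with u hu
  have hu0 : 0 ≤ u := by
    rcases Set.mem_uIoc.1 hu with h | h <;> linarith [h.1]
  simpa [abs_of_nonneg (hhf_nonneg hu0)] using hhf_le hu0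

lemma inv_sub_int {a b : ℝ} (h : (1:ℝ) ∉ Set.uIcc a b) :
    IntervalIntegrable (fun u : ℝ => 1 / (u - 1)) volume a b := by
  refine ContinuousOn.intervalIntegrable ?_
  refine continuousOn_const.div (by fun_prop) ?_
  intro x hx h0
  have : x = 1 := by linarith
  exact h (this ▸ hx)

lemma inv_log_eq {a b : ℝ} (ha : 0 ≤ a) (hb : 0 ≤ b) (h : (1:ℝ) ∉ Set.uIcc a b) :
    ∫ u in a..b, 1 / Real.log u = (∫ u in a..b, hhf u) + Real.log ((b - 1) / (a - 1)) := by
  have h2 : ∫ u in a..b, 1 / (u - 1) = Real.log ((b - 1) / (a - 1)) := by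
    rw [intervalIntegral.integral_comp_sub_right (fun u => 1 / u) 1]
    rw [integral_one_div]
    intro h0
    apply h
    rw [Set.mem_uIcc] at h0 ⊢
    rcases h0 with h0 | h0
    · left; constructor <;> linarith [h0.1, h0.2]
    · right; constructor <;> linarith [h0.1, h0.2]
  rw [← h2, ← intervalIntegral.integral_add (hhf_int ha hb) (inv_sub_int h)]
  congr 1
  ext u
  simp [hhf]

lemma li_eq {x : ℝ} (hx : 1 < x) : li x = (∫ u in (0:ℝ)..x, hhf u) + Real.log (x - 1) := by
  refine Tendsto.limUnder_eq ?_
  have hev : ∀ᶠ ε in nhdsWithin (0:ℝ) (Set.Ioi 0), 0 < ε ∧ ε < 1 ∧ ε < x - 1 := by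
    filter_upwards [self_mem_nhdsWithin, mem_nhdsWithin_of_mem_nhds (Iio_mem_nhds one_pos),
      mem_nhdsWithin_of_mem_nhds (Iio_mem_nhds (sub_pos.2 hx))] with ε h1 h2 h3
    exact ⟨h1, h2, h3⟩
  have key : Tendsto (fun ε : ℝ => ((∫ u in (0:ℝ)..x, hhf u) + Real.log (x - 1)) -
      ∫ u in (1 - ε)..(1 + ε), hhf u) (nhdsWithin (0:ℝ) (Set.Ioi 0))
      (nhds (((∫ u in (0:ℝ)..x, hhf u) + Real.log (x - 1)) - 0)) := by
    refine tendsto_const_nhds.sub ?_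
    refine squeeze_zero_norm' (a := fun ε => 1 * |2 * ε|) ?_ ?_
    · filter_upwards [hev] with ε hε
      have := intervalIntegral.norm_integral_le_of_norm_le_const (a := 1 - ε) (b := 1 + ε)
        (f := hhf) (C := 1) (by
        intro u hu
        rw [Set.uIoc_of_le (by linarith [hε.1])] at hu
        have hu0 : 0 ≤ u := by linarith [hu.1, hε.2.1]
        simpa [abs_of_nonneg (hhf_nonneg hu0)] using hhf_le hu0)
      convert this using 3
      ring
    · have : Tendsto (fun ε : ℝ => 1 * |2 * ε|) (nhds 0) (nhds (1 * |2 * 0|)) :=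
        Continuous.tendsto (by fun_prop) 0
      simp only [mul_zero, abs_zero] at this
      exact this.mono_left nhdsWithin_le_nhds
  rw [sub_zero] at key
  refine key.congr' ?_
  filter_upwards [hev] with ε hε
  obtain ⟨h0, h1, h2⟩ := hε
  rw [inv_log_eq (by norm_num) (by linarith) (by
      rw [Set.uIcc_of_le (by linarith)]; intro h; linarith [h.2]),
    inv_log_eq (by linarith) (by linarith) (by
      rw [Set.uIcc_of_le (by linarith)]; intro h; linarith [h.1])]
  have e1 : (1 - ε - 1) / ((0:ℝ) - 1) = ε := by ring
  have e2 : (x - 1) / (1 + ε - 1) = (x - 1) / ε := by ring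
  rw [e1, e2, Real.log_div (by linarith) (by linarith)]
  have i1 := intervalIntegral.integral_add_adjacent_intervals
    (hhf_int le_rfl (by linarith : 0 ≤ 1 - ε)) (hhf_int (by linarith : 0 ≤ 1 - ε) (by linarith : 0 ≤ 1 + ε))
  have i2 := intervalIntegral.integral_add_adjacent_intervals
    (hhf_int le_rfl (by linarith : 0 ≤ 1 + ε)) (hhf_int (by linarith : 0 ≤ 1 + ε) (by linarith : 0 ≤ x))
  linarith

lemma li_hasDerivAt {x : ℝ} (hx : 1 < x) : HasDerivAt li (1 / Real.log x) x := by
  have h1 : HasDerivAt (fun y => (∫ u in (0:ℝ)..y, hhf u) + Real.log (y - 1))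
      (hhf x + 1 / (x - 1)) x := by
    refine HasDerivAt.add ?_ ?_
    · refine intervalIntegral.integral_hasDerivAt_right (hhf_int le_rfl (by linarith)) ?_ ?_
      · exact hhf_meas.stronglyMeasurable.stronglyMeasurableAtFilter
      · unfold hhf
        have : Real.log x ≠ 0 := (Real.log_pos hx).ne'
        have : x - 1 ≠ 0 := by linarith
        have : x ≠ 0 := by linarith
        fun_prop (disch := assumption)
    · exact ((hasDerivAt_id x).sub_const 1).log (by simp; linarith)
  have e : hhf x + 1 / (x - 1) = 1 / Real.log x := by simp [hhf]
  rw [e] at h1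
  refine h1.congr_of_eventuallyEq ?_
  filter_upwards [Ioi_mem_nhds hx] with y hy using li_eq hy

lemma li_bound {x : ℝ} (hx : 2 ≤ x) : 0 ≤ li x ∧ li x ≤ 2 * x := by
  rw [li_eq (by linarith)]
  have h1 : 0 ≤ ∫ u in (0:ℝ)..x, hhf u :=
    intervalIntegral.integral_nonneg (by linarith) (fun u hu => hhf_nonneg hu.1)
  have h2 : ∫ u in (0:ℝ)..x, hhf u ≤ ∫ u in (0:ℝ)..x, (1:ℝ) :=
    intervalIntegral.integral_mono_on (by linarith) (hhf_int le_rfl (by linarith)) (by simp)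
      (fun u hu => hhf_le hu.1)
  have h3 : 0 ≤ Real.log (x - 1) := Real.log_nonneg (by linarith)
  have h4 := Real.log_le_sub_one_of_pos (show 0 < x - 1 by linarith)
  simp at h2
  constructor <;> linarith

/-- measure with density `ρ` on `(a, ∞)` -/
noncomputable def dm (a : ℝ) (ρ : ℝ → ℝ) : Measure ℝ :=
  (volume.restrict (Set.Ioi a)).withDensity (fun t => ENNReal.ofReal (ρ t))

lemma dm_integral {a : ℝ} {ρ : ℝ → ℝ} (hm : AEMeasurable ρ (volume.restrict (Set.Ioi a)))
    (h0 : ∀ t > a, 0 ≤ ρ t) (g : ℝ → ℝ) :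
    ∫ t, g t ∂(dm a ρ) = ∫ t in Set.Ioi a, ρ t * g t := by
  rw [dm, integral_withDensity_eq_integral_toReal_smul₀ hm.ennreal_ofReal (by simp)]
  refine setIntegral_congr_fun measurableSet_Ioi fun t ht => ?_
  simp [ENNReal.toReal_ofReal (h0 t ht)]

lemma dm_integrable {a : ℝ} {ρ : ℝ → ℝ} (hm : AEMeasurable ρ (volume.restrict (Set.Ioi a)))
    (h0 : ∀ t > a, 0 ≤ ρ t) (g : ℝ → ℝ) :
    Integrable g (dm a ρ) ↔ IntegrableOn (fun t => ρ t * g t) (Set.Ioi a) := by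
  rw [dm, integrable_withDensity_iff_integrable_smul₀' hm.ennreal_ofReal (by simp)]
  refine integrableOn_congr_fun (fun t ht => ?_) measurableSet_Ioi
  simp [ENNReal.toReal_ofReal (h0 t ht)]

lemma exp_neg_log {t : ℝ} (ht : 0 < t) (s : ℝ) : Real.exp (s * -Real.log t) = t ^ (-s) := by
  rw [Real.rpow_def_of_pos ht]; ring_nf

lemma dm_mgf {a : ℝ} (ha : 0 ≤ a) {ρ : ℝ → ℝ} (hm : AEMeasurable ρ (volume.restrict (Set.Ioi a)))
    (h0 : ∀ t > a, 0 ≤ ρ t) (s : ℝ) :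
    ProbabilityTheory.mgf (fun t => -Real.log t) (dm a ρ) s = ∫ t in Set.Ioi a, ρ t * t ^ (-s) := by
  rw [ProbabilityTheory.mgf, dm_integral hm h0]
  refine setIntegral_congr_fun measurableSet_Ioi fun t ht => ?_
  rw [exp_neg_log (lt_of_le_of_lt ha ht)]

lemma dm_mem {a : ℝ} (ha : 0 ≤ a) {ρ : ℝ → ℝ} (hm : AEMeasurable ρ (volume.restrict (Set.Ioi a)))
    (h0 : ∀ t > a, 0 ≤ ρ t) (s : ℝ) :
    s ∈ ProbabilityTheory.integrableExpSet (fun t => -Real.log t) (dm a ρ) ↔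
      IntegrableOn (fun t => ρ t * t ^ (-s)) (Set.Ioi a) := by
  rw [ProbabilityTheory.integrableExpSet, Set.mem_ofPred_eq, dm_integrable hm h0]
  refine integrableOn_congr_fun (fun t ht => ?_) measurableSet_Ioi
  rw [exp_neg_log (lt_of_le_of_lt ha ht)]

lemma dm_ae {a : ℝ} (ha : 1 ≤ a) {ρ : ℝ → ℝ} : ∀ᵐ t ∂(dm a ρ), -Real.log t ≤ 0 := by
  have : ∀ᵐ t ∂(volume.restrict (Set.Ioi a)), -Real.log t ≤ 0 := by
    filter_upwards [ae_restrict_mem measurableSet_Ioi] with t ht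
    have : 1 ≤ t := ha.trans (le_of_lt ht)
    simpa using Real.log_nonneg this
  exact (withDensity_absolutelyContinuous _ _).ae_le this

/-- bounded-by-power integrability -/
lemma intOn_of_le {a k C s : ℝ} (ha : 0 < a) {g : ℝ → ℝ}
    (hm : AEMeasurable g (volume.restrict (Set.Ioi a)))
    (hb : ∀ t > a, |g t| ≤ C * t ^ k) (hs : k + 1 < s) :
    IntegrableOn (fun t => g t * t ^ (-s)) (Set.Ioi a) := by
  have h1 : IntegrableOn (fun t : ℝ => C * t ^ (k - s)) (Set.Ioi a) :=
    (integrableOn_Ioi_rpow_of_lt (by linarith) ha).const_mul C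
  refine Integrable.mono' h1 (by
    have : AEMeasurable (fun t : ℝ => t ^ (-s)) (volume.restrict (Set.Ioi a)) := by fun_prop
    exact (hm.mul this).aestronglyMeasurable) ?_
  filter_upwards [ae_restrict_mem measurableSet_Ioi] with t ht
  have ht0 : 0 < t := ha.trans ht
  rw [norm_mul, Real.norm_eq_abs, Real.norm_eq_abs, abs_of_pos (Real.rpow_pos_of_pos ht0 _),
    sub_eq_add_neg, Real.rpow_add ht0, ← mul_assoc]
  exact mul_le_mul_of_nonneg_right (hb t ht) (Real.rpow_pos_of_pos ht0 _).le

noncomputable def KK (w : ℝ) : ℝ := ∫ t in Set.Ioi (2:ℝ), 1 / Real.log t * t ^ (-w)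

lemma invlog_meas : AEMeasurable (fun t => 1 / Real.log t) (volume.restrict (Set.Ioi (2:ℝ))) := by
  fun_prop

lemma invlog_nonneg : ∀ t > (2:ℝ), 0 ≤ 1 / Real.log t := fun t ht =>
  one_div_nonneg.2 (Real.log_nonneg (by linarith))

lemma invlog_int {w : ℝ} (hw : 1 < w) :
    IntegrableOn (fun t => 1 / Real.log t * t ^ (-w)) (Set.Ioi (2:ℝ)) := by
  refine intOn_of_le (k := 0) (C := 1 / Real.log 2) two_pos invlog_meas ?_ (by linarith)
  intro t ht
  rw [abs_of_nonneg (invlog_nonneg t ht), Real.rpow_zero, mul_one]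
  exact one_div_le_one_div_of_le (Real.log_pos (by norm_num)) (Real.log_le_log (by norm_num) (le_of_lt ht))

lemma KK_deriv {w : ℝ} (hw : 1 < w) : HasDerivAt KK (-(2 ^ (1 - w) / (w - 1))) w := by
  have hIntr : w ∈ interior (ProbabilityTheory.integrableExpSet (fun t => -Real.log t)
      (dm 2 fun t => 1 / Real.log t)) := by
    refine interior_maximal (t := Set.Ioi 1) ?_ isOpen_Ioi hw
    intro v hv
    rw [dm_mem (by norm_num) invlog_meas invlog_nonneg]
    exact invlog_int hv
  have h := ProbabilityTheory.hasDerivAt_mgf hIntr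
  have e : ProbabilityTheory.mgf (fun t => -Real.log t) (dm 2 fun t => 1 / Real.log t) = KK := by
    ext v
    rw [dm_mgf (by norm_num) invlog_meas invlog_nonneg, KK]
  rw [e] at h
  convert h using 1
  rw [dm_integral invlog_meas invlog_nonneg]
  have : ∫ t in Set.Ioi (2:ℝ), 1 / Real.log t * (-Real.log t * Real.exp (w * -Real.log t)) =
      ∫ t in Set.Ioi (2:ℝ), -(t ^ (-w)) := by
    refine setIntegral_congr_fun measurableSet_Ioi fun t ht => ?_
    have h2 : (2:ℝ) < t := ht
    have : Real.log t ≠ 0 := (Real.log_pos (by linarith)).ne'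
    rw [exp_neg_log (by linarith)]
    field_simp
  rw [this, integral_neg, integral_Ioi_rpow_of_lt (by linarith) two_pos]
  have : w - 1 ≠ 0 := by linarith
  have : -w + 1 ≠ 0 := by linarith
  rw [show -w + 1 = 1 - w by ring] at *
  field_simp
  ring

lemma exists_EE : ∃ E : ℂ → ℂ, Differentiable ℂ E ∧
    ∀ w : ℝ, 1 < w → E w = ((KK w + Real.log (w - 1) : ℝ) : ℂ) := by
  set q : ℂ → ℂ := fun z => -(2:ℂ) ^ (1 - z) with hq
  have hqd : Differentiable ℂ q := by
    intro z
    simp only [hq]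
    refine DifferentiableAt.neg ?_
    exact DifferentiableAt.const_cpow (by fun_prop) (Or.inl (by norm_num))
  have hg : Differentiable ℂ (dslope q 1) := by
    rw [← differentiableOn_univ]
    exact (Complex.differentiableOn_dslope (by simp)).2 hqd.differentiableOn
  obtain ⟨E, hE⟩ := hg.isExactOn_univ
  have hD : ∀ w : ℝ, 1 < w → HasDerivAt (fun x : ℝ => E x - ((KK x + Real.log (x - 1) : ℝ) : ℂ)) 0 w := by
    intro w hw
    have h1 : HasDerivAt (fun x : ℝ => E x) (dslope q 1 w) w := (hE w (by simp)).comp_ofReal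
    have h2 : HasDerivAt (fun x : ℝ => KK x + Real.log (x - 1)) (-(2 ^ (1 - w) / (w - 1)) + 1 / (w - 1)) w :=
      (KK_deriv hw).add (((hasDerivAt_id w).sub_const 1).log (by simp; linarith))
    have h3 := h1.sub h2.ofReal_comp
    have hne : (w:ℂ) ≠ 1 := by exact_mod_cast hw.ne'
    have e0 : dslope q 1 w - ((-(2 ^ (1 - w) / (w - 1)) + 1 / (w - 1) : ℝ) : ℂ) = 0 := by
      rw [dslope_of_ne _ hne, slope_def_field]
      simp only [hq]
      push_cast
      rw [Complex.ofReal_cpow (by norm_num)]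
      push_cast
      simp
      ring
    rw [e0] at h3
    exact h3
  have hconst : ∀ w : ℝ, 1 < w → E w - ((KK w + Real.log (w - 1) : ℝ) : ℂ) =
      E (2:ℝ) - ((KK 2 + Real.log (2 - 1) : ℝ) : ℂ) := by
    intro w hw
    exact IsOpen.is_const_of_deriv_eq_zero (s := Set.Ioi (1:ℝ)) isOpen_Ioi isPreconnected_Ioi
      (fun x hx => (hD x hx).differentiableAt.differentiableWithinAt)
      (fun x hx => (hD x hx).deriv) hw (by simp : (2:ℝ) ∈ Set.Ioi 1)
  refine ⟨fun z => E z - (E (2:ℝ) - ((KK 2 + Real.log (2 - 1) : ℝ) : ℂ)), ?_, ?_⟩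
  · intro z
    exact (hE z (by simp)).differentiableAt.sub_const _
  · intro w hw
    simp only
    rw [← hconst w hw]; ring

lemma li_int {w : ℝ} (hw : 1 < w) :
    IntegrableOn (fun t => li t * t ^ (-w - 1)) (Set.Ioi (2:ℝ)) := by
  have hm : AEMeasurable li (volume.restrict (Set.Ioi (2:ℝ))) := by
    refine ContinuousOn.aemeasurable ?_ measurableSet_Ioi
    intro t ht
    have : (2:ℝ) < t := ht
    exact (li_hasDerivAt (by linarith)).continuousAt.continuousWithinAt
  have := intOn_of_le (k := 1) (C := 2) (s := w + 1) two_pos hm (by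
    intro t ht
    have := li_bound (le_of_lt ht)
    rw [abs_of_nonneg this.1, Real.rpow_one]
    exact this.2) (by linarith)
  simpa [neg_add, sub_eq_add_neg, add_comm] using this

lemma li_mellin {w : ℝ} (hw : 1 < w) :
    w * ∫ t in Set.Ioi (2:ℝ), li t * t ^ (-w - 1) = li 2 * 2 ^ (-w) + KK w := by
  have hd : ∀ t ∈ Set.Ioi (2:ℝ), HasDerivAt (fun t => li t * t ^ (-w))
      (1 / Real.log t * t ^ (-w) + li t * (-w * t ^ (-w - 1))) t := by
    intro t ht
    have h2 : (2:ℝ) < t := ht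
    exact (li_hasDerivAt (by linarith)).mul (Real.hasDerivAt_rpow_const (Or.inl (by linarith)))
  have hi1 : IntegrableOn (fun t => li t * (-w * t ^ (-w - 1))) (Set.Ioi (2:ℝ)) := by
    have := (li_int hw).const_mul (-w)
    refine this.congr (Eventually.of_forall fun t => ?_)
    simp only; ring
  have ht : Tendsto (fun t => li t * t ^ (-w)) atTop (nhds 0) := by
    have h0 : Tendsto (fun t : ℝ => 2 * t ^ (-(w - 1))) atTop (nhds (2 * 0)) :=
      (tendsto_rpow_neg_atTop (by linarith)).const_mul 2
    rw [mul_zero] at h0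
    refine squeeze_zero' ?_ ?_ h0
    · filter_upwards [eventually_ge_atTop 2] with t ht
      have := li_bound ht
      have := Real.rpow_nonneg (show 0 ≤ t by linarith) (-w)
      nlinarith
    · filter_upwards [eventually_ge_atTop 2] with t ht
      have := (li_bound ht).2
      have h3 : t ^ (-(w - 1)) = t * t ^ (-w) := by
        rw [show -(w - 1) = 1 + -w by ring, Real.rpow_add (by linarith), Real.rpow_one]
      rw [h3, ← mul_assoc]
      exact mul_le_mul_of_nonneg_right this (Real.rpow_nonneg (show 0 ≤ t by linarith) (-w))
  have hc : ContinuousWithinAt (fun t => li t * t ^ (-w)) (Set.Ici 2) 2 := by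
    refine ContinuousAt.continuousWithinAt ?_
    exact (li_hasDerivAt (by norm_num)).continuousAt.mul
      (Real.continuousAt_rpow_const _ _ (Or.inl (by norm_num)))
  have := integral_Ioi_of_hasDerivAt_of_tendsto hc hd ((invlog_int hw).add hi1) ht
  rw [integral_add (invlog_int hw) hi1] at this
  have e : ∫ t in Set.Ioi (2:ℝ), li t * (-w * t ^ (-w - 1)) =
      -w * ∫ t in Set.Ioi (2:ℝ), li t * t ^ (-w - 1) := by
    rw [← integral_const_mul]
    congr 1; ext t; ring
  rw [e] at this
  rw [KK]
  linarith

noncomputable def aa (n : ℕ) : ℝ :=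
  if IsPrimePow n then (1 : ℝ) / (n.factorization n.minFac) else 0

lemma aa_nonneg (n : ℕ) : 0 ≤ aa n := by unfold aa; split_ifs <;> positivity

lemma aa_le (n : ℕ) : aa n ≤ 1 := by
  unfold aa
  split_ifs
  · rw [one_div]; exact Nat.cast_inv_le_one _
  · norm_num

lemma aa_eq (n : ℕ) : aa n = ArithmeticFunction.vonMangoldt n / Real.log n := by
  unfold aa
  rw [ArithmeticFunction.vonMangoldt_apply]
  split_ifs with h
  · have h1 := h.minFac_pow_factorization_eq
    have hn1 : n ≠ 1 := h.ne_one
    have h2 : Real.log n = n.factorization n.minFac * Real.log n.minFac := by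
      conv_lhs => rw [← h1]
      push_cast
      rw [Real.log_pow]
    have h3 : Real.log n.minFac ≠ 0 :=
      (Real.log_pos (by exact_mod_cast (Nat.minFac_prime hn1).one_lt)).ne'
    rw [h2, div_mul_cancel_right₀ h3, one_div]
  · simp

lemma PiR_eq (t : ℝ) : PiR t = ∑ n ∈ Finset.Icc 1 ⌊t⌋₊, aa n := rfl

lemma PiR_nonneg (t : ℝ) : 0 ≤ PiR t := Finset.sum_nonneg fun n _ => aa_nonneg n

lemma PiR_le {t : ℝ} (ht : 0 ≤ t) : PiR t ≤ t := by
  rw [PiR_eq]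
  calc ∑ n ∈ Finset.Icc 1 ⌊t⌋₊, aa n ≤ ∑ n ∈ Finset.Icc 1 ⌊t⌋₊, (1:ℝ) :=
        Finset.sum_le_sum fun n _ => aa_le n
    _ = ⌊t⌋₊ := by simp
    _ ≤ t := Nat.floor_le ht

lemma PiR_meas : Measurable PiR := by
  have : PiR = (fun k : ℕ => ∑ n ∈ Finset.Icc 1 k, aa n) ∘ (fun t : ℝ => ⌊t⌋₊) := rfl
  rw [this]
  exact (measurable_from_top).comp Nat.measurable_floor

lemma PiR_zero {t : ℝ} (ht : t < 2) : PiR t = 0 := by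
  rw [PiR_eq]
  refine Finset.sum_eq_zero fun n hn => ?_
  rw [Finset.mem_Icc] at hn
  have h2 : ⌊t⌋₊ < 2 := (Nat.floor_lt' (by norm_num)).2 (by exact_mod_cast ht)
  have : n = 1 := by omega
  subst this
  simp [aa, not_isPrimePow_one]

lemma LSeries_real {f : ℕ → ℝ} (h0 : ∀ n, 0 ≤ f n) (h1 : ∀ n, f n ≤ 1) {w : ℝ} (hw : 1 < w) :
    LSeries (fun n => (f n : ℂ)) w =
      ((w * ∫ t in Set.Ioi (1:ℝ), (∑ k ∈ Finset.Icc 1 ⌊t⌋₊, f k) * t ^ (-w - 1) : ℝ) : ℂ) := by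
  rw [LSeries_eq_mul_integral_of_nonneg f (r := 1) (by norm_num) (by simpa using hw) ?_ h0]
  · push_cast
    congr 1
    rw [← integral_complex_ofReal]
    refine setIntegral_congr_fun measurableSet_Ioi fun t ht => ?_
    have : (1:ℝ) < t := ht
    push_cast
    rw [Complex.ofReal_cpow (by linarith)]
    congr 2
    push_cast; ring
  · refine Asymptotics.IsBigO.of_bound 1 (Eventually.of_forall fun n => ?_)
    rw [Real.norm_of_nonneg (Finset.sum_nonneg fun n _ => h0 n), Real.rpow_one, one_mul,
      Real.norm_of_nonneg (by positivity)]
    calc ∑ k ∈ Finset.Icc 1 n, f k ≤ ∑ k ∈ Finset.Icc 1 n, (1:ℝ) :=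
        Finset.sum_le_sum fun n _ => h1 n
      _ = n := by simp

lemma PiR_mellin {w : ℝ} (hw : 1 < w) :
    w * ∫ t in Set.Ioi (2:ℝ), PiR t * t ^ (-w - 1) = Real.log (riemannZeta w).re := by
  have h1 := LSeries_real aa_nonneg aa_le hw
  have h2 := riemannZeta_eq_exp_LSeries (s := (w:ℂ)) (by simpa using hw)
  have h3 : (fun n : ℕ => ((ArithmeticFunction.vonMangoldt n : ℝ) : ℂ) / (Real.log n : ℂ)) =
      fun n => (aa n : ℂ) := by
    ext n; rw [aa_eq]; push_cast; rfl
  rw [h3, h1, ← Complex.ofReal_exp] at h2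
  rw [← h2, Complex.ofReal_re, Real.log_exp]
  congr 1
  have : Set.Ioi (1:ℝ) = Set.Ioo 1 2 ∪ Set.Ici 2 := (Set.Ioo_union_Ici_eq_Ioi (by norm_num)).symm
  rw [← integral_Ici_eq_integral_Ioi]
  symm
  refine setIntegral_eq_of_subset_of_forall_sdiff_eq_zero measurableSet_Ioi ?_ ?_
  · intro t ht
    have : (2:ℝ) ≤ t := ht
    simp only [Set.mem_Ioi]; linarith
  · intro t ht
    have h5 : t < 2 := by simpa using ht.2
    have := PiR_zero h5
    rw [PiR_eq] at this
    rw [this, zero_mul]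

lemma zeta1_of_gt {w : ℝ} (hw : 1 < w) :
    riemannZeta₁ w = (((w - 1) * (riemannZeta w).re : ℝ) : ℂ) := by
  have hne : (w:ℂ) ≠ 1 := by exact_mod_cast hw.ne'
  have h := riemannZeta_eq_inv_sub_mul hne
  have h0 : (w:ℂ) - 1 ≠ 0 := sub_ne_zero.2 hne
  have e : riemannZeta w = ((riemannZeta w).re : ℂ) := by
    apply Complex.ext <;> simp [riemannZeta_im_eq_zero_of_one_lt hw]
  push_cast
  rw [← e, h]
  field_simp

lemma fract_meas : AEMeasurable (fun t : ℝ => Int.fract t / t) (volume.restrict (Set.Ioi (1:ℝ))) := by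
  have := measurable_fract (R := ℝ)
  fun_prop

lemma fract_nonneg' : ∀ t > (1:ℝ), 0 ≤ Int.fract t / t := fun t ht =>
  div_nonneg (Int.fract_nonneg t) (by linarith)

lemma fract_int {w : ℝ} (hw : 0 < w) :
    IntegrableOn (fun t : ℝ => Int.fract t / t * t ^ (-w)) (Set.Ioi (1:ℝ)) := by
  refine intOn_of_le (k := -1) (C := 1) one_pos fract_meas ?_ (by linarith)
  intro t ht
  rw [abs_of_nonneg (fract_nonneg' t ht), one_mul, Real.rpow_neg_one, ← one_div]
  exact div_le_div_of_nonneg_right (Int.fract_lt_one t).le (by linarith)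

lemma zeta1_formula {w : ℝ} (hw : 1 < w) :
    (riemannZeta₁ w).re = w - w * (w - 1) * ∫ t in Set.Ioi (1:ℝ), Int.fract t / t * t ^ (-w) := by
  have h1 := LSeries_real (f := fun _ => 1) (by simp) (by simp) hw
  have h2 : LSeries (fun n => ((1:ℝ):ℂ)) w = riemannZeta w := by
    rw [← LSeries_one_eq_riemannZeta (by simpa using hw)]
    congr 1
  rw [h2] at h1
  rw [zeta1_of_gt hw, h1, Complex.ofReal_re, Complex.ofReal_re]
  have h3 : ∫ t in Set.Ioi (1:ℝ), (∑ k ∈ Finset.Icc 1 ⌊t⌋₊, (1:ℝ)) * t ^ (-w - 1) =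
      ∫ t in Set.Ioi (1:ℝ), (t ^ (-w) - Int.fract t / t * t ^ (-w)) := by
    refine setIntegral_congr_fun measurableSet_Ioi fun t ht => ?_
    have ht1 : (1:ℝ) < t := ht
    have e1 : ((⌊t⌋₊ : ℕ) : ℝ) = t - Int.fract t := by
      rw [natCast_floor_eq_intCast_floor (by linarith), Int.fract]; ring
    simp only [Finset.sum_const, Nat.card_Icc, Nat.add_sub_cancel, nsmul_eq_mul, mul_one]
    rw [e1, Real.rpow_sub_one (by linarith)]
    field_simp
  rw [h3, integral_sub (integrableOn_Ioi_rpow_of_lt (by linarith) one_pos) (fract_int (by linarith)),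
    integral_Ioi_rpow_of_lt (by linarith) one_pos, Real.one_rpow]
  have : w - 1 ≠ 0 := by linarith
  rw [show -w + 1 = -(w - 1) by ring, neg_div_neg_eq]
  field_simp

lemma zeta1_analytic (w : ℝ) : AnalyticAt ℝ (fun x : ℝ => (riemannZeta₁ x).re) w :=
  AnalyticAt.re_ofReal (f := riemannZeta₁) (differentiable_riemannZeta₁.analyticAt _)

lemma zeta1_formula' {w : ℝ} (hw : 0 < w) :
    (riemannZeta₁ w).re = w - w * (w - 1) * ∫ t in Set.Ioi (1:ℝ), Int.fract t / t * t ^ (-w) := by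
  set m := ProbabilityTheory.mgf (fun t => -Real.log t) (dm 1 fun t => Int.fract t / t) with hm
  have hmm : ∀ v, m v = ∫ t in Set.Ioi (1:ℝ), Int.fract t / t * t ^ (-v) :=
    fun v => dm_mgf (by norm_num) fract_meas fract_nonneg' v
  have hsub : Set.Ioi 0 ⊆ interior (ProbabilityTheory.integrableExpSet (fun t => -Real.log t)
      (dm 1 fun t => Int.fract t / t)) := by
    refine interior_maximal ?_ isOpen_Ioi
    intro v hv
    rw [dm_mem (by norm_num) fract_meas fract_nonneg']
    exact fract_int hv
  have hma : AnalyticOnNhd ℝ m (Set.Ioi 0) := ProbabilityTheory.analyticOnNhd_mgf.mono hsub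
  have key : Set.EqOn (fun x : ℝ => (riemannZeta₁ x).re) (fun x => x - x * (x - 1) * m x) (Set.Ioi 0) := by
    refine AnalyticOnNhd.eqOn_of_preconnected_of_eventuallyEq (z₀ := 2)
      (fun x _ => zeta1_analytic x) ?_ isPreconnected_Ioi (by simp) ?_
    · intro x hx
      have := hma x hx
      fun_prop
    · filter_upwards [Ioi_mem_nhds (show (1:ℝ) < 2 by norm_num)] with x hx
      rw [hmm]; exact zeta1_formula hx
  have := key hw
  simp only [hmm] at this
  exact this

lemma zeta1_pos {w : ℝ} (hw : 0 < w) : 0 < (riemannZeta₁ w).re := by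
  rcases le_or_gt w 1 with h | h
  · rw [zeta1_formula' hw]
    have h1 : 0 ≤ ∫ t in Set.Ioi (1:ℝ), Int.fract t / t * t ^ (-w) := by
      refine setIntegral_nonneg measurableSet_Ioi fun t ht => ?_
      have h1 : (1:ℝ) < t := ht
      exact mul_nonneg (fract_nonneg' t h1) (Real.rpow_nonneg (by linarith) _)
    have h2 : 0 ≤ w * (1 - w) := mul_nonneg hw.le (by linarith)
    nlinarith
  · rw [zeta1_of_gt h, Complex.ofReal_re]
    exact mul_pos (by linarith) (riemannZeta_re_pos_of_one_lt h)

lemma fub {φ : ℝ → ℝ} {C k s : ℝ} (hm : AEMeasurable φ (volume.restrict (Set.Ioi (2:ℝ))))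
    (hb : ∀ t > 2, |φ t| ≤ C * t ^ k) (hs : k + 1 < s) (hs0 : 0 < s) :
    IntegrableOn (fun x => (∫ t in (2:ℝ)..x, φ t) * x ^ (-s - 1)) (Set.Ioi (2:ℝ)) ∧
    s * ∫ x in Set.Ioi (2:ℝ), (∫ t in (2:ℝ)..x, φ t) * x ^ (-s - 1) =
      ∫ t in Set.Ioi (2:ℝ), φ t * t ^ (-s) := by
  set ν := volume.restrict (Set.Ioi (2:ℝ)) with hν
  set G : ℝ × ℝ → ℝ := Set.indicator {p | p.2 ≤ p.1} (fun p => φ p.2 * p.1 ^ (-s - 1)) with hG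
  have hφi := intOn_of_le two_pos hm hb hs
  have hGm : AEStronglyMeasurable G (ν.prod ν) := by
    have h1 : AEMeasurable (fun p : ℝ × ℝ => φ p.2) (ν.prod ν) := hm.comp_snd
    have h2 : AEMeasurable (fun p : ℝ × ℝ => p.1 ^ (-s - 1)) (ν.prod ν) := by fun_prop
    exact ((h1.mul h2).indicator (measurableSet_le measurable_snd measurable_fst)).aestronglyMeasurable
  have hpi : ∀ t : ℝ, 2 < t → IntegrableOn (fun x : ℝ => x ^ (-s - 1)) (Set.Ici t) := by
    intro t ht
    rw [integrableOn_Ici_iff_integrableOn_Ioi]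
    exact integrableOn_Ioi_rpow_of_lt (by linarith) (by linarith)
  have hpv : ∀ t : ℝ, 2 < t → ∫ x in Set.Ici t, x ^ (-s - 1) = t ^ (-s) / s := by
    intro t ht
    rw [integral_Ici_eq_integral_Ioi, integral_Ioi_rpow_of_lt (by linarith) (by linarith)]
    rw [show -s - 1 + 1 = -s by ring, neg_div_neg_eq]
  have hsec : ∀ t x : ℝ, G (x, t) = Set.indicator (Set.Ici t) (fun x => φ t * x ^ (-s - 1)) x := by
    intro t x
    simp only [hG, Set.indicator_apply, Set.mem_Ici]
    rfl
  have hsec2 : ∀ x t : ℝ, G (x, t) = Set.indicator (Set.Iic x) (fun t => φ t * x ^ (-s - 1)) t := by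
    intro x t
    simp only [hG, Set.indicator_apply, Set.mem_Iic]
    rfl
  have hcap : ∀ t : ℝ, 2 < t → Set.Ici t ∩ Set.Ioi 2 = Set.Ici t := by
    intro t ht
    refine Set.inter_eq_left.2 fun x hx => ?_
    exact lt_of_lt_of_le ht hx
  have hseci : ∀ t : ℝ, 2 < t → Integrable (fun x => G (x, t)) ν := by
    intro t ht
    simp only [hsec]
    rw [integrable_indicator_iff measurableSet_Ici, IntegrableOn, hν,
      Measure.restrict_restrict measurableSet_Ici, hcap t ht]
    exact (hpi t ht).const_mul _
  have hGi : Integrable G (ν.prod ν) := by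
    rw [integrable_prod_iff' hGm]
    constructor
    · filter_upwards [ae_restrict_mem measurableSet_Ioi] with t ht using hseci t ht
    · have : Integrable (fun t => ‖φ t * t ^ (-s)‖ / s) ν := hφi.norm.div_const s
      refine this.congr ?_
      filter_upwards [ae_restrict_mem measurableSet_Ioi] with t ht
      have ht2 : (2:ℝ) < t := ht
      have e : ∀ x, ‖G (x, t)‖ = Set.indicator (Set.Ici t) (fun x => |φ t| * |x ^ (-s - 1)|) x := by
        intro x
        rw [hsec, norm_indicator_eq_indicator_norm]
        simp
      simp only [e]
      rw [integral_indicator measurableSet_Ici, hν, Measure.restrict_restrict measurableSet_Ici,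
        hcap t ht2, integral_const_mul]
      have e2 : ∫ x in Set.Ici t, |x ^ (-s - 1)| = ∫ x in Set.Ici t, x ^ (-s - 1) := by
        refine setIntegral_congr_fun measurableSet_Ici fun x hx => ?_
        have : t ≤ x := hx
        exact abs_of_nonneg (Real.rpow_nonneg (by linarith) _)
      rw [e2, hpv t ht2, norm_mul, Real.norm_eq_abs, Real.norm_eq_abs,
        abs_of_nonneg (Real.rpow_nonneg (by linarith : (0:ℝ) ≤ t) _)]
      ring
  have hin : ∀ x ∈ Set.Ioi (2:ℝ), ∫ t, G (x, t) ∂ν = (∫ t in (2:ℝ)..x, φ t) * x ^ (-s - 1) := by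
    intro x hx
    have hx2 : (2:ℝ) < x := hx
    simp only [hsec2]
    rw [integral_indicator measurableSet_Iic, hν, Measure.restrict_restrict measurableSet_Iic,
      integral_mul_const, intervalIntegral.integral_of_le hx2.le, Set.inter_comm, Set.Ioi_inter_Iic]
  constructor
  · refine hGi.integral_prod_left.congr ?_
    filter_upwards [ae_restrict_mem measurableSet_Ioi] with x hx using hin x hx
  · rw [← setIntegral_congr_fun measurableSet_Ioi hin, integral_integral_swap (f := fun x t => G (x, t)) hGi,
      ← integral_const_mul]
    refine setIntegral_congr_fun measurableSet_Ioi fun t ht => ?_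
    have ht2 : (2:ℝ) < t := ht
    simp only [hsec]
    rw [integral_indicator measurableSet_Ici, hν, Measure.restrict_restrict measurableSet_Ici,
        hcap t ht2, integral_const_mul, hpv t ht2]
    field_simp

lemma phi_meas (c : ℝ) : AEMeasurable (fun t => (PiR t - li t) / t ^ c)
    (volume.restrict (Set.Ioi (2:ℝ))) := by
  have h1 : AEMeasurable li (volume.restrict (Set.Ioi (2:ℝ))) := by
    refine ContinuousOn.aemeasurable (fun x hx => ?_) measurableSet_Ioi
    have hx2 : (2:ℝ) < x := hx
    exact (li_hasDerivAt (by linarith)).continuousAt.continuousWithinAt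
  have h2 : Measurable PiR := PiR_meas
  fun_prop

lemma phi_bound (c : ℝ) : ∀ t > 2, |(PiR t - li t) / t ^ c| ≤ 3 * t ^ (1 + |c|) := by
  intro t ht
  have ht0 : (0:ℝ) < t := by linarith
  have h1 := PiR_le ht0.le
  have h2 : 0 ≤ PiR t := PiR_nonneg t
  have h3 := li_bound (le_of_lt ht)
  have h4 : |PiR t - li t| ≤ 3 * t := by
    rw [abs_le]; constructor <;> linarith [h3.1, h3.2]
  rw [abs_div, abs_of_pos (Real.rpow_pos_of_pos ht0 c), div_eq_mul_inv, ← Real.rpow_neg ht0.le,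
    Real.rpow_add ht0, Real.rpow_one, ← mul_assoc]
  refine mul_le_mul h4 ?_ (Real.rpow_nonneg ht0.le _) (by linarith)
  exact Real.rpow_le_rpow_of_exponent_le (by linarith) (neg_le_abs c)

lemma phi_mellin {c s : ℝ} (hw : 1 < s + c - 1) :
    (s + c - 1) * ∫ t in Set.Ioi (2:ℝ), (PiR t - li t) / t ^ c * t ^ (-s) =
      Real.log (riemannZeta ((s + c - 1 : ℝ) : ℂ)).re
        - (li 2 * 2 ^ (-(s + c - 1)) + KK (s + c - 1)) := by
  set w := s + c - 1 with hwd
  have e : ∫ t in Set.Ioi (2:ℝ), (PiR t - li t) / t ^ c * t ^ (-s) =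
      ∫ t in Set.Ioi (2:ℝ), (PiR t * t ^ (-w - 1) - li t * t ^ (-w - 1)) := by
    refine setIntegral_congr_fun measurableSet_Ioi fun t ht => ?_
    have ht0 : (0:ℝ) < t := lt_trans two_pos ht
    rw [show -w - 1 = -c + -s by rw [hwd]; ring, Real.rpow_add ht0, Real.rpow_neg ht0.le c]
    field_simp
  have hP : IntegrableOn (fun t => PiR t * t ^ (-w - 1)) (Set.Ioi (2:ℝ)) := by
    have := intOn_of_le (g := PiR) (a := 2) (C := 1) (k := 1) (s := w + 1) two_pos
      PiR_meas.aemeasurable (fun t ht => by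
        rw [abs_of_nonneg (PiR_nonneg t), one_mul, Real.rpow_one]
        exact PiR_le (by linarith)) (by linarith)
    simpa only [neg_add'] using this
  rw [e, integral_sub hP (li_int hw), mul_sub, PiR_mellin hw, li_mellin hw]

theorem integral_Pi_sub_li_div_rpow_pos_frequently
    (homega : 1 / 2 < omegaZ) (homega' : omegaZ ≤ 1)
    (c : ℝ) (hc : c < 1 + omegaZ) :
    ∀ X : ℝ, ∃ x : ℝ, x > X ∧ (∫ t in (2:ℝ)..x, (PiR t - li t) / t ^ c) > 0 := by
  intro X
  by_contra! hcon
  set φ : ℝ → ℝ := fun t => (PiR t - li t) / t ^ c with hφ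
  set F : ℝ → ℝ := fun x => ∫ t in (2:ℝ)..x, φ t with hF
  have hcon' : ∀ x, X < x → F x ≤ 0 := fun x hx => hcon x hx
  have hφm := phi_meas c
  have hφb := phi_bound c
  -- a constant dominating `F`
  obtain ⟨M, hM⟩ : ∃ M : ℝ, ∀ x > 2, 0 ≤ M - F x := by
    set X' := max X 2 with hX'
    have hX2 : 2 ≤ X' := le_max_right _ _
    have hk : 0 ≤ 1 + |c| := by positivity
    have hM0 : 0 ≤ 3 * X' ^ (1 + |c|) * X' := by positivity
    refine ⟨3 * X' ^ (1 + |c|) * X', fun x hx => ?_⟩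
    rcases le_or_gt x X' with h | h
    · have h1 : ‖F x‖ ≤ 3 * X' ^ (1 + |c|) * |x - 2| := by
        refine intervalIntegral.norm_integral_le_of_norm_le_const fun t ht => ?_
        rw [Set.uIoc_of_le (le_of_lt hx)] at ht
        refine (hφb t ht.1).trans ?_
        refine mul_le_mul_of_nonneg_left ?_ (by norm_num)
        exact Real.rpow_le_rpow (by linarith [ht.1]) (ht.2.trans h) hk
      have h2 : |x - 2| ≤ X' := by rw [abs_of_pos (by linarith)]; linarith
      have h3 : F x ≤ 3 * X' ^ (1 + |c|) * X' :=
        (le_abs_self _).trans (h1.trans (mul_le_mul_of_nonneg_left h2 (by positivity)))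
      linarith
    · have := hcon' x (lt_of_le_of_lt (le_max_left _ _) h)
      linarith
  set s1 : ℝ := 3 + 2 * |c| with hs1
  have hca := neg_abs_le c
  have hcb := abs_nonneg c
  have hfub : ∀ s > s1, _ := fun s (hs : s > s1) => fub (s := s) hφm hφb (by linarith) (by linarith)
  set ρ : ℝ → ℝ := fun x => (M - F x) / x with hρ
  have hFm : AEMeasurable F (volume.restrict (Set.Ioi (2:ℝ))) := by
    have h1 := (hfub (s1 + 1) (by linarith)).1.aemeasurable
    have h2 : AEMeasurable (fun x : ℝ => x ^ (s1 + 1 + 1)) (volume.restrict (Set.Ioi (2:ℝ))) := by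
      fun_prop
    refine (h1.mul h2).congr ?_
    filter_upwards [ae_restrict_mem measurableSet_Ioi] with x hx
    have hx0 : (0:ℝ) < x := lt_trans two_pos hx
    simp only [Pi.mul_apply]
    rw [mul_assoc, ← Real.rpow_add hx0, show -(s1 + 1) - 1 + (s1 + 1 + 1) = 0 by ring,
      Real.rpow_zero, mul_one]
  have hρm : AEMeasurable ρ (volume.restrict (Set.Ioi (2:ℝ))) := by fun_prop
  have hρ0 : ∀ t > 2, 0 ≤ ρ t := fun t ht => div_nonneg (hM t ht) (by linarith)
  have hρe : ∀ s : ℝ, Set.EqOn (fun t => M * t ^ (-s - 1) - F t * t ^ (-s - 1))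
      (fun t => ρ t * t ^ (-s)) (Set.Ioi (2:ℝ)) := by
    intro s t ht
    have ht0 : (0:ℝ) < t := lt_trans two_pos ht
    simp only [hρ]
    rw [Real.rpow_sub_one ht0.ne']
    field_simp
  set Y : ℝ → ℝ := fun t => -Real.log t with hY
  have hMi : ∀ s : ℝ, s > 0 → IntegrableOn (fun t : ℝ => M * t ^ (-s - 1)) (Set.Ioi (2:ℝ)) := fun s hs =>
    (integrableOn_Ioi_rpow_of_lt (by linarith) two_pos).const_mul M
  have hIntr : ∀ s > s1, s ∈ ProbabilityTheory.integrableExpSet Y (dm 2 ρ) := by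
    intro s hs
    rw [hY, dm_mem (by norm_num) hρm hρ0]
    refine IntegrableOn.congr_fun ?_ (hρe s) measurableSet_Ioi
    exact (hMi s (by linarith)).sub (hfub s hs).1
  obtain ⟨E, hE, hEv⟩ := exists_EE
  set R : ℂ → ℂ := fun z => M * (z + c - 1) * (2:ℂ) ^ (-z) + li 2 * (2:ℂ) ^ (-(z + c - 1))
    + E (z + c - 1) with hR
  have hRd : Differentiable ℂ R := by
    intro z
    have h2 : (2:ℂ) ≠ 0 := two_ne_zero
    have hE' : DifferentiableAt ℂ (fun z : ℂ => E (z + c - 1)) z :=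
      (hE _).comp z (by fun_prop)
    have ha : DifferentiableAt ℂ (fun z : ℂ => (2:ℂ) ^ (-z)) z :=
      DifferentiableAt.const_cpow (by fun_prop) (Or.inl h2)
    have hb : DifferentiableAt ℂ (fun z : ℂ => (2:ℂ) ^ (-(z + c - 1))) z :=
      DifferentiableAt.const_cpow (by fun_prop) (Or.inl h2)
    fun_prop
  have hRr : ∀ s > s1, R s = ((M * (s + c - 1) * 2 ^ (-s) + li 2 * 2 ^ (-(s + c - 1))
      + (KK (s + c - 1) + Real.log (s + c - 1 - 1)) : ℝ) : ℂ) := by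
    intro s hs
    have h := hEv (s + c - 1) (by linarith)
    simp only [hR]
    push_cast at h ⊢
    rw [h, Complex.ofReal_cpow (by norm_num), Complex.ofReal_cpow (by norm_num)]
    push_cast
    ring
  have hz1 : ∀ s > s1, Real.log (riemannZeta₁ ((s + c - 1 : ℝ) : ℂ)).re =
      Real.log (s + c - 1 - 1) + Real.log (riemannZeta ((s + c - 1 : ℝ) : ℂ)).re := by
    intro s hs
    have hw : 1 < s + c - 1 := by linarith
    have hp := zeta1_pos (w := s + c - 1) (by linarith)
    rw [zeta1_of_gt hw, Complex.ofReal_re] at hp ⊢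
    have h1 : 0 < s + c - 1 - 1 := by linarith
    rw [Real.log_mul h1.ne' (pos_of_mul_pos_right hp h1.le).ne']
  have hmgf : ∀ s > s1, s * (s + c - 1) * ProbabilityTheory.mgf Y (dm 2 ρ) s =
      (R s).re - Real.log (riemannZeta₁ ((s + c - 1 : ℝ) : ℂ)).re := by
    intro s hs
    have hs0 : 0 < s := by linarith
    rw [hY, dm_mgf (by norm_num) hρm hρ0, ← setIntegral_congr_fun measurableSet_Ioi (hρe s),
      integral_sub (hMi s hs0) (hfub s hs).1, integral_const_mul,
      integral_Ioi_rpow_of_lt (by linarith) two_pos, hRr s hs, Complex.ofReal_re, hz1 s hs]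
    have h1 := (hfub s hs).2
    have h2 := phi_mellin (c := c) (s := s) (by linarith)
    rw [← h1] at h2
    rw [show -s - 1 + 1 = -s by ring, neg_div_neg_eq]
    have h3 : s * (M * (2 ^ (-s) / s)) = M * 2 ^ (-s) := by field_simp
    linear_combination (s + c - 1) * h3 - h2
  -- Landau
  set s0 : ℝ := max 0 (1 - c) with hs0d
  have hs0a : 0 ≤ s0 := le_max_left _ _
  have hs0b : 1 - c ≤ s0 := le_max_right _ _
  set H : ℝ → ℝ := fun s => ((R s).re - Real.log (riemannZeta₁ ((s:ℂ) + c - 1)).re) /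
    (s * (s + c - 1)) with hH
  have hcast : ∀ s : ℝ, (s:ℂ) + c - 1 = ((s + c - 1 : ℝ) : ℂ) := fun s => by push_cast; ring
  have hHa : AnalyticOnNhd ℝ H (Set.Ioi s0) := by
    intro s hs
    have hs' : s0 < s := hs
    have a1 : AnalyticAt ℝ (fun s : ℝ => (R s).re) s := AnalyticAt.re_ofReal (hRd.analyticAt _)
    have hd : Differentiable ℂ (fun z : ℂ => riemannZeta₁ (z + c - 1)) :=
      differentiable_riemannZeta₁.comp (by fun_prop)
    have a2 : AnalyticAt ℝ (fun s : ℝ => (riemannZeta₁ ((s:ℂ) + c - 1)).re) s :=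
      AnalyticAt.re_ofReal (f := fun z : ℂ => riemannZeta₁ (z + c - 1)) (hd.analyticAt _)
    have hp : 0 < (riemannZeta₁ ((s:ℂ) + c - 1)).re := by
      rw [hcast]; exact zeta1_pos (by linarith)
    have a3 := a2.log hp
    have hne : s * (s + c - 1) ≠ 0 := mul_ne_zero (by linarith) (by linarith)
    exact (a1.sub a3).div (by fun_prop) hne
  have hall := landau (μ := dm 2 ρ) (Y := Y) (s0 := s0) (s1 := s1) (H := H)
    (dm_ae (by norm_num)) (Real.measurable_log.neg.aemeasurable) hIntr hHa (by
      intro s hs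
      have hne : s * (s + c - 1) ≠ 0 := mul_ne_zero (by linarith) (by linarith)
      simp only [hH]
      rw [eq_div_iff hne, hcast, ← hmgf s hs]
      ring)
  -- the identity theorem
  set U : Set ℂ := {z | s0 < z.re} with hU
  have hUc : IsPreconnected U := (convex_halfSpace_re_gt s0).isPreconnected
  have hUo : IsOpen U := isOpen_lt continuous_const Complex.continuous_re
  have hsub : U ⊆ {z | z.re ∈ interior (ProbabilityTheory.integrableExpSet Y (dm 2 ρ))} := by
    intro z hz
    exact interior_maximal (fun v hv => hall v hv) isOpen_Ioi hz
  have hcm : AnalyticOnNhd ℂ (ProbabilityTheory.complexMGF Y (dm 2 ρ)) U :=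
    ProbabilityTheory.analyticOnNhd_complexMGF.mono hsub
  have key : Set.EqOn (fun z => Complex.exp (R z - z * (z + c - 1) *
      ProbabilityTheory.complexMGF Y (dm 2 ρ) z)) (fun z => riemannZeta₁ (z + c - 1)) U := by
    have hs01 : s0 < s1 + 1 := max_lt (by linarith) (by linarith)
    refine AnalyticOnNhd.eqOn_of_preconnected_of_frequently_eq (z₀ := ((s1 + 1 : ℝ) : ℂ))
      ?_ ?_ hUc (by simpa [hU] using hs01) ?_
    · intro z hz
      have b1 := hcm z hz
      have b2 : AnalyticAt ℂ R z := hRd.analyticAt z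
      fun_prop
    · intro z _
      have hd : Differentiable ℂ (fun z : ℂ => riemannZeta₁ (z + c - 1)) :=
        differentiable_riemannZeta₁.comp (by fun_prop)
      exact hd.analyticAt z
    · have ht : Tendsto (fun x : ℝ => (x:ℂ)) (nhdsWithin (s1 + 1) {s1 + 1}ᶜ)
          (nhdsWithin ((s1 + 1 : ℝ) : ℂ) {((s1 + 1 : ℝ) : ℂ)}ᶜ) := by
        refine tendsto_nhdsWithin_iff.2 ⟨Complex.continuous_ofReal.continuousAt.mono_left
          nhdsWithin_le_nhds, ?_⟩
        filter_upwards [self_mem_nhdsWithin] with x hx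
        simpa only [Set.mem_compl_iff, Set.mem_singleton_iff, Complex.ofReal_inj] using hx
      refine ht.frequently (Eventually.frequently ?_)
      filter_upwards [nhdsWithin_le_nhds (Ioi_mem_nhds (show s1 < s1 + 1 by linarith))] with s hs
      have hs' : s1 < s := hs
      have h1 := hmgf s hs
      have hp := zeta1_pos (w := s + c - 1) (by linarith)
      have hreal : riemannZeta₁ ((s + c - 1 : ℝ) : ℂ) =
          ((riemannZeta₁ ((s + c - 1 : ℝ) : ℂ)).re : ℂ) := by
        rw [zeta1_of_gt (by linarith), Complex.ofReal_re]
      have hRre : R s = ((R s).re : ℂ) := by rw [hRr s hs, Complex.ofReal_re]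
      have h2 : (R s).re - s * (s + c - 1) * ProbabilityTheory.mgf Y (dm 2 ρ) s =
          Real.log (riemannZeta₁ ((s + c - 1 : ℝ) : ℂ)).re := by linarith
      rw [ProbabilityTheory.complexMGF_ofReal, hcast, hRre, hreal, ← Complex.ofReal_mul,
        ← Complex.ofReal_mul, ← Complex.ofReal_sub, h2, ← Complex.ofReal_exp, Real.exp_log hp]
  -- a zero of `ζ` to the right of `max 0 (c - 1)`
  have hne : {r : ℝ | ∃ s : ℂ, riemannZeta s = 0 ∧ s.re = r}.Nonempty := by
    by_contra h
    rw [Set.not_nonempty_iff_eq_empty] at h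
    rw [omegaZ, h, Real.sSup_empty] at homega
    norm_num at homega
  have hlt : max 0 (c - 1) < sSup {r : ℝ | ∃ s : ℂ, riemannZeta s = 0 ∧ s.re = r} := by
    have : omegaZ = sSup {r : ℝ | ∃ s : ℂ, riemannZeta s = 0 ∧ s.re = r} := rfl
    rw [← this]
    exact max_lt (by linarith) (by linarith)
  obtain ⟨r, ⟨z, hz, rfl⟩, hr⟩ := exists_lt_of_lt_csSup hne hlt
  have hr0 : 0 < z.re := lt_of_le_of_lt (le_max_left _ _) hr
  have hr1 : c - 1 < z.re := lt_of_le_of_lt (le_max_right _ _) hr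
  have hz1 : z ≠ 1 := by rintro rfl; exact riemannZeta_one_ne_zero hz
  have hzz : riemannZeta₁ z = 0 := by
    have h := riemannZeta_eq_inv_sub_mul hz1
    rw [hz] at h
    rcases mul_eq_zero.1 h.symm with h' | h'
    · exact absurd (inv_eq_zero.1 h') (sub_ne_zero.2 hz1)
    · exact h'
  have hmem : z - c + 1 ∈ U := by
    simp only [hU, Set.mem_ofPred_eq, Complex.add_re, Complex.sub_re, Complex.ofReal_re,
      Complex.one_re]
    exact max_lt (by linarith) (by linarith)
  have hfin := key hmem
  simp only [show z - c + 1 + c - 1 = z by ring] at hfin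
  rw [hzz] at hfin
  exact Complex.exp_ne_zero _ hfin
end

section
/- Suppose 1/2 < ω ≤ 1, where ω = sup{Re(s) : ζ(s) = 0}, and let c be a real number with c < 1 + ω. Then there exist arbitrarily large x such that ∫_2^x (ψ(t) − t)/t^c dt > 0. -/
open MeasureTheory Filter

/-- `psi x = ∑_{p^m ≤ x} log p`, the Chebyshev psi function. -/
noncomputable def psi (x : ℝ) : ℝ :=
  ∑ n ∈ Finset.Icc 1 ⌊x⌋₊, ArithmeticFunction.vonMangoldt n

open scoped Topology

namespace PsiAux
open ProbabilityTheory

lemma landau {Ω : Type*} [MeasurableSpace Ω] {μ : Measure Ω} {X : Ω → ℝ}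
    (hXm : AEMeasurable X μ) (hX : ∀ᵐ x ∂μ, 0 ≤ X x) {φ : ℝ → ℝ} {b t0 : ℝ}
    (hφ : ∀ t < b, AnalyticAt ℝ φ t)
    (ht0 : ∀ t < t0, t ∈ integrableExpSet X μ) (heq : ∀ t < t0, φ t = mgf X μ t) :
    ∀ t < b, t ∈ integrableExpSet X μ := by
  have hdown : ∀ t ∈ integrableExpSet X μ, ∀ u ≤ t, u ∈ integrableExpSet X μ := by
    intro t ht u hu
    refine Integrable.mono' (ht : Integrable (fun ω ↦ Real.exp (t * X ω)) μ) ?_ ?_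
    · exact (Real.measurable_exp.comp_aemeasurable (hXm.const_mul u)).aestronglyMeasurable
    · filter_upwards [hX] with x hx
      rw [Real.norm_eq_abs, abs_of_pos (Real.exp_pos _)]
      exact Real.exp_le_exp.2 (mul_le_mul_of_nonneg_right hu hx)
  by_contra! hcon
  obtain ⟨b', hb', hb'S⟩ := hcon
  set S := integrableExpSet X μ with hS
  have hne : S.Nonempty := ⟨t0 - 1, ht0 _ (by linarith)⟩
  have hub : ∀ t ∈ S, t ≤ b' := fun t ht => by
    by_contra! h
    exact hb'S (hdown t ht _ h.le)
  have hbdd : BddAbove S := ⟨b', hub⟩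
  set σ := sSup S with hσ
  have hσb : σ < b := (csSup_le hne hub).trans_lt hb'
  have hlow : ∀ t < σ, t ∈ S := fun t ht => by
    obtain ⟨u, hu, htu⟩ := exists_lt_of_lt_csSup hne ht
    exact hdown u hu t htu.le
  have hint : Set.Iio σ ⊆ interior S := interior_maximal hlow isOpen_Iio
  have heqσ : Set.EqOn φ (mgf X μ) (Set.Iio σ) := by
    have h1 : AnalyticOnNhd ℝ φ (Set.Iio σ) := fun t ht => hφ t (lt_trans ht hσb)
    have h2 : AnalyticOnNhd ℝ (mgf X μ) (Set.Iio σ) := fun t ht => analyticAt_mgf (hint ht)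
    refine h1.eqOn_of_preconnected_of_eventuallyEq h2 (isPreconnected_Iio)
      (z₀ := min t0 σ - 1) ?_ ?_
    · simp only [Set.mem_Iio]; linarith [min_le_right t0 σ]
    · have : min t0 σ - 1 < t0 := by linarith [min_le_left t0 σ]
      filter_upwards [isOpen_Iio.mem_nhds this] with t ht using heq t ht
  obtain ⟨p, r, hp⟩ := hφ σ hσb
  obtain ⟨ε, hε0, hεr⟩ : ∃ ε : ℝ, 0 < ε ∧ ENNReal.ofReal (4 * ε) < r := by
    rcases ENNReal.lt_iff_exists_nnreal_btwn.1 hp.r_pos with ⟨q, hq0, hqr⟩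
    refine ⟨q / 4, ?_, ?_⟩
    · have : (0 : ℝ) < q := by exact_mod_cast hq0
      positivity
    · rw [mul_div_cancel₀ _ (by norm_num : (4:ℝ) ≠ 0)]
      simpa using hqr
  have hnorm : (‖(-ε : ℝ)‖₊ : ENNReal) = ENNReal.ofReal ε := by
    rw [nnnorm_neg, ← enorm_eq_nnnorm, Real.enorm_eq_ofReal hε0.le]
  have hlt : (‖(-ε : ℝ)‖₊ : ENNReal) < r := by
    rw [hnorm]
    exact (ENNReal.ofReal_le_ofReal (by linarith)).trans_lt hεr
  have hq := hp.changeOrigin hlt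
  set s1 := σ + -ε with hs1
  have hs1σ : s1 < σ := by linarith
  have hm := hasFPowerSeriesAt_mgf (hint hs1σ)
  have hq' : HasFPowerSeriesAt (mgf X μ) (p.changeOrigin (-ε)) s1 :=
    hq.hasFPowerSeriesAt.congr (by
      filter_upwards [isOpen_Iio.mem_nhds hs1σ] with t ht using heqσ ht)
  have hqe := hq'.eq_formalMultilinearSeries hm
  rw [hqe, hnorm] at hq
  have hball : (2 * ε : ℝ) ∈ Metric.eball (0 : ℝ) (r - ENNReal.ofReal ε) := by
    rw [Metric.mem_eball, edist_zero_right, Real.enorm_eq_ofReal (by positivity)]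
    refine lt_of_lt_of_le ?_ (tsub_le_tsub_right hεr.le _)
    rw [← ENNReal.ofReal_sub _ hε0.le]
    exact (ENNReal.ofReal_lt_ofReal_iff (by linarith)).2 (by linarith)
  have hsum := (hq.hasSum hball).summable
  have hsum' : Summable fun n : ℕ => ∫ ω, (2 * ε) ^ n / (n.factorial : ℝ) * (X ω ^ n * Real.exp (s1 * X ω)) ∂μ := by
    refine hsum.congr fun n => ?_
    rw [integral_const_mul]
    simp [FormalMultilinearSeries.ofScalars, smul_eq_mul]
    ring
  have hintn : ∀ n : ℕ, Integrable (fun ω => (2 * ε) ^ n / (n.factorial : ℝ) * (X ω ^ n * Real.exp (s1 * X ω))) μ :=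
    fun n => (integrable_pow_mul_exp_of_mem_interior_integrableExpSet (hint hs1σ) n).const_mul _
  have hnn : ∀ n : ℕ, ∀ᵐ ω ∂μ, 0 ≤ (2 * ε) ^ n / (n.factorial : ℝ) * (X ω ^ n * Real.exp (s1 * X ω)) := by
    intro n
    filter_upwards [hX] with ω hω
    positivity
  have hmem : σ + ε ∈ S := by
    change Integrable (fun ω ↦ Real.exp ((σ + ε) * X ω)) μ
    refine ⟨(Real.measurable_exp.comp_aemeasurable (hXm.const_mul _)).aestronglyMeasurable, ?_⟩
    rw [hasFiniteIntegral_iff_ofReal (Eventually.of_forall fun _ => (Real.exp_pos _).le)]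
    have : ∫⁻ ω, ENNReal.ofReal (Real.exp ((σ + ε) * X ω)) ∂μ =
        ∑' n : ℕ, ∫⁻ ω, ENNReal.ofReal ((2 * ε) ^ n / (n.factorial : ℝ) * (X ω ^ n * Real.exp (s1 * X ω))) ∂μ := by
      rw [← lintegral_tsum fun n => (hintn n).aemeasurable.ennreal_ofReal]
      refine lintegral_congr_ae ?_
      filter_upwards [ae_all_iff.2 hnn] with ω hω
      have hs : HasSum (fun n : ℕ => (2 * ε) ^ n / (n.factorial : ℝ) * (X ω ^ n * Real.exp (s1 * X ω)))
          (Real.exp ((σ + ε) * X ω)) := by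
        have h1 : (σ + ε) * X ω = 2 * ε * X ω + s1 * X ω := by rw [hs1]; ring
        rw [h1, Real.exp_add]
        have h2 := (NormedSpace.expSeries_div_hasSum_exp (𝔸 := ℝ) (2 * ε * X ω)).mul_right (Real.exp (s1 * X ω))
        rw [← Real.exp_eq_exp_ℝ] at h2
        refine h2.congr_fun ?_
        intro n
        rw [mul_pow]; ring
      rw [← hs.tsum_eq, ENNReal.ofReal_tsum_of_nonneg hω hs.summable]
    rw [this]
    simp_rw [← fun n => ofReal_integral_eq_lintegral_ofReal (hintn n) (hnn n)]
    rw [← ENNReal.ofReal_tsum_of_nonneg (fun n => integral_nonneg_of_ae (hnn n)) hsum']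
    exact ENNReal.ofReal_lt_top
  have := le_csSup hbdd hmem
  linarith

/-- `(s-1) ζ(s)`. -/
noncomputable def Z : ℂ → ℂ := Function.update (fun s => (s - 1) * riemannZeta s) 1 1

lemma Z_one : Z 1 = 1 := by simp [Z]

lemma Z_of_ne {s : ℂ} (hs : s ≠ 1) : Z s = (s - 1) * riemannZeta s := by simp [Z, hs]

lemma Z_diff : Differentiable ℂ Z := by
  intro s
  rcases eq_or_ne s 1 with rfl | hs
  · refine (Complex.analyticAt_of_differentiable_on_punctured_nhds_of_continuousAt ?_ ?_).differentiableAt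
    · filter_upwards [self_mem_nhdsWithin] with t ht
      have h : DifferentiableAt ℂ (fun s => (s - 1) * riemannZeta s) t :=
        ((differentiableAt_id.sub_const 1).mul (differentiableAt_riemannZeta ht))
      refine h.congr_of_eventuallyEq ?_
      filter_upwards [isOpen_ne.mem_nhds ht] with u hu using Z_of_ne hu
    · simpa only [Z, continuousAt_update_same] using riemannZeta_residue_one
  · have h : DifferentiableAt ℂ (fun s => (s - 1) * riemannZeta s) s :=
        ((differentiableAt_id.sub_const 1).mul (differentiableAt_riemannZeta hs))
    refine h.congr_of_eventuallyEq ?_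
    filter_upwards [isOpen_ne.mem_nhds hs] with u hu using Z_of_ne hu

lemma zero_contra {U : Set ℂ} (hU : IsOpen U) {N : ℂ → ℂ} (hN : DifferentiableOn ℂ N U)
    {ρ : ℂ} (hρ : ρ ∈ U) (hz : Z ρ = 0) (hode : ∀ w ∈ U, deriv Z w = N w * Z w) : False := by
  have hZ : AnalyticAt ℂ Z ρ := Z_diff.analyticAt ρ
  have hNa : AnalyticAt ℂ N ρ := hN.analyticAt (hU.mem_nhds hρ)
  have h1 := hZ.analyticOrderAt_deriv_add_one
  have h2 : analyticOrderAt (deriv Z) ρ = analyticOrderAt N ρ + analyticOrderAt Z ρ := by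
    rw [← analyticOrderAt_mul hNa hZ]
    refine analyticOrderAt_congr ?_
    filter_upwards [hU.mem_nhds hρ] with w hw using hode w hw
  have h3 : analyticOrderAt Z ρ = ⊤ := by
    by_contra h
    rw [h2] at h1
    simp only [hz, sub_zero] at h1
    generalize analyticOrderAt N ρ = a at *
    generalize analyticOrderAt Z ρ = n at *
    lift n to ℕ using h
    induction a using ENat.recTopCoe with
    | top => simp at h1
    | coe a => norm_cast at h1; omega
  have h4 : AnalyticOnNhd ℂ Z Set.univ := fun z _ => Z_diff.analyticAt z
  have h5 := h4.eqOn_zero_of_preconnected_of_eventuallyEq_zero isPreconnected_univ (Set.mem_univ ρ)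
    (analyticOrderAt_eq_top.1 h3)
  have := h5 (Set.mem_univ 1)
  simp [Z_one] at this

lemma floor_sum (t : ℝ) : (∑ _k ∈ Finset.Icc 1 ⌊t⌋₊, ((1 : ℝ) : ℂ)) = ((⌊t⌋₊ : ℝ) : ℂ) := by
  simp

/-- fractional part, cut off to `(1, ∞)` -/
noncomputable def fr : ℝ → ℂ := (Set.Ioi (1:ℝ)).indicator (fun x => ((Int.fract x : ℝ) : ℂ))

lemma norm_fr_le (x : ℝ) : ‖fr x‖ ≤ 1 := by
  unfold fr
  by_cases hx : x ∈ Set.Ioi (1:ℝ)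
  · rw [Set.indicator_of_mem hx, Complex.norm_real, Real.norm_eq_abs, abs_of_nonneg (Int.fract_nonneg x)]
    exact (Int.fract_lt_one x).le
  · rw [Set.indicator_of_notMem hx]; simp

lemma fr_meas : Measurable fr :=
  (Complex.measurable_ofReal.comp measurable_fract).indicator measurableSet_Ioi

lemma fr_locInt : LocallyIntegrableOn fr (Set.Ioi 0) := by
  apply LocallyIntegrable.locallyIntegrableOn
  refine (locallyIntegrable_const (1 : ℝ)).mono fr_meas.aestronglyMeasurable ?_
  exact Eventually.of_forall fun x => by simpa using norm_fr_le x

lemma fr_top : fr =O[atTop] (fun x : ℝ => x ^ (-(0:ℝ))) := by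
  refine Asymptotics.IsBigO.of_bound 1 (Eventually.of_forall fun x => ?_)
  simpa using norm_fr_le x

lemma bot_of_indicator (f : ℝ → ℂ) (b : ℝ) {a : ℝ} (ha : 0 < a) {S : Set ℝ} (hS : S ⊆ Set.Ioi a) :
    (S.indicator f) =O[𝓝[>] 0] (fun x : ℝ => x ^ (-b)) := by
  refine Asymptotics.IsBigO.of_bound 1 ?_
  filter_upwards [nhdsWithin_le_nhds (isOpen_Iio.mem_nhds ha)] with x hx
  rw [Set.indicator_of_notMem (fun h => lt_asymm (Set.mem_Ioi.1 (hS h)) (Set.mem_Iio.1 hx))]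
  simp

lemma mellin_fr_conv {s : ℂ} (hs : 0 < s.re) : MellinConvergent fr (-s) :=
  mellinConvergent_of_isBigO_rpow fr_locInt fr_top (by simpa using hs)
    (bot_of_indicator _ (-s.re - 1) one_pos subset_rfl) (by simp)

lemma mellin_fr_diff {s : ℂ} (hs : 0 < s.re) : DifferentiableAt ℂ (fun s => mellin fr (-s)) s := by
  have h : DifferentiableAt ℂ (mellin fr) (-s) :=
    mellin_differentiableAt_of_isBigO_rpow fr_locInt fr_top (by simpa using hs)
    (bot_of_indicator _ (-s.re - 1) one_pos subset_rfl) (by simp)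
  exact h.comp s differentiableAt_id.neg

lemma mellin_fr_eq (s : ℂ) : mellin fr s = ∫ t in Set.Ioi (1:ℝ), ((Int.fract t : ℝ) : ℂ) * (t : ℂ) ^ (s - 1) := by
  rw [mellin]
  have : ∀ t : ℝ, (t : ℂ) ^ (s - 1) • fr t =
      (Set.Ioi (1:ℝ)).indicator (fun t : ℝ => ((Int.fract t : ℝ) : ℂ) * (t : ℂ) ^ (s - 1)) t := by
    intro t
    unfold fr
    by_cases hx : t ∈ Set.Ioi (1:ℝ)
    · simp only [Set.indicator_of_mem hx, smul_eq_mul, mul_comm]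
    · simp only [Set.indicator_of_notMem hx, smul_zero]
  simp_rw [this]
  rw [setIntegral_indicator measurableSet_Ioi]
  congr 2
  ext x; simp only [Set.mem_inter_iff, Set.mem_Ioi]; constructor
  · exact fun h => h.2
  · exact fun h => ⟨by linarith, h⟩

lemma Z_eq_of_one_lt {s : ℂ} (hs : 1 < s.re) : Z s = s - s * (s - 1) * mellin fr (-s) := by
  have hs1 : s ≠ 1 := by rintro rfl; simp at hs
  have hs0 : s - 1 ≠ 0 := sub_ne_zero.2 hs1
  have h1 := LSeries_eq_mul_integral_of_nonneg (fun _ => (1:ℝ)) (zero_le_one) hs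
    (by
      refine Asymptotics.IsBigO.of_bound 1 (Eventually.of_forall fun n => ?_)
      simp) (fun _ => zero_le_one)
  have h2 : LSeries (fun _ => ((1:ℝ) : ℂ)) s = riemannZeta s := by
    rw [← LSeries_one_eq_riemannZeta hs]
    simp
    rfl
  rw [h2] at h1
  have h3 : ∫ t in Set.Ioi (1 : ℝ), (∑ k ∈ Finset.Icc 1 ⌊t⌋₊, ((1 : ℝ) : ℂ)) * (t:ℂ) ^ (-(s + 1))
      = (∫ t in Set.Ioi (1:ℝ), (t:ℂ) ^ (-s)) - mellin fr (-s) := by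
    rw [mellin_fr_eq, ← integral_sub]
    · refine setIntegral_congr_fun measurableSet_Ioi fun t ht => ?_
      have ht0 : (0:ℝ) < t := lt_trans one_pos (Set.mem_Ioi.1 ht)
      have htc : (t : ℂ) ≠ 0 := by exact_mod_cast ht0.ne'
      rw [floor_sum]
      have e1 : ((⌊t⌋₊ : ℝ) : ℂ) = t - (Int.fract t : ℝ) := by
        rw [← Complex.ofReal_sub, Int.self_sub_fract, natCast_floor_eq_intCast_floor ht0.le]
      have e2 : (t:ℂ) ^ (-s) = t * (t:ℂ) ^ (-(s+1)) := by
        rw [show -s = 1 + -(s+1) by ring, Complex.cpow_add _ _ htc, Complex.cpow_one]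
      rw [e1, e2, show -s - 1 = -(s+1) by ring]; ring
    · exact integrableOn_Ioi_cpow_of_lt (by simpa using hs) one_pos
    · have := mellin_fr_conv (s := s) (by linarith)
      have h := this.mono_set (Set.Ioi_subset_Ioi zero_le_one)
      refine h.congr_fun (fun t ht => ?_) measurableSet_Ioi
      simp only [fr, Set.indicator_of_mem ht, smul_eq_mul, mul_comm]
  rw [h3, integral_Ioi_cpow_of_lt (by simpa using hs) one_pos] at h1
  rw [Z_of_ne hs1, h1]
  simp only [Complex.ofReal_one, Complex.one_cpow]
  have : -s + 1 ≠ 0 := by intro h; apply hs0; linear_combination -h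
  field_simp
  ring

lemma Z_eq {s : ℂ} (hs : 0 < s.re) : Z s = s - s * (s - 1) * mellin fr (-s) := by
  have hop : IsOpen {s : ℂ | 0 < s.re} := isOpen_lt continuous_const Complex.continuous_re
  have hop1 : IsOpen {s : ℂ | 1 < s.re} := isOpen_lt continuous_const Complex.continuous_re
  have h1 : AnalyticOnNhd ℂ Z {s : ℂ | 0 < s.re} := fun z _ => Z_diff.analyticAt z
  have h2 : AnalyticOnNhd ℂ (fun s => s - s * (s - 1) * mellin fr (-s)) {s : ℂ | 0 < s.re} := by
    refine DifferentiableOn.analyticOnNhd (fun z hz => ?_) hop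
    have := mellin_fr_diff hz
    exact (differentiableAt_id.sub ((differentiableAt_id.mul (differentiableAt_id.sub_const 1)).mul this)).differentiableWithinAt
  refine h1.eqOn_of_preconnected_of_eventuallyEq h2 (convex_halfSpace_re_gt 0).isPreconnected
    (z₀ := 2) (by simp) ?_ hs
  filter_upwards [hop1.mem_nhds (show (1:ℝ) < (2:ℂ).re by simp)] with z hz using Z_eq_of_one_lt hz

lemma Z_ne_zero {σ : ℝ} (hσ : 0 < σ) : Z (σ : ℂ) ≠ 0 := by
  rcases lt_or_ge σ 1 with h | h
  · have hre : 0 ≤ (mellin fr (-(σ:ℂ))).re := by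
      rw [mellin_fr_eq]
      have : ∫ t in Set.Ioi (1:ℝ), ((Int.fract t : ℝ) : ℂ) * (t : ℂ) ^ (-(σ:ℂ) - 1)
          = ((∫ t in Set.Ioi (1:ℝ), Int.fract t * t ^ (-σ - 1) : ℝ) : ℂ) := by
        rw [← integral_complex_ofReal]
        refine setIntegral_congr_fun measurableSet_Ioi fun t ht => ?_
        have ht0 : (0:ℝ) < t := lt_trans one_pos (Set.mem_Ioi.1 ht)
        rw [Complex.ofReal_mul, Complex.ofReal_cpow ht0.le]
        push_cast; rfl
      rw [this, Complex.ofReal_re]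
      refine setIntegral_nonneg measurableSet_Ioi fun t ht => ?_
      have ht0 : (0:ℝ) < t := lt_trans one_pos (Set.mem_Ioi.1 ht)
      exact mul_nonneg (Int.fract_nonneg _) (Real.rpow_nonneg ht0.le _)
    intro hz
    rw [Z_eq (by simpa using hσ)] at hz
    have h2 := congrArg Complex.re hz
    have e : (σ:ℂ) * (σ - 1) = ((σ * (σ - 1) : ℝ) : ℂ) := by push_cast; ring
    rw [e, Complex.sub_re, Complex.re_ofReal_mul, Complex.ofReal_re, Complex.zero_re] at h2
    nlinarith [mul_nonneg (mul_nonneg hσ.le (sub_nonneg.2 h.le)) hre]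
  · rcases eq_or_ne (σ:ℂ) 1 with h1 | h1
    · rw [h1, Z_one]; exact one_ne_zero
    · rw [Z_of_ne h1]
      exact mul_ne_zero (sub_ne_zero.2 h1) (riemannZeta_ne_zero_of_one_le_re (by simpa using h))

lemma fubini_step {g : ℝ → ℝ} (hg : Measurable g) {s : ℝ} (hs : 0 < s)
    (hi : IntegrableOn (fun t => g t * t ^ (-s)) (Set.Ioi 2)) :
    IntegrableOn (fun x => (∫ t in (2:ℝ)..x, g t) * x ^ (-s - 1)) (Set.Ioi 2) ∧
    ∫ x in Set.Ioi (2:ℝ), (∫ t in (2:ℝ)..x, g t) * x ^ (-s - 1)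
      = (1 / s) * ∫ t in Set.Ioi (2:ℝ), g t * t ^ (-s) := by
  set ν := (volume : Measure ℝ).restrict (Set.Ioi 2) with hν
  set k : ℝ × ℝ → ℝ := {p : ℝ × ℝ | p.1 ≤ p.2}.indicator (fun p => g p.1 * p.2 ^ (-s - 1)) with hk
  have hkm : Measurable k := by
    refine Measurable.indicator ?_ (measurableSet_le measurable_fst measurable_snd)
    exact (hg.comp measurable_fst).mul (measurable_snd.pow_const _)
  have hk1 : ∀ t x, k (t, x) = (Set.Ici t).indicator (fun x => g t * x ^ (-s - 1)) x := by
    intro t x; simp only [hk, Set.indicator, Set.mem_ofPred_eq, Set.mem_Ici]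
  have hk2 : ∀ t x, k (t, x) = (Set.Iic x).indicator (fun t => g t * x ^ (-s - 1)) t := by
    intro t x; simp only [hk, Set.indicator, Set.mem_ofPred_eq, Set.mem_Iic]
  have hset : ∀ t ∈ Set.Ioi (2:ℝ), Set.Ioi 2 ∩ Set.Ici t = Set.Ici t := by
    intro t ht; apply Set.inter_eq_right.2
    intro x hx; exact Set.mem_Ioi.2 (lt_of_lt_of_le (Set.mem_Ioi.1 ht) (Set.mem_Ici.1 hx))
  have hpow : ∀ t ∈ Set.Ioi (2:ℝ), ∫ x in Set.Ici t, x ^ (-s - 1) = t ^ (-s) / s := by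
    intro t ht
    have ht0 : (0:ℝ) < t := lt_trans two_pos (Set.mem_Ioi.1 ht)
    rw [integral_Ici_eq_integral_Ioi, integral_Ioi_rpow_of_lt (by linarith) ht0]
    rw [show -s - 1 + 1 = -s by ring]; field_simp
  have hpowi : ∀ t ∈ Set.Ioi (2:ℝ), IntegrableOn (fun x : ℝ => x ^ (-s - 1)) (Set.Ici t) := by
    intro t ht
    have ht0 : (0:ℝ) < t := lt_trans two_pos (Set.mem_Ioi.1 ht)
    rw [integrableOn_Ici_iff_integrableOn_Ioi]
    exact integrableOn_Ioi_rpow_of_lt (by linarith) ht0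
  have hkint : Integrable k (ν.prod ν) := by
    rw [integrable_prod_iff hkm.aestronglyMeasurable]
    constructor
    · rw [hν]
      filter_upwards [ae_restrict_mem measurableSet_Ioi] with t ht
      simp_rw [hk1]
      rw [integrable_indicator_iff measurableSet_Ici, IntegrableOn, Measure.restrict_restrict measurableSet_Ici,
        Set.inter_comm, hset t ht]
      exact (hpowi t ht).const_mul _
    · have : (fun t => (1 / s) * |g t * t ^ (-s)|) =ᵐ[ν] fun t => ∫ x, ‖k (t, x)‖ ∂ν := by
        rw [hν]
        filter_upwards [ae_restrict_mem measurableSet_Ioi] with t ht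
        have ht0 : (0:ℝ) < t := lt_trans two_pos (Set.mem_Ioi.1 ht)
        simp_rw [hk1, norm_indicator_eq_indicator_norm]
        rw [setIntegral_indicator measurableSet_Ici, hset t ht]
        have : ∫ x in Set.Ici t, ‖g t * x ^ (-s - 1)‖ = ∫ x in Set.Ici t, |g t| * x ^ (-s - 1) := by
          refine setIntegral_congr_fun measurableSet_Ici fun x hx => ?_
          have hx0 : (0:ℝ) < x := lt_of_lt_of_le ht0 (Set.mem_Ici.1 hx)
          simp only [norm_mul, Real.norm_eq_abs, abs_of_pos (Real.rpow_pos_of_pos hx0 _)]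
        rw [this, integral_const_mul, hpow t ht, abs_mul, abs_of_pos (Real.rpow_pos_of_pos ht0 _)]
        field_simp
      refine Integrable.congr ?_ this
      exact (Integrable.abs hi).const_mul _
  have hinner : ∀ x ∈ Set.Ioi (2:ℝ), ∫ t, k (t, x) ∂ν = (∫ t in (2:ℝ)..x, g t) * x ^ (-s - 1) := by
    intro x hx
    simp_rw [hk2]
    rw [hν, setIntegral_indicator measurableSet_Iic, Set.Ioi_inter_Iic, integral_mul_const,
      intervalIntegral.integral_of_le (le_of_lt (Set.mem_Ioi.1 hx))]
  constructor
  · have := hkint.integral_prod_right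
    exact IntegrableOn.congr_fun this (fun x hx => hinner x hx) measurableSet_Ioi
  · rw [← setIntegral_congr_fun measurableSet_Ioi (fun x hx => hinner x hx)]
    have := integral_integral_swap (f := fun t x => k (t, x)) (μ := ν) (ν := ν) hkint
    rw [← hν, ← this, ← integral_const_mul]
    refine setIntegral_congr_fun measurableSet_Ioi fun t ht => ?_
    simp_rw [hk1]
    rw [hν, setIntegral_indicator measurableSet_Ici, hset t ht, integral_const_mul, hpow t ht]
    ring

lemma psi_eq (x : ℝ) : psi x = Chebyshev.psi x := by
  unfold psi Chebyshev.psi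
  rfl

lemma psi_mono : Monotone psi := by
  intro x y h
  rw [psi_eq, psi_eq]; exact Chebyshev.psi_mono h

lemma psi_nonneg (x : ℝ) : 0 ≤ psi x := by rw [psi_eq]; exact Chebyshev.psi_nonneg x

lemma psi_le {x : ℝ} (hx : 0 ≤ x) : psi x ≤ (Real.log 4 + 4) * x := by
  rw [psi_eq]; exact Chebyshev.psi_le_const_mul_self hx

lemma psi_zero {x : ℝ} (hx : x < 2) : psi x = 0 := by
  rw [psi_eq]; exact Chebyshev.psi_eq_zero_of_lt_two hx

lemma psi_int {w : ℝ} (hw : 1 < w) : IntegrableOn (fun t => psi t * t ^ (-(w + 1))) (Set.Ioi 2) := by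
  have h := (integrableOn_Ioi_rpow_of_lt (a := -w) (by linarith) two_pos).const_mul (Real.log 4 + 4)
  refine Integrable.mono' h ?_ ?_
  · exact (psi_mono.measurable.mul (measurable_id.pow_const _)).aestronglyMeasurable
  · filter_upwards [ae_restrict_mem measurableSet_Ioi] with t ht
    have ht0 : (0:ℝ) < t := lt_trans two_pos (Set.mem_Ioi.1 ht)
    rw [Real.norm_eq_abs, abs_of_nonneg (mul_nonneg (psi_nonneg t) (Real.rpow_nonneg ht0.le _))]
    have e : t ^ (-w) = t * t ^ (-(w + 1)) := by
      rw [show -w = 1 + -(w + 1) by ring, Real.rpow_add ht0, Real.rpow_one]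
    rw [e, ← mul_assoc]
    exact mul_le_mul_of_nonneg_right (psi_le ht0.le) (Real.rpow_nonneg ht0.le _)

lemma psi_mellin {w : ℝ} (hw : 1 < w) :
    ((∫ t in Set.Ioi (2:ℝ), psi t * t ^ (-(w + 1)) : ℝ) : ℂ)
      = -(deriv riemannZeta w / riemannZeta w) / w := by
  have hwre : 1 < (w : ℂ).re := by simpa using hw
  have h1 := LSeries_eq_mul_integral_of_nonneg (fun n => ArithmeticFunction.vonMangoldt n)
    (zero_le_one) hwre
    (by
      refine Asymptotics.IsBigO.of_bound (Real.log 4 + 4) (Eventually.of_forall fun n => ?_)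
      have h := psi_le (x := n) (Nat.cast_nonneg n)
      have h0 := psi_nonneg n
      unfold psi at h h0
      rw [Nat.floor_natCast] at h h0
      rw [Real.norm_eq_abs, abs_of_nonneg h0]
      simpa using h) (fun _ => ArithmeticFunction.vonMangoldt_nonneg)
  have h2 := ArithmeticFunction.LSeries_vonMangoldt_eq_deriv_riemannZeta_div hwre
  rw [h2] at h1
  have h3 : ∫ t in Set.Ioi (1 : ℝ), (∑ k ∈ Finset.Icc 1 ⌊t⌋₊, ((ArithmeticFunction.vonMangoldt k : ℝ) : ℂ)) * (t:ℂ) ^ (-((w:ℂ) + 1))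
      = ((∫ t in Set.Ioi (2:ℝ), psi t * t ^ (-(w + 1)) : ℝ) : ℂ) := by
    have e1 : ∫ t in Set.Ioi (2:ℝ), psi t * t ^ (-(w + 1)) = ∫ t in Set.Ioi (1:ℝ), psi t * t ^ (-(w + 1)) := by
      rw [← integral_Ici_eq_integral_Ioi]
      symm
      refine setIntegral_eq_of_subset_of_forall_sdiff_eq_zero measurableSet_Ioi ?_ ?_
      · intro x hx
        exact Set.mem_Ioi.2 (lt_of_lt_of_le one_lt_two (Set.mem_Ici.1 hx))
      · intro x hx
        rw [psi_zero, zero_mul]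
        by_contra! h
        exact hx.2 (Set.mem_Ici.2 h)
    rw [e1, ← integral_complex_ofReal]
    refine setIntegral_congr_fun measurableSet_Ioi fun t ht => ?_
    have ht0 : (0:ℝ) < t := lt_trans one_pos (Set.mem_Ioi.1 ht)
    rw [Complex.ofReal_mul, Complex.ofReal_cpow ht0.le]
    unfold psi
    push_cast; rfl
  rw [h3] at h1
  have hw0 : (w:ℂ) ≠ 0 := by
    have : w ≠ 0 := by linarith
    exact_mod_cast this
  rw [eq_div_iff hw0, mul_comm, ← h1]
  ring

lemma Z_logderiv {w : ℂ} (hw : 1 < w.re) :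
    -(deriv riemannZeta w / riemannZeta w) = 1 / (w - 1) - deriv Z w / Z w := by
  have hw1 : w ≠ 1 := by rintro rfl; simp at hw
  have h0 : w - 1 ≠ 0 := sub_ne_zero.2 hw1
  have hz : riemannZeta w ≠ 0 := riemannZeta_ne_zero_of_one_le_re hw.le
  have hd : deriv Z w = riemannZeta w + (w - 1) * deriv riemannZeta w := by
    have e : Z =ᶠ[𝓝 w] fun s => (s - 1) * riemannZeta s := by
      filter_upwards [isOpen_ne.mem_nhds hw1] with u hu using Z_of_ne hu
    rw [e.deriv_eq]
    have := ((hasDerivAt_id w).sub_const 1).mul (differentiableAt_riemannZeta hw1).hasDerivAt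
    have h := this.deriv
    simp only [id, one_mul] at h
    exact h
  rw [hd, Z_of_ne hw1]
  field_simp
  ring

/-- auxiliary function with a removable singularity at `1`. -/
noncomputable def q (w : ℂ) : ℂ := 1 / w - (2:ℂ) ^ (1 - w)

lemma q_diff {w : ℂ} (hw : w ≠ 0) : DifferentiableAt ℂ q w := by
  unfold q
  refine DifferentiableAt.sub (by fun_prop (disch := assumption)) ?_
  refine DifferentiableAt.const_cpow (by fun_prop) (Or.inl two_ne_zero)

lemma D_diff : DifferentiableOn ℂ (dslope q 1) {w | 0 < w.re} := by
  have hop : IsOpen {s : ℂ | 0 < s.re} := isOpen_lt continuous_const Complex.continuous_re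
  refine (Complex.differentiableOn_dslope (hop.mem_nhds (by simp))).2 ?_
  intro w hw
  refine (q_diff ?_).differentiableWithinAt
  rintro rfl
  simp at hw

lemma D_eq {w : ℂ} (hw : w ≠ 1) : dslope q 1 w = (1 / w - (2:ℂ) ^ (1 - w)) / (w - 1) := by
  rw [dslope_of_ne _ hw, slope_def_field]
  simp [q]

/-- continuation of the transform of `ψ(t) - t` on `(2,∞)` -/
noncomputable def K (w : ℂ) : ℂ := -(deriv Z w / Z w) / w + dslope q 1 w

lemma g_mellin {c s : ℝ} (hw : 1 < c + s - 1) :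
    IntegrableOn (fun t => (psi t - t) / t ^ c * t ^ (-s)) (Set.Ioi 2) ∧
    ((∫ t in Set.Ioi (2:ℝ), (psi t - t) / t ^ c * t ^ (-s) : ℝ) : ℂ) = K ((c + s - 1 : ℝ) : ℂ) := by
  set w := c + s - 1 with hwd
  have he : Set.EqOn (fun t => psi t * t ^ (-(w + 1)) - t ^ (-w))
      (fun t => (psi t - t) / t ^ c * t ^ (-s)) (Set.Ioi 2) := by
    intro t ht
    have ht0 : (0:ℝ) < t := lt_trans two_pos (Set.mem_Ioi.1 ht)
    have e : t ^ (-w) = t * t ^ (-(w + 1)) := by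
      rw [show -w = 1 + -(w + 1) by ring, Real.rpow_add ht0, Real.rpow_one]
    have e2 : t ^ (-(w+1)) = (t ^ c)⁻¹ * t ^ (-s) := by
      rw [show -(w+1) = -c + -s by rw [hwd]; ring, Real.rpow_add ht0, Real.rpow_neg ht0.le]
    simp only
    rw [e, e2]; ring
  have hi2 := integrableOn_Ioi_rpow_of_lt (a := -w) (by linarith) two_pos
  constructor
  · exact IntegrableOn.congr_fun ((psi_int hw).sub hi2) he measurableSet_Ioi
  · rw [← setIntegral_congr_fun measurableSet_Ioi he, integral_sub (psi_int hw) hi2,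
      integral_Ioi_rpow_of_lt (by linarith) two_pos, Complex.ofReal_sub, psi_mellin hw,
      Z_logderiv (by simpa using hw)]
    have hw1 : (w:ℂ) ≠ 1 := by
      have : w ≠ 1 := by linarith
      exact_mod_cast this
    rw [K, D_eq hw1]
    have e3 : ((2 ^ (-w + 1) : ℝ) : ℂ) = (2:ℂ) ^ (1 - (w:ℂ)) := by
      rw [Complex.ofReal_cpow two_pos.le]
      push_cast
      rw [show -(w:ℂ) + 1 = 1 - w by ring]
    rw [Complex.ofReal_div, Complex.ofReal_neg, e3]
    push_cast
    have h1 : (w:ℂ) - 1 ≠ 0 := sub_ne_zero.2 hw1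
    have h2 : -(w:ℂ) + 1 ≠ 0 := by intro h; apply h1; linear_combination -h
    have h3 : (w:ℂ) ≠ 0 := by
      have : w ≠ 0 := by linarith
      exact_mod_cast this
    rw [show -(w:ℂ) + 1 = -(w - 1) by ring, neg_div_neg_eq]
    field_simp
    ring

lemma core {c X a : ℝ} (hneg : ∀ x > X, (∫ t in (2:ℝ)..x, (psi t - t) / t ^ c) ≤ 0)
    (ha : 0 < a) (hca : c - 1 ≤ a) (ρ : ℂ) (hρ : a < ρ.re) : Z ρ ≠ 0 := by
  intro hZρ
  set g : ℝ → ℝ := fun t => (psi t - t) / t ^ c with hg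
  set F : ℝ → ℝ := fun x => ∫ t in (2:ℝ)..x, g t with hF
  set T : ℝ := max X 2 with hT
  have hT2 : 2 ≤ T := le_max_right _ _
  have hFneg : ∀ x ∈ Set.Ioi T, F x ≤ 0 := fun x hx =>
    hneg x (lt_of_le_of_lt (le_max_left _ _) (Set.mem_Ioi.1 hx))
  have hgm : Measurable g :=
    (psi_mono.measurable.sub measurable_id).div (measurable_id.pow_const c)
  have hgi : ∀ x, 2 ≤ x → IntegrableOn g (Set.uIcc 2 x) := by
    intro x hx
    rw [Set.uIcc_of_le hx]
    have h1 : IntegrableOn (fun t => psi t - t) (Set.Icc 2 x) :=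
      ((psi_mono.monotoneOn _).integrableOn_isCompact isCompact_Icc).sub
        (continuous_id.integrableOn_Icc)
    have h2 : ContinuousOn (fun t : ℝ => (t ^ c)⁻¹) (Set.Icc 2 x) := by
      refine ContinuousOn.inv₀ (continuousOn_id.rpow_const fun t ht => Or.inl ?_) fun t ht => ?_
      · have := ht.1; simp only [id]; linarith
      · have : (0:ℝ) < t := by linarith [ht.1]
        exact (Real.rpow_pos_of_pos this _).ne'
    have := h1.mul_continuousOn h2 isCompact_Icc
    simpa only [hg, div_eq_mul_inv] using this
  have hFc : ∀ x, 2 ≤ x → ContinuousOn F (Set.Icc 2 x) := by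
    intro x hx
    have := intervalIntegral.continuousOn_primitive_interval (hgi x hx)
    rwa [Set.uIcc_of_le hx] at this
  have hFc' : ContinuousOn F (Set.Ioi 2) := by
    intro x hx
    have h2 : (2:ℝ) < x := Set.mem_Ioi.1 hx
    exact ((hFc (x + 1) (by linarith)).continuousAt
      (Icc_mem_nhds h2 (by linarith))).continuousWithinAt
  -- the compact part
  set f : ℝ → ℂ := (Set.Ioc 2 T).indicator (fun x => ((F x : ℝ) : ℂ)) with hf
  have hFint : IntegrableOn (fun x => ((F x : ℝ) : ℂ)) (Set.Ioc 2 T) :=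
    ((Complex.continuous_ofReal.comp_continuousOn (hFc T hT2)).integrableOn_compact
      isCompact_Icc).mono_set Set.Ioc_subset_Icc_self
  have hfint : Integrable f := (integrable_indicator_iff measurableSet_Ioc).2 hFint
  have hEdiff : Differentiable ℂ (mellin f) := by
    intro z
    refine mellin_differentiableAt_of_isBigO_rpow (a := z.re + 1) (b := z.re - 1)
      (hfint.locallyIntegrable.locallyIntegrableOn _) ?_ (by linarith)
      (bot_of_indicator _ _ one_pos ?_) (by linarith)
    · refine Asymptotics.IsBigO.of_bound 1 ?_
      filter_upwards [eventually_gt_atTop T] with x hx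
      rw [hf, Set.indicator_of_notMem (fun h => absurd h.2 (not_le.2 hx))]
      simp
    · intro x hx
      exact Set.mem_Ioi.2 (by linarith [hx.1])
  have hEreal : ∀ t : ℝ, mellin f (t : ℂ) = ((∫ x in Set.Ioc 2 T, F x * x ^ (t - 1) : ℝ) : ℂ) := by
    intro t
    rw [mellin]
    have : ∀ x : ℝ, (x : ℂ) ^ ((t:ℂ) - 1) • f x =
        (Set.Ioc 2 T).indicator (fun x : ℝ => ((F x : ℝ) : ℂ) * (x : ℂ) ^ ((t:ℂ) - 1)) x := by
      intro x
      rw [hf]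
      by_cases hx : x ∈ Set.Ioc 2 T
      · simp only [Set.indicator_of_mem hx, smul_eq_mul, mul_comm]
      · simp only [Set.indicator_of_notMem hx, smul_zero]
    simp_rw [this]
    rw [setIntegral_indicator measurableSet_Ioc]
    have hs : Set.Ioi 0 ∩ Set.Ioc 2 T = Set.Ioc 2 T := by
      apply Set.inter_eq_right.2
      intro x hx
      exact Set.mem_Ioi.2 (by linarith [hx.1])
    rw [hs, ← integral_complex_ofReal]
    refine setIntegral_congr_fun measurableSet_Ioc fun x hx => ?_
    have hx0 : (0:ℝ) < x := by linarith [hx.1]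
    rw [Complex.ofReal_mul, Complex.ofReal_cpow hx0.le]
    push_cast; rfl
  -- the measure
  set d : ℝ → NNReal := fun x => Real.toNNReal (-F x * x⁻¹) with hd
  set μ : Measure ℝ := (volume.restrict (Set.Ioi T)).withDensity (fun x => (d x : ENNReal)) with hμ
  have hdm : AEMeasurable d (volume.restrict (Set.Ioi T)) := by
    have hc : ContinuousOn (fun x => -F x * x⁻¹) (Set.Ioi T) := by
      refine ((hFc'.mono (Set.Ioi_subset_Ioi hT2)).neg).mul
        (continuousOn_id.inv₀ fun x hx => ?_)
      have := Set.mem_Ioi.1 hx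
      simp only [id]; linarith
    exact (hc.aemeasurable measurableSet_Ioi).real_toNNReal
  have hlogpos : ∀ᵐ x ∂μ, 0 ≤ Real.log x := by
    refine (withDensity_absolutelyContinuous _ _).ae_le ?_
    filter_upwards [ae_restrict_mem measurableSet_Ioi] with x hx
    have := Set.mem_Ioi.1 hx
    exact Real.log_nonneg (by linarith)
  have hdens : ∀ t : ℝ, ∀ x ∈ Set.Ioi T, d x • Real.exp (t * Real.log x) = -(F x * x ^ (t - 1)) := by
    intro t x hx
    have hx0 : 0 < x := by linarith [Set.mem_Ioi.1 hx]
    have h1 : 0 ≤ -F x * x⁻¹ := mul_nonneg (by linarith [hFneg x hx]) (inv_nonneg.2 hx0.le)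
    rw [NNReal.smul_def, smul_eq_mul, hd, Real.coe_toNNReal _ h1, Real.rpow_sub_one hx0.ne',
      Real.rpow_def_of_pos hx0, mul_comm (Real.log x)]
    ring
  set Φ : ℂ → ℂ := fun z => mellin f z + K ((c:ℂ) - 1 - z) / z with hΦ
  set t0 : ℝ := min 0 (c - 2) with ht0
  have hkey : ∀ t < t0, t ∈ ProbabilityTheory.integrableExpSet Real.log μ ∧
      ((mgf Real.log μ t : ℝ) : ℂ) = Φ t := by
    intro t ht
    have htneg : t < 0 := lt_of_lt_of_le ht (min_le_left _ _)
    have htc : t < c - 2 := lt_of_lt_of_le ht (min_le_right _ _)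
    have hG := g_mellin (c := c) (s := -t) (by linarith)
    have hFub := fubini_step hgm (s := -t) (by linarith) hG.1
    simp only [neg_neg] at hFub hG
    have hIT : IntegrableOn (fun x => F x * x ^ (t - 1)) (Set.Ioi T) :=
      hFub.1.mono_set (Set.Ioi_subset_Ioi hT2)
    have hIc : IntegrableOn (fun x => F x * x ^ (t - 1)) (Set.Ioc 2 T) :=
      hFub.1.mono_set (fun x hx => Set.mem_Ioi.2 hx.1)
    constructor
    · change Integrable (fun x => Real.exp (t * Real.log x)) μ
      rw [hμ, integrable_withDensity_iff_integrable_smul₀ hdm]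
      exact IntegrableOn.congr_fun hIT.neg (fun x hx => (hdens t x hx).symm) measurableSet_Ioi
    · have h1 : mgf Real.log μ t = -∫ x in Set.Ioi T, F x * x ^ (t - 1) := by
        rw [mgf, hμ, integral_withDensity_eq_integral_smul₀ hdm, ← integral_neg]
        exact setIntegral_congr_fun measurableSet_Ioi fun x hx => hdens t x hx
      have h2 : ∫ x in Set.Ioi 2, F x * x ^ (t - 1) =
          (∫ x in Set.Ioc 2 T, F x * x ^ (t - 1)) + ∫ x in Set.Ioi T, F x * x ^ (t - 1) := by
        rw [← setIntegral_union (Set.Ioc_disjoint_Ioi le_rfl) measurableSet_Ioi hIc hIT,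
          Set.Ioc_union_Ioi_eq_Ioi hT2]
      have h3 := hFub.2
      change ∫ x in Set.Ioi 2, F x * x ^ (t - 1) = _ at h3
      rw [h2] at h3
      have h4 : mgf Real.log μ t = (∫ x in Set.Ioc 2 T, F x * x ^ (t - 1))
          + (∫ t_1 in Set.Ioi 2, g t_1 * t_1 ^ t) / t := by
        rw [h1, div_eq_mul_inv]
        rw [div_neg, one_div] at h3
        linear_combination (-1:ℝ) * h3
      rw [h4, hΦ]
      simp only
      rw [hEreal, Complex.ofReal_add, Complex.ofReal_div]
      have h5 := hG.2
      change ((∫ t_1 in Set.Ioi 2, g t_1 * t_1 ^ t : ℝ) : ℂ) = _ at h5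
      rw [h5]
      congr 3
      push_cast
      ring
  have hopa : IsOpen {w : ℂ | 0 < w.re} := isOpen_lt continuous_const Complex.continuous_re
  have hZ'diff : Differentiable ℂ (deriv Z) := fun w => (Z_diff.analyticAt w).deriv.differentiableAt
  have hΦan : ∀ t < c - 1 - a, AnalyticAt ℝ (fun t : ℝ => (Φ t).re) t := by
    intro t ht
    refine AnalyticAt.re_ofReal (f := Φ) ?_
    have hwpos : 0 < c - 1 - t := by linarith
    have hwe : ((c:ℂ) - 1 - t) = ((c - 1 - t : ℝ) : ℂ) := by push_cast; ring
    have hKan : AnalyticAt ℂ K ((c:ℂ) - 1 - t) := by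
      rw [hwe]
      refine AnalyticAt.add ?_ ?_
      · refine AnalyticAt.div (AnalyticAt.neg ((hZ'diff.analyticAt _).div (Z_diff.analyticAt _)
          (Z_ne_zero hwpos))) analyticAt_id ?_
        exact_mod_cast hwpos.ne'
      · exact D_diff.analyticAt (hopa.mem_nhds (by simpa using hwpos))
    refine (hEdiff.analyticAt _).add (AnalyticAt.div ?_ analyticAt_id ?_)
    · exact AnalyticAt.fun_comp (g := K) (f := fun z : ℂ => (c:ℂ) - 1 - z) hKan
        (analyticAt_const.sub analyticAt_id)
    · show (t:ℂ) ≠ 0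
      have : t ≠ 0 := by linarith
      exact_mod_cast this
  have hland := landau (μ := μ) (X := Real.log) Real.measurable_log.aemeasurable hlogpos hΦan
    (fun t ht => (hkey t ht).1) (fun t ht => by rw [← (hkey t ht).2, Complex.ofReal_re])
  have hMdiff : ∀ z : ℂ, z.re < c - 1 - a → DifferentiableAt ℂ (complexMGF Real.log μ) z := by
    intro z hz
    refine (analyticAt_complexMGF ?_).differentiableAt
    exact interior_maximal (fun t ht => hland t (Set.mem_Iio.1 ht)) isOpen_Iio (Set.mem_Iio.2 hz)
  set U : Set ℂ := {w : ℂ | a < w.re} with hU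
  have hUo : IsOpen U := isOpen_lt continuous_const Complex.continuous_re
  set N : ℂ → ℂ := fun w => w * dslope q 1 w +
    (mellin f ((c:ℂ) - 1 - w) - complexMGF Real.log μ ((c:ℂ) - 1 - w)) * ((c:ℂ) - 1 - w) * w with hN
  have hlin : Differentiable ℂ (fun w : ℂ => (c:ℂ) - 1 - w) := by fun_prop
  have hNd : DifferentiableOn ℂ N U := by
    intro w hw
    have hw' : a < w.re := hw
    refine DifferentiableAt.differentiableWithinAt ?_
    have h1 : DifferentiableAt ℂ (dslope q 1) w :=
      D_diff.differentiableAt (hopa.mem_nhds (show 0 < w.re by linarith))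
    have h2 : DifferentiableAt ℂ (fun w => mellin f ((c:ℂ) - 1 - w)) w :=
      (hEdiff.comp hlin) w
    have h3 : DifferentiableAt ℂ (fun w => complexMGF Real.log μ ((c:ℂ) - 1 - w)) w :=
      DifferentiableAt.comp w (g := complexMGF Real.log μ) (f := fun w : ℂ => (c:ℂ) - 1 - w)
        (hMdiff _ (by simp; linarith)) (hlin w)
    exact (differentiableAt_id.mul h1).add (((h2.sub h3).mul (hlin w)).mul differentiableAt_id)
  have hode : Set.EqOn (deriv Z) (fun w => N w * Z w) U := by
    have hA1 : AnalyticOnNhd ℂ (deriv Z) U := fun w _ => hZ'diff.analyticAt w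
    have hA2 : AnalyticOnNhd ℂ (fun w => N w * Z w) U :=
      (hNd.mul Z_diff.differentiableOn).analyticOnNhd hUo
    set w0 : ℝ := max a (c - 1 - t0) + 1 with hw0
    have hwa : a < w0 := by linarith [le_max_left a (c - 1 - t0)]
    have hwt : c - 1 - t0 < w0 := by linarith [le_max_right a (c - 1 - t0)]
    refine hA1.eqOn_of_preconnected_of_frequently_eq hA2 (convex_halfSpace_re_gt a).isPreconnected
      (z₀ := (w0:ℂ)) (show a < (w0:ℂ).re by simpa using hwa) ?_
    have htend : Tendsto (fun x : ℝ => (x:ℂ)) (𝓝[≠] w0) (𝓝[≠] (w0:ℂ)) := by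
      refine tendsto_nhdsWithin_of_tendsto_nhds_of_eventually_within _
        (Complex.continuous_ofReal.continuousAt.tendsto.mono_left nhdsWithin_le_nhds) ?_
      filter_upwards [self_mem_nhdsWithin] with x hx h
      exact hx (Complex.ofReal_injective h)
    refine htend.frequently (Eventually.frequently ?_)
    have hnear : ∀ᶠ x : ℝ in 𝓝[≠] w0, a < x ∧ c - 1 - t0 < x :=
      nhdsWithin_le_nhds ((isOpen_Ioi.eventually_mem (Set.mem_Ioi.2 hwa)).and
        (isOpen_Ioi.eventually_mem (Set.mem_Ioi.2 hwt)))
    filter_upwards [hnear] with x hx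
    have hk := (hkey (c - 1 - x) (by linarith [hx.2])).2
    rw [← complexMGF_ofReal] at hk
    have hx0 : 0 < x := by linarith [hx.1]
    have hxc : (x:ℂ) ≠ 0 := by exact_mod_cast hx0.ne'
    have hZx := Z_ne_zero hx0
    have he : ((c - 1 - x : ℝ) : ℂ) = (c:ℂ) - 1 - x := by push_cast; ring
    have hz0 : (c:ℂ) - 1 - x ≠ 0 := by
      rw [← he]
      have : c - 1 - x ≠ 0 := by linarith [hx.1]
      exact_mod_cast this
    rw [he] at hk
    simp only [hN]
    rw [hk, hΦ]
    simp only
    rw [sub_sub_cancel, K]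
    generalize (c:ℂ) - 1 - x = z at *
    field_simp
    ring
  exact zero_contra hUo hNd (show a < ρ.re from hρ) hZρ hode

end PsiAux

theorem integral_psi_sub_id_div_rpow_pos_frequently
    (homega : 1 / 2 < omegaZ) (homega' : omegaZ ≤ 1)
    (c : ℝ) (hc : c < 1 + omegaZ) :
    ∀ X : ℝ, ∃ x : ℝ, x > X ∧ (∫ t in (2:ℝ)..x, (psi t - t) / t ^ c) > 0 := by
  by_contra! hcon
  obtain ⟨X, hX⟩ := hcon
  have hlt : max (1 / 2) (c - 1) < omegaZ := max_lt homega (by linarith)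
  have hne : {r : ℝ | ∃ s : ℂ, riemannZeta s = 0 ∧ s.re = r}.Nonempty := by
    by_contra h
    rw [Set.not_nonempty_iff_eq_empty] at h
    rw [omegaZ, h, Real.sSup_empty] at homega
    norm_num at homega
  obtain ⟨r, ⟨ρ, hρ, hr⟩, hlt'⟩ := exists_lt_of_lt_csSup hne hlt
  refine PsiAux.core (a := max (1 / 2) (c - 1)) hX (lt_of_lt_of_le (by norm_num) (le_max_left _ _))
    (le_max_right _ _) ρ (by rw [hr]; exact hlt') ?_
  have h1 : ρ ≠ 1 := by
    rintro rfl
    exact riemannZeta_ne_zero_of_one_le_re (by simp) hρ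
  rw [PsiAux.Z_of_ne h1, hρ, mul_zero]
end

section
/- For all real x ≥ 121, ψ(x) − 1.5·x^{1/2} < θ(x) < ψ(x) − 0.98·x^{1/2}. -/
open MeasureTheory Filter

/-- `theta x = ∑_{p ≤ x} log p`, the Chebyshev theta function. -/
noncomputable def theta (x : ℝ) : ℝ :=
  ∑ p ∈ Finset.filter Nat.Prime (Finset.range (⌊x⌋₊ + 1)), Real.log p

namespace ThetaPsi

open ArithmeticFunction

lemma log_fact_ge (m : ℕ) (hm : 1 ≤ m) :
    (m : ℝ) * Real.log m - m + 1 ≤ Real.log (m.factorial : ℝ) := by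
  induction m, hm using Nat.le_induction with
  | base => simp
  | succ m hm ih =>
    have hm0 : (0 : ℝ) < m := by exact_mod_cast hm
    have h1 : Real.log (((m : ℝ) + 1) / m) ≤ ((m : ℝ) + 1) / m - 1 :=
      Real.log_le_sub_one_of_pos (by positivity)
    rw [Real.log_div (by positivity) (by positivity)] at h1
    have h2 : (m : ℝ) * (Real.log ((m : ℝ) + 1) - Real.log m) ≤ 1 := by
      have := mul_le_mul_of_nonneg_left h1 hm0.le
      have h3 : (m : ℝ) * (((m : ℝ) + 1) / m - 1) = 1 := by field_simp; ring
      linarith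
    rw [Nat.factorial_succ, Nat.cast_mul, Real.log_mul (by positivity) (by positivity)]
    push_cast
    nlinarith

lemma log_fact_le (m : ℕ) (hm : 1 ≤ m) :
    Real.log (m.factorial : ℝ) ≤ (m : ℝ) * Real.log m - m + 1 + Real.log m := by
  induction m, hm using Nat.le_induction with
  | base => simp
  | succ m hm ih =>
    have hm0 : (0 : ℝ) < m := by exact_mod_cast hm
    have h1 : Real.log ((m : ℝ) / (m + 1)) ≤ (m : ℝ) / (m + 1) - 1 :=
      Real.log_le_sub_one_of_pos (by positivity)
    rw [Real.log_div (by positivity) (by positivity)] at h1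
    have h2 : ((m : ℝ) + 1) * (Real.log m - Real.log ((m : ℝ) + 1)) ≤ -1 := by
      have := mul_le_mul_of_nonneg_left h1 (by positivity : (0 : ℝ) ≤ (m : ℝ) + 1)
      have h3 : ((m : ℝ) + 1) * ((m : ℝ) / (m + 1) - 1) = -1 := by field_simp; ring
      linarith
    rw [Nat.factorial_succ, Nat.cast_mul, Real.log_mul (by positivity) (by positivity)]
    push_cast
    nlinarith

lemma h_mono {a b : ℝ} (ha : 1 ≤ a) (hab : a ≤ b) :
    a * Real.log a - a ≤ b * Real.log b - b := by
  have ha0 : 0 < a := by linarith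
  have hb0 : 0 < b := by linarith
  have h1 : Real.log (a / b) ≤ a / b - 1 := Real.log_le_sub_one_of_pos (by positivity)
  rw [Real.log_div ha0.ne' hb0.ne'] at h1
  have h2 := mul_le_mul_of_nonneg_left h1 hb0.le
  have h3 : b * (a / b - 1) = a - b := by field_simp
  have h4 : 0 ≤ Real.log a := Real.log_nonneg ha
  nlinarith

lemma log_fact_abs (m : ℕ) (hm : 1 ≤ m) (u : ℝ) (h1 : (m : ℝ) ≤ u) (h2 : u ≤ m + 1) :
    |Real.log (m.factorial : ℝ) - (u * Real.log u - u)| ≤ 1 + Real.log u := by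
  have hm1 : (1 : ℝ) ≤ m := by exact_mod_cast hm
  have hu : 1 ≤ u := hm1.trans h1
  rw [abs_le]
  constructor
  · have h3 := log_fact_ge (m + 1) (by omega)
    rw [Nat.factorial_succ, Nat.cast_mul, Real.log_mul (by positivity) (by positivity)] at h3
    push_cast at h3
    have h4 := h_mono hu h2
    have h5 : Real.log ((m : ℝ) + 1) ≤ Real.log (2 * u) :=
      Real.log_le_log (by positivity) (by linarith)
    rw [Real.log_mul (by norm_num) (by positivity)] at h5
    have := Real.log_two_lt_d9
    linarith
  · have h3 := log_fact_le m hm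
    have h4 := h_mono hm1 h1
    have h5 : Real.log m ≤ Real.log u := Real.log_le_log (by positivity) h1
    linarith

/-- the error estimate for `log ⌊N/d⌋!` -/
lemma log_fact_div (N d : ℕ) (hd : 1 ≤ d) (hN : d ≤ N) :
    |Real.log ((N / d).factorial : ℝ) -
      ((N : ℝ) / d * (Real.log N - 1) - N * (Real.log d / d))| ≤ 1 + Real.log N := by
  have hd0 : (0 : ℝ) < d := by exact_mod_cast hd
  have hd1 : (1 : ℝ) ≤ d := by exact_mod_cast hd
  have hN0 : (0 : ℝ) < N := by exact_mod_cast (lt_of_lt_of_le hd hN)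
  have h := log_fact_abs (N / d) (Nat.div_pos hN hd) ((N : ℝ) / d) Nat.cast_div_le (by
    have := Nat.lt_div_mul_add (a := N) (b := d) hd
    rw [div_le_iff₀ hd0]
    have h2 : (N : ℝ) < ((N / d : ℕ) : ℝ) * d + d := by exact_mod_cast this
    nlinarith)
  rw [Real.log_div hN0.ne' hd0.ne'] at h
  have h5 : 0 ≤ Real.log d := Real.log_nonneg hd1
  have e : (N : ℝ) / d * (Real.log N - 1) - N * (Real.log d / d) =
    (N : ℝ) / d * (Real.log N - Real.log d) - N / d := by field_simp; ring
  rw [e]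
  linarith

lemma log_fact_eq (N m : ℕ) (hm : m ≤ N) :
    Real.log (m.factorial : ℝ) = ∑ n ∈ Finset.Icc 1 N, Λ n * ((m / n : ℕ) : ℝ) := by
  induction m with
  | zero => simp
  | succ m ih =>
    rw [Nat.factorial_succ, Nat.cast_mul, Real.log_mul (by positivity) (by positivity),
      ih (by omega), ← vonMangoldt_sum]
    have : ∑ i ∈ (m + 1).divisors, Λ i =
        ∑ n ∈ Finset.Icc 1 N, if n ∣ m + 1 then Λ n else 0 := by
      rw [← Finset.sum_filter]
      apply Finset.sum_congr _ (fun _ _ => rfl)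
      ext i
      simp only [Nat.mem_divisors, Finset.mem_filter, Finset.mem_Icc]
      constructor
      · rintro ⟨h, _⟩
        exact ⟨⟨Nat.pos_of_dvd_of_pos h (by omega), (Nat.le_of_dvd (by omega) h).trans hm⟩, h⟩
      · rintro ⟨_, h⟩
        exact ⟨h, by omega⟩
    rw [this, ← Finset.sum_add_distrib]
    apply Finset.sum_congr rfl
    intro n _
    rw [Nat.succ_div]
    split_ifs <;> push_cast <;> ring

lemma log_fact_div_eq (N d : ℕ) :
    Real.log ((N / d).factorial : ℝ) = ∑ n ∈ Finset.Icc 1 N, Λ n * ((N / n / d : ℕ) : ℝ) := by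
  rw [log_fact_eq N (N / d) (Nat.div_le_self _ _)]
  apply Finset.sum_congr rfl
  intro n _
  rw [Nat.div_div_eq_div_mul, Nat.div_div_eq_div_mul, mul_comm d n]

lemma psi_nat (N : ℕ) : Chebyshev.psi N = ∑ n ∈ Finset.Icc 1 N, Λ n := by
  rw [Chebyshev.psi, Nat.floor_natCast]
  rfl

lemma sum_step (N t : ℕ) (ht : 1 ≤ t) :
    ∑ n ∈ Finset.Icc 1 N, Λ n * (if t ≤ N / n then (1 : ℝ) else 0) =
      Chebyshev.psi (N / t : ℕ) := by
  rw [psi_nat]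
  simp only [mul_ite, mul_one, mul_zero]
  rw [← Finset.sum_filter]
  apply Finset.sum_congr _ (fun _ _ => rfl)
  ext n
  simp only [Finset.mem_filter, Finset.mem_Icc]
  constructor
  · rintro ⟨⟨h1, h2⟩, h3⟩
    refine ⟨h1, ?_⟩
    rw [Nat.le_div_iff_mul_le (by omega)] at h3 ⊢
    linarith
  · rintro ⟨h1, h2⟩
    refine ⟨⟨h1, h2.trans (Nat.div_le_self _ _)⟩, ?_⟩
    rw [Nat.le_div_iff_mul_le (by omega)] at h2 ⊢
    linarith

/-- forces the evaluation of a natural number -/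
def forceNat {α : Type} (n : ℕ) (k : ℕ → α) : α :=
  Nat.rec (k 0) (fun m _ => k (Nat.succ m)) n

lemma forceNat_eq {α : Type} (n : ℕ) (k : ℕ → α) : forceNat n k = k n := by
  cases n <;> rfl

/-- binary search for the integral part of the binary logarithm of `x` -/
noncomputable def ilog (x j : ℕ) : ℕ → ℕ :=
  Nat.rec (fun e => e) (fun j ih e => forceNat (Nat.add e (Nat.pow 2 j)) fun e' =>
    Bool.rec (ih e) (ih e') (Nat.ble (Nat.pow 2 e') x)) j

lemma ilog_succ (x j e : ℕ) : ilog x (j + 1) e =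
    if 2 ^ (e + 2 ^ j) ≤ x then ilog x j (e + 2 ^ j) else ilog x j e := by
  have h : ilog x (j + 1) e = forceNat (Nat.add e (Nat.pow 2 j)) fun e' =>
    Bool.rec (ilog x j e) (ilog x j e') (Nat.ble (Nat.pow 2 e') x) := rfl
  rw [h, forceNat_eq]
  change (Bool.rec (ilog x j e) (ilog x j (e + 2 ^ j)) (Nat.ble (2 ^ (e + 2 ^ j)) x) : ℕ) = _
  split_ifs with h1
  · rw [Nat.ble_eq_true_of_le h1]
  · rw [Bool.eq_false_iff.mpr (fun h2 => h1 (Nat.le_of_ble_eq_true h2))]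

lemma ilog_lo (x j : ℕ) : ∀ e, 2 ^ e ≤ x → 2 ^ (ilog x j e) ≤ x := by
  induction j with
  | zero => intro e h; exact h
  | succ j ih =>
    intro e h
    rw [ilog_succ]
    split_ifs with h1
    · exact ih _ h1
    · exact ih _ h

lemma ilog_hi (x j : ℕ) : ∀ e, x < 2 ^ (e + 2 ^ j) → x < 2 ^ (ilog x j e + 1) := by
  induction j with
  | zero => intro e h; exact h
  | succ j ih =>
    intro e h
    rw [ilog_succ]
    split_ifs with h1
    · apply ih
      rwa [add_assoc, ← two_mul, ← pow_succ']
    · exact ih _ (not_le.mp h1)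

lemma log_lo_of (n K s : ℕ) (hn : n ≠ 0) (h : 2 ^ s ≤ n ^ K) :
    (s : ℝ) * Real.log 2 ≤ K * Real.log n := by
  have hn0 : (0 : ℝ) < n := by exact_mod_cast Nat.pos_of_ne_zero hn
  have h1' : (2 : ℝ) ^ s ≤ (n : ℝ) ^ K := by exact_mod_cast h
  have h3 := Real.log_le_log (by positivity) h1'
  rwa [Real.log_pow, Real.log_pow] at h3

lemma log_hi_of (n K s : ℕ) (hn : n ≠ 0) (h : n ^ K ≤ 2 ^ s) :
    K * Real.log n ≤ (s : ℝ) * Real.log 2 := by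
  have hn0 : (0 : ℝ) < n := by exact_mod_cast Nat.pos_of_ne_zero hn
  have h1' : (n : ℝ) ^ K ≤ (2 : ℝ) ^ s := by exact_mod_cast h
  have h3 := Real.log_le_log (by positivity) h1'
  rwa [Real.log_pow, Real.log_pow] at h3


/-! ### The certificate for the lower bound -/


/-- positive coefficients `(d, n_d)` of the certificate -/
def lpos : List (ℕ × ℕ) :=
  [(6, 1000), (10, 1000), (14, 1000), (15, 1000), (21, 1000), (22, 1000), (26, 1000), (33, 1000),
  (34, 1000), (35, 1000), (38, 1000), (39, 1000), (46, 1000), (51, 1000), (55, 1000), (57, 1000),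
  (58, 826), (62, 1000), (65, 740), (69, 1000), (72, 73), (74, 927), (77, 182), (80, 156),
  (82, 733), (84, 344), (85, 1000), (86, 656), (87, 501), (91, 1000), (93, 401), (94, 1028),
  (95, 143), (96, 184), (104, 55), (106, 225), (111, 927), (115, 1000), (116, 174), (118, 826),
  (119, 1000), (120, 156), (122, 1000), (123, 828), (124, 16), (126, 73), (132, 542), (133, 879),
  (134, 199), (140, 188), (141, 1000), (142, 812), (143, 156), (145, 231), (146, 870), (148, 31),
  (158, 547), (159, 663), (160, 225), (161, 543), (166, 331), (176, 58), (177, 64), (178, 71),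
  (183, 701), (184, 299), (185, 16), (194, 103), (198, 368), (200, 156), (201, 199), (202, 185),
  (203, 673), (204, 619), (205, 844), (206, 572), (208, 57), (209, 475), (210, 1000), (212, 339),
  (213, 79), (214, 227), (215, 207), (216, 150), (218, 580), (219, 56), (221, 30), (223, 462),
  (226, 606), (235, 171), (236, 57), (237, 183), (247, 8), (248, 140), (249, 529), (254, 230),
  (256, 146), (262, 231), (267, 287), (269, 149), (270, 251), (272, 445), (276, 393), (278, 654),
  (287, 357), (288, 182), (289, 120), (291, 93), (294, 604), (295, 739), (297, 56), (299, 89),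
  (301, 173), (302, 302), (304, 223), (306, 292), (308, 376), (319, 511), (321, 325), (326, 187),
  (327, 336), (328, 287), (329, 39), (330, 1119), (334, 479), (336, 104), (340, 442), (341, 13),
  (342, 73), (343, 109), (346, 877), (348, 167)]

/-- negative coefficients `(d, -n_d)` of the certificate -/
def lneg : List (ℕ × ℕ) :=
  [(2, 1000), (3, 1000), (5, 1000), (7, 1000), (11, 1000), (13, 1000), (17, 1000), (19, 1000),
  (23, 1000), (29, 1000), (30, 1000), (31, 1000), (36, 73), (37, 927), (40, 156), (41, 844),
  (42, 1344), (43, 656), (47, 1000), (52, 112), (53, 888), (59, 826), (61, 1000), (66, 1542),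
  (67, 199), (70, 1188), (71, 812), (73, 1000), (78, 635), (79, 547), (83, 889), (88, 58),
  (89, 443), (97, 447), (98, 260), (101, 185), (102, 1292), (103, 572), (105, 943), (107, 337),
  (108, 11), (109, 916), (110, 1000), (113, 1000), (114, 1000), (127, 729), (128, 86),
  (130, 984), (131, 15), (136, 632), (137, 247), (138, 1029), (139, 971), (151, 288), (152, 56),
  (154, 238), (156, 85), (157, 57), (163, 543), (164, 8), (165, 1322), (168, 73), (169, 316),
  (170, 611), (173, 1000), (174, 327), (179, 182), (180, 122), (181, 489), (182, 1000),
  (186, 557), (190, 143), (192, 281), (195, 261), (196, 361), (197, 378), (199, 826), (220, 138),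
  (222, 884), (224, 172), (225, 3), (227, 216), (230, 685), (231, 59), (233, 401), (234, 95),
  (238, 507), (240, 631), (241, 41), (245, 8), (246, 709), (255, 97), (257, 269), (261, 376),
  (263, 374), (264, 601), (265, 214), (266, 133), (271, 66), (273, 415), (275, 616), (277, 501),
  (280, 219), (281, 124), (282, 1029), (283, 584), (285, 143), (286, 156), (290, 197),
  (293, 376), (312, 175), (313, 398), (316, 176), (317, 824), (322, 269), (351, 271), (352, 281),
  (353, 338), (354, 247), (357, 509)]

def fp (k : ℕ) : ℕ :=
  Nat.add (Nat.mul 1000 (Nat.div k 6)) (Nat.add (Nat.mul 1000 (Nat.div k 10)) (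
  Nat.add (Nat.mul 1000 (Nat.div k 14)) (Nat.add (Nat.mul 1000 (Nat.div k 15)) (
  Nat.add (Nat.mul 1000 (Nat.div k 21)) (Nat.add (Nat.mul 1000 (Nat.div k 22)) (
  Nat.add (Nat.mul 1000 (Nat.div k 26)) (Nat.add (Nat.mul 1000 (Nat.div k 33)) (
  Nat.add (Nat.mul 1000 (Nat.div k 34)) (Nat.add (Nat.mul 1000 (Nat.div k 35)) (
  Nat.add (Nat.mul 1000 (Nat.div k 38)) (Nat.add (Nat.mul 1000 (Nat.div k 39)) (
  Nat.add (Nat.mul 1000 (Nat.div k 46)) (Nat.add (Nat.mul 1000 (Nat.div k 51)) (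
  Nat.add (Nat.mul 1000 (Nat.div k 55)) (Nat.add (Nat.mul 1000 (Nat.div k 57)) (
  Nat.add (Nat.mul 826 (Nat.div k 58)) (Nat.add (Nat.mul 1000 (Nat.div k 62)) (
  Nat.add (Nat.mul 740 (Nat.div k 65)) (Nat.add (Nat.mul 1000 (Nat.div k 69)) (
  Nat.add (Nat.mul 73 (Nat.div k 72)) (Nat.add (Nat.mul 927 (Nat.div k 74)) (
  Nat.add (Nat.mul 182 (Nat.div k 77)) (Nat.add (Nat.mul 156 (Nat.div k 80)) (
  Nat.add (Nat.mul 733 (Nat.div k 82)) (Nat.add (Nat.mul 344 (Nat.div k 84)) (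
  Nat.add (Nat.mul 1000 (Nat.div k 85)) (Nat.add (Nat.mul 656 (Nat.div k 86)) (
  Nat.add (Nat.mul 501 (Nat.div k 87)) (Nat.add (Nat.mul 1000 (Nat.div k 91)) (
  Nat.add (Nat.mul 401 (Nat.div k 93)) (Nat.add (Nat.mul 1028 (Nat.div k 94)) (
  Nat.add (Nat.mul 143 (Nat.div k 95)) (Nat.add (Nat.mul 184 (Nat.div k 96)) (
  Nat.add (Nat.mul 55 (Nat.div k 104)) (Nat.add (Nat.mul 225 (Nat.div k 106)) (
  Nat.add (Nat.mul 927 (Nat.div k 111)) (Nat.add (Nat.mul 1000 (Nat.div k 115)) (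
  Nat.add (Nat.mul 174 (Nat.div k 116)) (Nat.add (Nat.mul 826 (Nat.div k 118)) (
  Nat.add (Nat.mul 1000 (Nat.div k 119)) (Nat.add (Nat.mul 156 (Nat.div k 120)) (
  Nat.add (Nat.mul 1000 (Nat.div k 122)) (Nat.add (Nat.mul 828 (Nat.div k 123)) (
  Nat.add (Nat.mul 16 (Nat.div k 124)) (Nat.add (Nat.mul 73 (Nat.div k 126)) (
  Nat.add (Nat.mul 542 (Nat.div k 132)) (Nat.add (Nat.mul 879 (Nat.div k 133)) (
  Nat.add (Nat.mul 199 (Nat.div k 134)) (Nat.add (Nat.mul 188 (Nat.div k 140)) (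
  Nat.add (Nat.mul 1000 (Nat.div k 141)) (Nat.add (Nat.mul 812 (Nat.div k 142)) (
  Nat.add (Nat.mul 156 (Nat.div k 143)) (Nat.add (Nat.mul 231 (Nat.div k 145)) (
  Nat.add (Nat.mul 870 (Nat.div k 146)) (Nat.add (Nat.mul 31 (Nat.div k 148)) (
  Nat.add (Nat.mul 547 (Nat.div k 158)) (Nat.add (Nat.mul 663 (Nat.div k 159)) (
  Nat.add (Nat.mul 225 (Nat.div k 160)) (Nat.add (Nat.mul 543 (Nat.div k 161)) (
  Nat.add (Nat.mul 331 (Nat.div k 166)) (Nat.add (Nat.mul 58 (Nat.div k 176)) (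
  Nat.add (Nat.mul 64 (Nat.div k 177)) (Nat.add (Nat.mul 71 (Nat.div k 178)) (
  Nat.add (Nat.mul 701 (Nat.div k 183)) (Nat.add (Nat.mul 299 (Nat.div k 184)) (
  Nat.add (Nat.mul 16 (Nat.div k 185)) (Nat.add (Nat.mul 103 (Nat.div k 194)) (
  Nat.add (Nat.mul 368 (Nat.div k 198)) (Nat.add (Nat.mul 156 (Nat.div k 200)) (
  Nat.add (Nat.mul 199 (Nat.div k 201)) (Nat.add (Nat.mul 185 (Nat.div k 202)) (
  Nat.add (Nat.mul 673 (Nat.div k 203)) (Nat.add (Nat.mul 619 (Nat.div k 204)) (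
  Nat.add (Nat.mul 844 (Nat.div k 205)) (Nat.add (Nat.mul 572 (Nat.div k 206)) (
  Nat.add (Nat.mul 57 (Nat.div k 208)) (Nat.add (Nat.mul 475 (Nat.div k 209)) (
  Nat.add (Nat.mul 1000 (Nat.div k 210)) (Nat.add (Nat.mul 339 (Nat.div k 212)) (
  Nat.add (Nat.mul 79 (Nat.div k 213)) (Nat.add (Nat.mul 227 (Nat.div k 214)) (
  Nat.add (Nat.mul 207 (Nat.div k 215)) (Nat.add (Nat.mul 150 (Nat.div k 216)) (
  Nat.add (Nat.mul 580 (Nat.div k 218)) (Nat.add (Nat.mul 56 (Nat.div k 219)) (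
  Nat.add (Nat.mul 30 (Nat.div k 221)) (Nat.add (Nat.mul 462 (Nat.div k 223)) (
  Nat.add (Nat.mul 606 (Nat.div k 226)) (Nat.add (Nat.mul 171 (Nat.div k 235)) (
  Nat.add (Nat.mul 57 (Nat.div k 236)) (Nat.add (Nat.mul 183 (Nat.div k 237)) (
  Nat.add (Nat.mul 8 (Nat.div k 247)) (Nat.add (Nat.mul 140 (Nat.div k 248)) (
  Nat.add (Nat.mul 529 (Nat.div k 249)) (Nat.add (Nat.mul 230 (Nat.div k 254)) (
  Nat.add (Nat.mul 146 (Nat.div k 256)) (Nat.add (Nat.mul 231 (Nat.div k 262)) (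
  Nat.add (Nat.mul 287 (Nat.div k 267)) (Nat.add (Nat.mul 149 (Nat.div k 269)) (
  Nat.add (Nat.mul 251 (Nat.div k 270)) (Nat.add (Nat.mul 445 (Nat.div k 272)) (
  Nat.add (Nat.mul 393 (Nat.div k 276)) (Nat.add (Nat.mul 654 (Nat.div k 278)) (
  Nat.add (Nat.mul 357 (Nat.div k 287)) (Nat.add (Nat.mul 182 (Nat.div k 288)) (
  Nat.add (Nat.mul 120 (Nat.div k 289)) (Nat.add (Nat.mul 93 (Nat.div k 291)) (
  Nat.add (Nat.mul 604 (Nat.div k 294)) (Nat.add (Nat.mul 739 (Nat.div k 295)) (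
  Nat.add (Nat.mul 56 (Nat.div k 297)) (Nat.add (Nat.mul 89 (Nat.div k 299)) (
  Nat.add (Nat.mul 173 (Nat.div k 301)) (Nat.add (Nat.mul 302 (Nat.div k 302)) (
  Nat.add (Nat.mul 223 (Nat.div k 304)) (Nat.add (Nat.mul 292 (Nat.div k 306)) (
  Nat.add (Nat.mul 376 (Nat.div k 308)) (Nat.add (Nat.mul 511 (Nat.div k 319)) (
  Nat.add (Nat.mul 325 (Nat.div k 321)) (Nat.add (Nat.mul 187 (Nat.div k 326)) (
  Nat.add (Nat.mul 336 (Nat.div k 327)) (Nat.add (Nat.mul 287 (Nat.div k 328)) (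
  Nat.add (Nat.mul 39 (Nat.div k 329)) (Nat.add (Nat.mul 1119 (Nat.div k 330)) (
  Nat.add (Nat.mul 479 (Nat.div k 334)) (Nat.add (Nat.mul 104 (Nat.div k 336)) (
  Nat.add (Nat.mul 442 (Nat.div k 340)) (Nat.add (Nat.mul 13 (Nat.div k 341)) (
  Nat.add (Nat.mul 73 (Nat.div k 342)) (Nat.add (Nat.mul 109 (Nat.div k 343)) (
  Nat.add (Nat.mul 877 (Nat.div k 346)) (Nat.add (Nat.mul 167 (Nat.div k 348)) (0))))))))))))))))))))))))))))))))))))))))))))))))))))))))))))))))))))))))))))))))))))))))))))))))))))))))))))))))))))))))))))))))))))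

def fn (k : ℕ) : ℕ :=
  Nat.add (Nat.mul 1000 (Nat.div k 2)) (Nat.add (Nat.mul 1000 (Nat.div k 3)) (
  Nat.add (Nat.mul 1000 (Nat.div k 5)) (Nat.add (Nat.mul 1000 (Nat.div k 7)) (
  Nat.add (Nat.mul 1000 (Nat.div k 11)) (Nat.add (Nat.mul 1000 (Nat.div k 13)) (
  Nat.add (Nat.mul 1000 (Nat.div k 17)) (Nat.add (Nat.mul 1000 (Nat.div k 19)) (
  Nat.add (Nat.mul 1000 (Nat.div k 23)) (Nat.add (Nat.mul 1000 (Nat.div k 29)) (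
  Nat.add (Nat.mul 1000 (Nat.div k 30)) (Nat.add (Nat.mul 1000 (Nat.div k 31)) (
  Nat.add (Nat.mul 73 (Nat.div k 36)) (Nat.add (Nat.mul 927 (Nat.div k 37)) (
  Nat.add (Nat.mul 156 (Nat.div k 40)) (Nat.add (Nat.mul 844 (Nat.div k 41)) (
  Nat.add (Nat.mul 1344 (Nat.div k 42)) (Nat.add (Nat.mul 656 (Nat.div k 43)) (
  Nat.add (Nat.mul 1000 (Nat.div k 47)) (Nat.add (Nat.mul 112 (Nat.div k 52)) (
  Nat.add (Nat.mul 888 (Nat.div k 53)) (Nat.add (Nat.mul 826 (Nat.div k 59)) (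
  Nat.add (Nat.mul 1000 (Nat.div k 61)) (Nat.add (Nat.mul 1542 (Nat.div k 66)) (
  Nat.add (Nat.mul 199 (Nat.div k 67)) (Nat.add (Nat.mul 1188 (Nat.div k 70)) (
  Nat.add (Nat.mul 812 (Nat.div k 71)) (Nat.add (Nat.mul 1000 (Nat.div k 73)) (
  Nat.add (Nat.mul 635 (Nat.div k 78)) (Nat.add (Nat.mul 547 (Nat.div k 79)) (
  Nat.add (Nat.mul 889 (Nat.div k 83)) (Nat.add (Nat.mul 58 (Nat.div k 88)) (
  Nat.add (Nat.mul 443 (Nat.div k 89)) (Nat.add (Nat.mul 447 (Nat.div k 97)) (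
  Nat.add (Nat.mul 260 (Nat.div k 98)) (Nat.add (Nat.mul 185 (Nat.div k 101)) (
  Nat.add (Nat.mul 1292 (Nat.div k 102)) (Nat.add (Nat.mul 572 (Nat.div k 103)) (
  Nat.add (Nat.mul 943 (Nat.div k 105)) (Nat.add (Nat.mul 337 (Nat.div k 107)) (
  Nat.add (Nat.mul 11 (Nat.div k 108)) (Nat.add (Nat.mul 916 (Nat.div k 109)) (
  Nat.add (Nat.mul 1000 (Nat.div k 110)) (Nat.add (Nat.mul 1000 (Nat.div k 113)) (
  Nat.add (Nat.mul 1000 (Nat.div k 114)) (Nat.add (Nat.mul 729 (Nat.div k 127)) (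
  Nat.add (Nat.mul 86 (Nat.div k 128)) (Nat.add (Nat.mul 984 (Nat.div k 130)) (
  Nat.add (Nat.mul 15 (Nat.div k 131)) (Nat.add (Nat.mul 632 (Nat.div k 136)) (
  Nat.add (Nat.mul 247 (Nat.div k 137)) (Nat.add (Nat.mul 1029 (Nat.div k 138)) (
  Nat.add (Nat.mul 971 (Nat.div k 139)) (Nat.add (Nat.mul 288 (Nat.div k 151)) (
  Nat.add (Nat.mul 56 (Nat.div k 152)) (Nat.add (Nat.mul 238 (Nat.div k 154)) (
  Nat.add (Nat.mul 85 (Nat.div k 156)) (Nat.add (Nat.mul 57 (Nat.div k 157)) (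
  Nat.add (Nat.mul 543 (Nat.div k 163)) (Nat.add (Nat.mul 8 (Nat.div k 164)) (
  Nat.add (Nat.mul 1322 (Nat.div k 165)) (Nat.add (Nat.mul 73 (Nat.div k 168)) (
  Nat.add (Nat.mul 316 (Nat.div k 169)) (Nat.add (Nat.mul 611 (Nat.div k 170)) (
  Nat.add (Nat.mul 1000 (Nat.div k 173)) (Nat.add (Nat.mul 327 (Nat.div k 174)) (
  Nat.add (Nat.mul 182 (Nat.div k 179)) (Nat.add (Nat.mul 122 (Nat.div k 180)) (
  Nat.add (Nat.mul 489 (Nat.div k 181)) (Nat.add (Nat.mul 1000 (Nat.div k 182)) (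
  Nat.add (Nat.mul 557 (Nat.div k 186)) (Nat.add (Nat.mul 143 (Nat.div k 190)) (
  Nat.add (Nat.mul 281 (Nat.div k 192)) (Nat.add (Nat.mul 261 (Nat.div k 195)) (
  Nat.add (Nat.mul 361 (Nat.div k 196)) (Nat.add (Nat.mul 378 (Nat.div k 197)) (
  Nat.add (Nat.mul 826 (Nat.div k 199)) (Nat.add (Nat.mul 138 (Nat.div k 220)) (
  Nat.add (Nat.mul 884 (Nat.div k 222)) (Nat.add (Nat.mul 172 (Nat.div k 224)) (
  Nat.add (Nat.mul 3 (Nat.div k 225)) (Nat.add (Nat.mul 216 (Nat.div k 227)) (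
  Nat.add (Nat.mul 685 (Nat.div k 230)) (Nat.add (Nat.mul 59 (Nat.div k 231)) (
  Nat.add (Nat.mul 401 (Nat.div k 233)) (Nat.add (Nat.mul 95 (Nat.div k 234)) (
  Nat.add (Nat.mul 507 (Nat.div k 238)) (Nat.add (Nat.mul 631 (Nat.div k 240)) (
  Nat.add (Nat.mul 41 (Nat.div k 241)) (Nat.add (Nat.mul 8 (Nat.div k 245)) (
  Nat.add (Nat.mul 709 (Nat.div k 246)) (Nat.add (Nat.mul 97 (Nat.div k 255)) (
  Nat.add (Nat.mul 269 (Nat.div k 257)) (Nat.add (Nat.mul 376 (Nat.div k 261)) (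
  Nat.add (Nat.mul 374 (Nat.div k 263)) (Nat.add (Nat.mul 601 (Nat.div k 264)) (
  Nat.add (Nat.mul 214 (Nat.div k 265)) (Nat.add (Nat.mul 133 (Nat.div k 266)) (
  Nat.add (Nat.mul 66 (Nat.div k 271)) (Nat.add (Nat.mul 415 (Nat.div k 273)) (
  Nat.add (Nat.mul 616 (Nat.div k 275)) (Nat.add (Nat.mul 501 (Nat.div k 277)) (
  Nat.add (Nat.mul 219 (Nat.div k 280)) (Nat.add (Nat.mul 124 (Nat.div k 281)) (
  Nat.add (Nat.mul 1029 (Nat.div k 282)) (Nat.add (Nat.mul 584 (Nat.div k 283)) (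
  Nat.add (Nat.mul 143 (Nat.div k 285)) (Nat.add (Nat.mul 156 (Nat.div k 286)) (
  Nat.add (Nat.mul 197 (Nat.div k 290)) (Nat.add (Nat.mul 376 (Nat.div k 293)) (
  Nat.add (Nat.mul 175 (Nat.div k 312)) (Nat.add (Nat.mul 398 (Nat.div k 313)) (
  Nat.add (Nat.mul 176 (Nat.div k 316)) (Nat.add (Nat.mul 824 (Nat.div k 317)) (
  Nat.add (Nat.mul 269 (Nat.div k 322)) (Nat.add (Nat.mul 271 (Nat.div k 351)) (
  Nat.add (Nat.mul 281 (Nat.div k 352)) (Nat.add (Nat.mul 338 (Nat.div k 353)) (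
  Nat.add (Nat.mul 247 (Nat.div k 354)) (Nat.add (Nat.mul 509 (Nat.div k 357)) (0))))))))))))))))))))))))))))))))))))))))))))))))))))))))))))))))))))))))))))))))))))))))))))))))))))))))))))))))))))))))


/-- the steps of the right-hand side -/
def gB (k : ℕ) : ℕ :=
  Nat.add 1000 (Nat.add (cond (Nat.ble 241 k) 1 0) (Nat.add (cond (Nat.ble 273 k) 246 0)
    (Nat.add (cond (Nat.ble 433 k) 717 0) (Nat.add (cond (Nat.ble 444 k) 93 0)
    (Nat.add (cond (Nat.ble 449 k) 828 0) (Nat.add (cond (Nat.ble 460 k) 1257 0)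
    (cond (Nat.ble 20000 k) 59704 0)))))))

def certTest (k : ℕ) : Bool :=
  Nat.ble (Nat.add (Nat.mul 1099511627776 (fp k)) (Nat.mul 1099511142506800 k))
    (Nat.mul 1099511627776 (Nat.add (fn k) (gB k)))

/-- checks the test on `[a, a + 2 ^ j)` by binary splitting -/
noncomputable def chkRange (test : ℕ → Bool) (j : ℕ) : ℕ → Bool :=
  Nat.rec (fun a => test a)
    (fun j ih a => Bool.rec false (forceNat (Nat.add a (Nat.pow 2 j)) ih) (ih a)) j

lemma chkRange_sound (test : ℕ → Bool) (j : ℕ) : ∀ a, chkRange test j a = true →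
    ∀ k, a ≤ k → k < a + 2 ^ j → test k = true := by
  induction j with
  | zero =>
    intro a h k h1 h2
    have : k = a := by simp at h2; omega
    subst this
    exact h
  | succ j ih =>
    intro a h k h1 h2
    have e : chkRange test (j + 1) a = Bool.rec false
      (forceNat (Nat.add a (Nat.pow 2 j)) (chkRange test j)) (chkRange test j a) := rfl
    rw [e] at h
    cases hc : chkRange test j a with
    | false => rw [hc] at h; exact absurd h (by simp)
    | true =>
      rw [hc] at h
      have h' : chkRange test j (a + 2 ^ j) = true := by
        rw [← h]; exact (forceNat_eq _ _).symm
      rcases lt_or_ge k (a + 2 ^ j) with hk | hk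
      · exact ih a hc k h1 hk
      · exact ih _ h' k hk (by rw [pow_succ] at h2; omega)

set_option maxRecDepth 100000 in
lemma cert_chk1 : chkRange certTest 12 1 = true := by decide +kernel

set_option maxRecDepth 100000 in
lemma cert_chk2 : chkRange certTest 12 4097 = true := by decide +kernel

set_option maxRecDepth 100000 in
lemma cert_chk3 : chkRange certTest 12 8193 = true := by decide +kernel

set_option maxRecDepth 100000 in
lemma cert_chk4 : chkRange certTest 12 12289 = true := by decide +kernel

set_option maxRecDepth 100000 in
lemma cert_chk5 : chkRange certTest 12 16385 = true := by decide +kernel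

lemma cert_chk (k : ℕ) (h1 : 1 ≤ k) (h2 : k ≤ 20000) : certTest k = true := by
  rcases lt_or_ge k 4097 with g1 | g1
  · exact chkRange_sound _ _ _ cert_chk1 k h1 (by norm_num; omega)
  rcases lt_or_ge k 8193 with g2 | g2
  · exact chkRange_sound _ _ _ cert_chk2 k g1 (by norm_num; omega)
  rcases lt_or_ge k 12289 with g3 | g3
  · exact chkRange_sound _ _ _ cert_chk3 k g2 (by norm_num; omega)
  rcases lt_or_ge k 16385 with g4 | g4
  · exact chkRange_sound _ _ _ cert_chk4 k g3 (by norm_num; omega)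
  exact chkRange_sound _ _ _ cert_chk5 k g4 (by norm_num; omega)

/-- weighted sums over a list -/
noncomputable def wS (l : List (ℕ × ℕ)) (f : ℕ → ℝ) : ℝ := (l.map fun p => (p.2 : ℝ) * f p.1).sum

/-- weighted sums over a list, natural numbers -/
noncomputable def wN (l : List (ℕ × ℕ)) (f : ℕ → ℕ) : ℕ :=
  List.rec 0 (fun p _ ih => Nat.add (Nat.mul p.2 (f p.1)) ih) l

lemma wN_nil (f : ℕ → ℕ) : wN [] f = 0 := rfl
lemma wN_cons (p : ℕ × ℕ) (l : List (ℕ × ℕ)) (f : ℕ → ℕ) :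
    wN (p :: l) f = p.2 * f p.1 + wN l f := rfl

lemma wS_nil (f : ℕ → ℝ) : wS [] f = 0 := rfl
lemma wS_cons (p : ℕ × ℕ) (l : List (ℕ × ℕ)) (f : ℕ → ℝ) :
    wS (p :: l) f = p.2 * f p.1 + wS l f := by simp [wS]

lemma wS_le (l : List (ℕ × ℕ)) (f g : ℕ → ℝ) (h : ∀ p ∈ l, f p.1 ≤ g p.1) : wS l f ≤ wS l g := by
  induction l with
  | nil => simp [wS_nil]
  | cons p l ih =>
    rw [wS_cons, wS_cons]
    have h1 := ih (fun q hq => h q (List.mem_cons_of_mem _ hq))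
    have h2 := mul_le_mul_of_nonneg_left (h p List.mem_cons_self) (Nat.cast_nonneg (α := ℝ) p.2)
    linarith

lemma wS_add (l : List (ℕ × ℕ)) (f g : ℕ → ℝ) : wS l (fun d => f d + g d) = wS l f + wS l g := by
  induction l with
  | nil => simp [wS_nil]
  | cons p l ih => rw [wS_cons, wS_cons, wS_cons, ih]; ring

lemma wS_mul (l : List (ℕ × ℕ)) (f : ℕ → ℝ) (c : ℝ) : wS l (fun d => c * f d) = c * wS l f := by
  induction l with
  | nil => simp [wS_nil]
  | cons p l ih => rw [wS_cons, wS_cons, ih]; ring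

lemma wS_cast (l : List (ℕ × ℕ)) (f : ℕ → ℕ) : wS l (fun d => (f d : ℝ)) = (wN l f : ℝ) := by
  induction l with
  | nil => simp [wS_nil, wN_nil]
  | cons p l ih => rw [wS_cons, ih, wN_cons]; push_cast; ring

lemma wS_sum (l : List (ℕ × ℕ)) (s : Finset ℕ) (c : ℕ → ℝ) (f : ℕ → ℕ → ℝ) :
    wS l (fun d => ∑ n ∈ s, c n * f n d) = ∑ n ∈ s, c n * wS l (f n) := by
  induction l with
  | nil => simp [wS_nil]
  | cons p l ih =>
    simp only [wS_cons]
    rw [ih, Finset.mul_sum, ← Finset.sum_add_distrib]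
    apply Finset.sum_congr rfl
    intro n _
    ring

lemma wN_step (k d v x : ℕ) (l : List (ℕ × ℕ)) (h : x = wN l (fun d => k / d)) :
    Nat.add (Nat.mul v (Nat.div k d)) x = wN ((d, v) :: l) (fun d => k / d) := by
  rw [h]; rfl

lemma fp_eq (k : ℕ) : fp k = wN lpos (fun d => k / d) := by
  unfold fp lpos
  repeat refine wN_step k _ _ _ _ ?_
  exact (wN_nil _).symm

lemma fn_eq (k : ℕ) : fn k = wN lneg (fun d => k / d) := by
  unfold fn lneg
  repeat refine wN_step k _ _ _ _ ?_
  exact (wN_nil _).symm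

lemma lpos_range : ∀ p ∈ lpos, 1 ≤ p.1 ∧ p.1 ≤ 360 := by decide +kernel
lemma lneg_range : ∀ p ∈ lneg, 1 ≤ p.1 ∧ p.1 ≤ 360 := by decide +kernel

lemma inv_lo (l : List (ℕ × ℕ)) :
    (wN l (fun d => 2 ^ 100 / d) : ℝ) ≤ 2 ^ 100 * wS l (fun d => 1 / (d : ℝ)) := by
  rw [← wS_cast, ← wS_mul]
  apply wS_le
  intro p hp
  have h := @Nat.cast_div_le ℝ _ _ _ (2 ^ 100) p.1
  rw [mul_one_div]
  refine h.trans (le_of_eq ?_)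
  norm_num

lemma inv_hi (l : List (ℕ × ℕ)) (hl : ∀ p ∈ l, 1 ≤ p.1 ∧ p.1 ≤ 360) :
    2 ^ 100 * wS l (fun d => 1 / (d : ℝ)) ≤ (wN l (fun d => 2 ^ 100 / d + 1) : ℝ) := by
  rw [← wS_cast, ← wS_mul]
  apply wS_le
  intro p hp
  have hd0 : (0 : ℝ) < p.1 := by exact_mod_cast (hl p hp).1
  rw [mul_one_div, div_le_iff₀ hd0]
  have := Nat.lt_div_mul_add (a := 2 ^ 100) (b := p.1) (hl p hp).1
  have h2 : (2 ^ 100 : ℝ) < ((2 ^ 100 / p.1 : ℕ) : ℝ) * p.1 + p.1 := by exact_mod_cast this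
  push_cast at h2 ⊢
  linarith

/-- the coefficient `n_1` -/
noncomputable def n1 : ℝ := wS lneg (fun d => 1 / (d : ℝ)) - wS lpos (fun d => 1 / (d : ℝ))

lemma n1_chk : 2 ^ 40 * wN lneg (fun d => 2 ^ 100 / d + 1) ≤
    2 ^ 100 * 1099511142506800 + 2 ^ 40 * wN lpos (fun d => 2 ^ 100 / d) := by decide +kernel

lemma n1_chk' : wN lpos (fun d => 2 ^ 100 / d + 1) ≤ wN lneg (fun d => 2 ^ 100 / d) := by
  decide +kernel

lemma n1_le : 2 ^ 40 * n1 ≤ 1099511142506800 := by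
  have h1 := inv_lo lpos
  have h2 := inv_hi lneg lneg_range
  have h3 : (2 ^ 40 * wN lneg (fun d => 2 ^ 100 / d + 1) : ℝ) ≤
    2 ^ 100 * 1099511142506800 + 2 ^ 40 * wN lpos (fun d => 2 ^ 100 / d) := by
      exact_mod_cast n1_chk
  unfold n1
  generalize (wN lneg (fun d => 2 ^ 100 / d + 1) : ℝ) = a at *
  generalize (wN lpos (fun d => 2 ^ 100 / d) : ℝ) = b at *
  norm_num at *
  linarith

lemma n1_nonneg : 0 ≤ n1 := by
  have h1 := inv_lo lneg
  have h2 := inv_hi lpos lpos_range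
  have h3 : (wN lpos (fun d => 2 ^ 100 / d + 1) : ℝ) ≤ wN lneg (fun d => 2 ^ 100 / d) := by
      exact_mod_cast n1_chk'
  unfold n1
  generalize (wN lneg (fun d => 2 ^ 100 / d) : ℝ) = a at *
  generalize (wN lpos (fun d => 2 ^ 100 / d + 1) : ℝ) = b at *
  norm_num at *
  linarith

noncomputable def lgE (d : ℕ) : ℕ := ilog (Nat.pow d 65536) 20 0

lemma lgE_lo (d : ℕ) (h1 : 1 ≤ d) : (lgE d : ℝ) * Real.log 2 ≤ 65536 * Real.log d := by
  have := log_lo_of d 65536 (lgE d) (by omega) (ilog_lo _ _ _ (by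
    rw [pow_zero]; exact Nat.one_le_pow _ _ h1))
  exact_mod_cast this

lemma lgE_hi (d : ℕ) (h1 : 1 ≤ d) (h2 : d ≤ 360) :
    65536 * Real.log d ≤ ((lgE d : ℝ) + 1) * Real.log 2 := by
  have := log_hi_of d 65536 (lgE d + 1) (by omega) (ilog_hi _ _ _ (by
    have e : 2 ^ (0 + 2 ^ 20) = (2 ^ 16) ^ 65536 := by rw [← pow_mul]; congr 1
    rw [e]
    exact Nat.pow_lt_pow_left (by omega) (by norm_num))).le
  exact_mod_cast this

noncomputable def loE (d : ℕ) : ℕ := forceNat (lgE d) fun u => Nat.div (Nat.mul u 1000000) d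
noncomputable def hiE (d : ℕ) : ℕ :=
  forceNat (lgE d) fun u => Nat.succ (Nat.div (Nat.mul (Nat.succ u) 1000000) d)

lemma A_chk : Nat.ble (Nat.add (wN lpos hiE) 93845000000000) (wN lneg loE) = true := by
  decide +kernel

lemma wS_log_lo (l : List (ℕ × ℕ)) (hl : ∀ p ∈ l, 1 ≤ p.1 ∧ p.1 ≤ 360) :
    Real.log 2 * (wN l loE : ℝ) ≤ (65536 * 1000000) * wS l (fun d => Real.log d / d) := by
  rw [← wS_cast, ← wS_mul, ← wS_mul]
  apply wS_le
  intro p hp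
  have hd0 : (0 : ℝ) < p.1 := by exact_mod_cast (hl p hp).1
  have hL : 0 < Real.log 2 := Real.log_pos (by norm_num)
  have h := lgE_lo p.1 (hl p hp).1
  unfold loE
  rw [forceNat_eq]
  generalize lgE p.1 = a at *
  have h2 := @Nat.cast_div_le ℝ _ _ _ (a * 1000000) p.1
  change Real.log 2 * ((a * 1000000 / p.1 : ℕ) : ℝ) ≤ _
  have h3 := mul_le_mul_of_nonneg_left h2 hL.le
  refine h3.trans ?_
  rw [mul_div_assoc', mul_div_assoc']
  apply div_le_div_of_nonneg_right _ hd0.le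
  push_cast
  linarith

lemma wS_log_hi (l : List (ℕ × ℕ)) (hl : ∀ p ∈ l, 1 ≤ p.1 ∧ p.1 ≤ 360) :
    (65536 * 1000000) * wS l (fun d => Real.log d / d) ≤ Real.log 2 * (wN l hiE : ℝ) := by
  rw [← wS_cast, ← wS_mul, ← wS_mul]
  apply wS_le
  intro p hp
  have hd0 : (0 : ℝ) < p.1 := by exact_mod_cast (hl p hp).1
  have hL : 0 < Real.log 2 := Real.log_pos (by norm_num)
  have h := lgE_hi p.1 (hl p hp).1 (hl p hp).2
  unfold hiE
  rw [forceNat_eq]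
  generalize lgE p.1 = a at *
  rw [mul_div_assoc', div_le_iff₀ hd0]
  have h2 := Nat.lt_div_mul_add (a := (a + 1) * 1000000) (b := p.1) (hl p hp).1
  change _ ≤ Real.log 2 * (((a + 1) * 1000000 / p.1 + 1 : ℕ) : ℝ) * p.1
  have h4 : ((a : ℝ) + 1) * 1000000 <
    (((a + 1) * 1000000 / p.1 : ℕ) : ℝ) * p.1 + p.1 := by
    exact_mod_cast h2
  rw [Nat.cast_add, Nat.cast_one]
  generalize (((a + 1) * 1000000 / p.1 : ℕ) : ℝ) = q at *
  have h5 := mul_le_mul_of_nonneg_left h4.le hL.le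
  linarith

lemma A_ge : 992.5 ≤ wS lneg (fun d => Real.log d / d) - wS lpos (fun d => Real.log d / d) := by
  have h1 := wS_log_lo lneg lneg_range
  have h2 := wS_log_hi lpos lpos_range
  have h3 : (wN lpos hiE : ℝ) + 93845000000000 ≤ wN lneg loE := by
    have h := Nat.le_of_ble_eq_true A_chk
    generalize wN lpos hiE = a at *
    generalize wN lneg loE = b at *
    exact_mod_cast h
  have hL := Real.log_two_gt_d9
  nlinarith


/-! ### The lower bound for large arguments -/

lemma gB_eq (k : ℕ) (hk : 1 ≤ k) : (gB k : ℝ) =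
    1000 * (if 1 ≤ k then (1 : ℝ) else 0) + 1 * (if 241 ≤ k then (1 : ℝ) else 0) +
    246 * (if 273 ≤ k then (1 : ℝ) else 0) + 717 * (if 433 ≤ k then (1 : ℝ) else 0) +
    93 * (if 444 ≤ k then (1 : ℝ) else 0) + 828 * (if 449 ≤ k then (1 : ℝ) else 0) +
    1257 * (if 460 ≤ k then (1 : ℝ) else 0) + 59704 * (if 20000 ≤ k then (1 : ℝ) else 0) := by
  have key : ∀ t g : ℕ, ((cond (Nat.ble t k) g 0 : ℕ) : ℝ) = g * (if t ≤ k then (1 : ℝ) else 0) := by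
    intro t g
    split_ifs with h
    · rw [Nat.ble_eq_true_of_le h]; simp
    · rw [Bool.eq_false_iff.mpr (fun h2 => h (Nat.le_of_ble_eq_true h2))]; simp
  have e : gB k = 1000 + (cond (Nat.ble 241 k) 1 0 + (cond (Nat.ble 273 k) 246 0 +
    (cond (Nat.ble 433 k) 717 0 + (cond (Nat.ble 444 k) 93 0 +
    (cond (Nat.ble 449 k) 828 0 + (cond (Nat.ble 460 k) 1257 0 +
    cond (Nat.ble 20000 k) 59704 0)))))) := rfl
  rw [e]
  push_cast [key]
  rw [if_pos hk]
  ring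

lemma lneg_total : wN lneg (fun _ => 1) = 63846 := by decide +kernel
lemma lpos_total : wN lpos (fun _ => 1) = 62135 := by decide +kernel

lemma lneg_total' (c : ℝ) : wS lneg (fun _ => c) = 63846 * c := by
  have h : wS lneg (fun _ => ((1 : ℕ) : ℝ)) = _ := wS_cast lneg (fun _ => 1)
  rw [lneg_total] at h
  have h2 := wS_mul lneg (fun _ => ((1 : ℕ) : ℝ)) c
  rw [h] at h2
  simp only [Nat.cast_one, mul_one] at h2
  rw [h2]; push_cast; ring

lemma lpos_total' (c : ℝ) : wS lpos (fun _ => c) = 62135 * c := by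
  have h : wS lpos (fun _ => ((1 : ℕ) : ℝ)) = _ := wS_cast lpos (fun _ => 1)
  rw [lpos_total] at h
  have h2 := wS_mul lpos (fun _ => ((1 : ℕ) : ℝ)) c
  rw [h] at h2
  simp only [Nat.cast_one, mul_one] at h2
  rw [h2]; push_cast; ring

lemma cert_real (k : ℕ) (hk : 1 ≤ k) :
    n1 * k + wS lpos (fun d => ((k / d : ℕ) : ℝ)) - wS lneg (fun d => ((k / d : ℕ) : ℝ)) ≤ gB k := by
  rcases le_or_gt k 20000 with h | h
  · have h1 := Nat.le_of_ble_eq_true (cert_chk k hk h)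
    have h2 : 1099511627776 * fp k + 1099511142506800 * k ≤
      1099511627776 * (fn k + gB k) := h1
    have h3 : (1099511627776 * fp k + 1099511142506800 * k : ℝ) ≤
      1099511627776 * (fn k + gB k) := by exact_mod_cast h2
    rw [wS_cast, wS_cast, ← fp_eq, ← fn_eq]
    have h4 := n1_le
    have h5 := mul_le_mul_of_nonneg_right h4 (Nat.cast_nonneg (α := ℝ) k)
    linarith
  · have hg : (gB k : ℝ) = 63846 := by
      rw [gB_eq k hk, if_pos hk, if_pos (by omega), if_pos (by omega), if_pos (by omega),
        if_pos (by omega), if_pos (by omega), if_pos (by omega), if_pos (by omega)]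
      norm_num
    have h1 : wS lpos (fun d => ((k / d : ℕ) : ℝ)) ≤ wS lpos (fun d => (k : ℝ) * (1 / (d : ℝ))) := by
      apply wS_le
      intro p _
      rw [mul_one_div]
      exact Nat.cast_div_le
    have h2 : wS lneg (fun d => (k : ℝ) * (1 / (d : ℝ))) ≤
        wS lneg (fun d => ((k / d : ℕ) : ℝ) + 1) := by
      apply wS_le
      intro p hp
      have hd0 : (0 : ℝ) < p.1 := by exact_mod_cast (lneg_range p hp).1
      rw [mul_one_div, div_le_iff₀ hd0]
      have := Nat.lt_div_mul_add (a := k) (b := p.1) (lneg_range p hp).1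
      have h2 : (k : ℝ) < ((k / p.1 : ℕ) : ℝ) * p.1 + p.1 := by exact_mod_cast this
      linarith
    rw [wS_add, wS_mul, lneg_total'] at h2
    rw [wS_mul] at h1
    rw [hg]
    unfold n1
    linarith

lemma cert_sum (N : ℕ) :
    n1 * Real.log (N.factorial : ℝ) + wS lpos (fun d => Real.log ((N / d).factorial : ℝ)) -
      wS lneg (fun d => Real.log ((N / d).factorial : ℝ)) ≤
    1000 * Chebyshev.psi N + 1 * Chebyshev.psi (N / 241 : ℕ) + 246 * Chebyshev.psi (N / 273 : ℕ) +
    717 * Chebyshev.psi (N / 433 : ℕ) + 93 * Chebyshev.psi (N / 444 : ℕ) +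
    828 * Chebyshev.psi (N / 449 : ℕ) + 1257 * Chebyshev.psi (N / 460 : ℕ) +
    59704 * Chebyshev.psi (N / 20000 : ℕ) := by
  have h0 := log_fact_div_eq N 1
  simp only [Nat.div_one] at h0
  have s1 := sum_step N 1 (by norm_num)
  rw [Nat.div_one] at s1
  simp_rw [log_fact_div_eq]
  rw [h0, wS_sum lpos (Finset.Icc 1 N) (fun n => Λ n) (fun n d => ((N / n / d : ℕ) : ℝ)),
    wS_sum lneg (Finset.Icc 1 N) (fun n => Λ n) (fun n d => ((N / n / d : ℕ) : ℝ)), ← s1,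
    ← sum_step N 241 (by norm_num), ← sum_step N 273 (by norm_num), ← sum_step N 433 (by norm_num),
    ← sum_step N 444 (by norm_num), ← sum_step N 449 (by norm_num), ← sum_step N 460 (by norm_num),
    ← sum_step N 20000 (by norm_num)]
  simp only [Finset.mul_sum]
  rw [← Finset.sum_add_distrib, ← Finset.sum_sub_distrib]
  simp only [← Finset.sum_add_distrib]
  apply Finset.sum_le_sum
  intro n hn
  rw [Finset.mem_Icc] at hn
  have hk : 1 ≤ N / n := Nat.div_pos hn.2 hn.1
  have h1 := cert_real (N / n) hk
  rw [gB_eq _ hk] at h1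
  have h2 := mul_le_mul_of_nonneg_left h1 (vonMangoldt_nonneg (n := n))
  linarith

lemma psi_lower_large (hU : ∀ n : ℕ, Chebyshev.psi n ≤ 1.11 * n) (N : ℕ) (hN : 360 ≤ N) :
    0.981 * N - 126.981 * (1 + Real.log N) ≤ Chebyshev.psi N := by
  have h := cert_sum N
  have hU' : ∀ t : ℕ, Chebyshev.psi (N / t : ℕ) ≤ 1.11 * ((N : ℝ) / t) := by
    intro t
    refine (hU _).trans ?_
    have := @Nat.cast_div_le ℝ _ _ _ N t
    linarith
  have u1 := hU' 241
  have u2 := hU' 273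
  have u3 := hU' 433
  have u4 := hU' 444
  have u5 := hU' 449
  have u6 := hU' 460
  have u7 := hU' 20000
  have e1 := (abs_le.mp (log_fact_div N 1 le_rfl (by omega))).1
  rw [Nat.div_one] at e1
  have p1 : wS lpos (fun d => (((N : ℝ) * (Real.log N - 1)) * (1 / (d : ℝ)) +
      (-N) * (Real.log d / d)) + (-(1 + Real.log N))) ≤
      wS lpos (fun d => Real.log ((N / d).factorial : ℝ)) := by
    apply wS_le
    intro p hp
    have := (abs_le.mp (log_fact_div N p.1 (lpos_range p hp).1
      ((lpos_range p hp).2.trans hN))).1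
    have e : (N : ℝ) / p.1 * (Real.log N - 1) = ((N : ℝ) * (Real.log N - 1)) * (1 / (p.1 : ℝ)) := by
      ring
    linarith
  have p2 : wS lneg (fun d => Real.log ((N / d).factorial : ℝ)) ≤
      wS lneg (fun d => (((N : ℝ) * (Real.log N - 1)) * (1 / (d : ℝ)) +
      (-N) * (Real.log d / d)) + (1 + Real.log N)) := by
    apply wS_le
    intro p hp
    have := (abs_le.mp (log_fact_div N p.1 (lneg_range p hp).1
      ((lneg_range p hp).2.trans hN))).2
    have e : (N : ℝ) / p.1 * (Real.log N - 1) = ((N : ℝ) * (Real.log N - 1)) * (1 / (p.1 : ℝ)) := by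
      ring
    linarith
  rw [wS_add, wS_add, wS_mul, wS_mul, lpos_total'] at p1
  rw [wS_add, wS_add, wS_mul, wS_mul, lneg_total'] at p2
  have hn := n1_nonneg
  have hn2 : n1 ≤ 1000 := by
    have := n1_le
    norm_num at this
    linarith
  have hlog : 0 ≤ Real.log N := Real.log_natCast_nonneg N
  simp only [Nat.cast_one, div_one, Real.log_one, mul_zero, sub_zero] at e1
  have e2 := mul_le_mul_of_nonneg_left e1 hn
  have e3 : n1 * (1 + Real.log N) ≤ 1000 * (1 + Real.log N) :=
    mul_le_mul_of_nonneg_right hn2 (by linarith)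
  have hA := mul_le_mul_of_nonneg_left A_ge (Nat.cast_nonneg (α := ℝ) N)
  have hz : ((N : ℝ) * (Real.log N - 1)) * (n1 + wS lpos (fun d => 1 / (d : ℝ)) -
    wS lneg (fun d => 1 / (d : ℝ))) = 0 := by
    unfold n1
    ring
  push_cast at u1 u2 u3 u4 u5 u6 u7
  nlinarith [Nat.cast_nonneg (α := ℝ) N]


/-! ### Verified computation -/

/-- iterates `step` over `2 ^ j` consecutive values, by binary splitting -/
noncomputable def loop (step : ℕ → ℕ → ℕ) (j : ℕ) : ℕ → ℕ → ℕ :=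
  Nat.rec step (fun j ih n s => forceNat (ih n s) fun s1 =>
    forceNat (Nat.add n (Nat.pow 2 j)) fun n1 => ih n1 s1) j

lemma loop_succ (step : ℕ → ℕ → ℕ) (j n s : ℕ) :
    loop step (j + 1) n s = loop step j (n + 2 ^ j) (loop step j n s) := by
  have h : loop step (j + 1) n s = forceNat (loop step j n s) fun s1 =>
    forceNat (Nat.add n (Nat.pow 2 j)) fun n1 => loop step j n1 s1 := rfl
  rw [h, forceNat_eq, forceNat_eq]
  rfl

lemma loop_zero (step : ℕ → ℕ → ℕ) (h0 : ∀ n, step n 0 = 0) (j : ℕ) :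
    ∀ n, loop step j n 0 = 0 := by
  induction j with
  | zero => exact h0
  | succ j ih => intro n; rw [loop_succ, ih, ih]

lemma loop_sound (step : ℕ → ℕ → ℕ) (h0 : ∀ n, step n 0 = 0) (B : ℕ)
    (Inv : ℕ → ℕ → Prop) (Q : ℕ → Prop)
    (hs : ∀ n s, n < B → Inv n s → step n s ≠ 0 → Inv (n + 1) (step n s) ∧ Q (n + 1)) (j : ℕ) :
    ∀ n s, n + 2 ^ j ≤ B → Inv n s → loop step j n s ≠ 0 →
      Inv (n + 2 ^ j) (loop step j n s) ∧ ∀ m, n < m → m ≤ n + 2 ^ j → Q m := by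
  induction j with
  | zero =>
    intro n s hB hI hn
    obtain ⟨h1, h2⟩ := hs n s (by simp at hB; omega) hI hn
    refine ⟨h1, fun m hm1 hm2 => ?_⟩
    have : m = n + 1 := by simp at hm2; omega
    rwa [this]
  | succ j ih =>
    intro n s hB hI hn
    rw [loop_succ] at hn ⊢
    have e : n + 2 ^ (j + 1) = n + 2 ^ j + 2 ^ j := by rw [pow_succ]; ring
    rw [e] at hB ⊢
    have h1 : loop step j n s ≠ 0 := by
      intro h
      rw [h, loop_zero step h0] at hn
      exact hn rfl
    obtain ⟨a1, a2⟩ := ih n s (le_trans (Nat.le_add_right _ _) hB) hI h1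
    obtain ⟨b1, b2⟩ := ih _ _ hB a1 hn
    refine ⟨b1, fun m hm1 hm2 => ?_⟩
    rcases le_or_gt m (n + 2 ^ j) with h | h
    · exact a2 m hm1 h
    · exact b2 m h hm2

/-- one step of the computation of `lcm (1, …, n)`, with a test -/
noncomputable def lcmStep (test : ℕ → ℕ → Bool) (n L : ℕ) : ℕ :=
  forceNat (Nat.succ n) fun m => forceNat (Nat.gcd m (Nat.mod L m)) fun g =>
    forceNat (Nat.mul L (Nat.div m g)) fun L' => Bool.rec 0 L' (test m L')

lemma lcmStep_eq (test : ℕ → ℕ → Bool) (n L : ℕ) :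
    lcmStep test n L = if test (n + 1) (Nat.lcm L (n + 1)) = true then Nat.lcm L (n + 1) else 0 := by
  unfold lcmStep
  rw [forceNat_eq, forceNat_eq, forceNat_eq]
  have e : Nat.mul L (Nat.div n.succ (Nat.gcd n.succ (Nat.mod L n.succ))) = Nat.lcm L (n + 1) := by
    change L * ((n + 1) / (Nat.gcd (n + 1) (L % (n + 1)))) = _
    have : Nat.gcd (n + 1) (L % (n + 1)) = Nat.gcd L (n + 1) := by
      rw [Nat.gcd_comm, ← Nat.gcd_rec, Nat.gcd_comm]
    rw [this, Nat.lcm, Nat.mul_div_assoc _ (Nat.gcd_dvd_right _ _)]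
  rw [e]
  cases h : test (n + 1) (Nat.lcm L (n + 1)) <;> simp

lemma lcmUpto_succ' (n : ℕ) : Nat.lcmUpto (n + 1) = Nat.lcm (Nat.lcmUpto n) (n + 1) := by
  unfold Nat.lcmUpto
  have : Finset.Icc 1 (n + 1) = insert (n + 1) (Finset.Icc 1 n) := by
    ext i; simp only [Finset.mem_Icc, Finset.mem_insert]; omega
  rw [this, Finset.lcm_insert]
  exact Nat.lcm_comm _ _

lemma lcmLoop_sound (test : ℕ → ℕ → Bool) (j : ℕ) (h : loop (lcmStep test) j 0 1 ≠ 0) :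
    loop (lcmStep test) j 0 1 = Nat.lcmUpto (2 ^ j) ∧
      ∀ m, 0 < m → m ≤ 2 ^ j → test m (Nat.lcmUpto m) = true := by
  have := loop_sound (lcmStep test) (fun n => by rw [lcmStep_eq]; simp) (2 ^ j)
    (fun n L => L = Nat.lcmUpto n) (fun m => test m (Nat.lcmUpto m) = true) (by
      intro n s _ hI hn
      rw [lcmStep_eq, hI, ← lcmUpto_succ'] at hn ⊢
      split_ifs at hn ⊢ with ht
      · exact ⟨rfl, ht⟩
      · exact absurd rfl hn) j 0 1 (by simp) (by decide) h
  simpa using this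

/-- the test for `2 ≤ m ≤ 16384` -/
def testA (m L : ℕ) : Bool :=
  and (Nat.ble L (Nat.pow 2 (Nat.div (Nat.mul m 11100000000) 6931471808)))
    (cond (Nat.ble m 57) true
      (Nat.ble (Nat.pow 2 (Nat.succ (Nat.div (Nat.mul (Nat.sub (Nat.mul 98 (Nat.succ m)) 1200)
        100000000) 6931471803))) L))

lemma runA : Nat.ble (Nat.pow 2 23672) (loop (lcmStep testA) 14 0 1) = true := by decide +kernel

/-- the test for `11 ≤ m ≤ 62` -/
def testB (m L : ℕ) : Bool :=
  cond (Nat.ble m 10) true (cond (Nat.ble 63 m) true (and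
    (Nat.ble (Nat.pow L 16) (Nat.pow 2 (Nat.div (Nat.mul (Nat.sub (Nat.mul 150 m)
      (cond (Nat.ble m 13) 480 (cond (Nat.ble m 17) 590 (cond (Nat.ble m 25) 854
        (cond (Nat.ble m 35) 1033 1690))))) 1600000000) 6931471808)))
    (cond (Nat.ble 58 m) true (Nat.ble (Nat.pow 2 (Nat.succ (Nat.div (Nat.mul
      (Nat.sub (Nat.mul 98 (Nat.succ m)) (cond (Nat.ble m 11) 240 409)) 1600000000) 6931471803)))
      (Nat.pow L 16)))))

lemma runB : Nat.ble 1 (loop (lcmStep testB) 6 0 1) = true := by decide +kernel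

/-- one step of a lower estimate `s` for `32 ψ(n) / log 2`, with a test;
`P` is used as a sieve -/
noncomputable def psiBody (P c1 c2 c3 n s : ℕ) : ℕ :=
  forceNat (Nat.succ n) fun m =>
    forceNat (Bool.rec s (Nat.add s (ilog (Nat.pow m 32) 10 0))
      (Nat.beq (Nat.gcd m (Nat.mod P m)) 1)) fun s' =>
    Bool.rec 0 s' (Nat.ble (Nat.mul c1 (Nat.succ m)) (Nat.add (Nat.mul c2 s') c3))

/-- `psiBody`, with `0` for a failure -/
noncomputable def psiStep (P c1 c2 c3 n s : ℕ) : ℕ :=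
  Nat.rec 0 (fun s0 _ => psiBody P c1 c2 c3 n (Nat.succ s0)) s

/-- the two runs of the estimate, up to `65536` -/
noncomputable def psiRun (P c1 c2 c3 : ℕ) : ℕ :=
  loop (psiStep P c1 c2 c3) 14 49152 (loop (psiStep P c1 c2 c3) 15 16384 757504)

lemma runC : Nat.ble 1 (forceNat (Nat.factorial 256) fun P =>
    psiRun P 313600000000 6931471803 3840000000000) = true := by decide +kernel


/-! ### Consequences of the computations -/

lemma psi_lo_of_lcm (m K s : ℕ) (h : 2 ^ s ≤ (Nat.lcmUpto m) ^ K) :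
    (s : ℝ) * Real.log 2 ≤ K * Chebyshev.psi m := by
  rw [Chebyshev.psi_eq_log_lcmUpto]
  exact log_lo_of _ _ _ (Nat.lcmUpto_ne_zero m) h

lemma psi_hi_of_lcm (m K s : ℕ) (h : (Nat.lcmUpto m) ^ K ≤ 2 ^ s) :
    K * Chebyshev.psi m ≤ (s : ℝ) * Real.log 2 := by
  rw [Chebyshev.psi_eq_log_lcmUpto]
  exact log_hi_of _ _ _ (Nat.lcmUpto_ne_zero m) h

/-- numerators for lower bounds -/
lemma num_lo (X c : ℕ) :
    (X : ℝ) ≤ ((X * c / 6931471803 + 1 : ℕ) : ℝ) * Real.log 2 / (c / 10000000000) ∨ c = 0 := by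
  rcases Nat.eq_zero_or_pos c with h | h
  · right; exact h
  left
  have hc : (0 : ℝ) < c := by exact_mod_cast h
  rw [le_div_iff₀ (by positivity)]
  have h1 := Nat.lt_div_mul_add (a := X * c) (b := 6931471803) (by norm_num)
  have h2 : (X : ℝ) * c < ((X * c / 6931471803 : ℕ) : ℝ) * 6931471803 + 6931471803 := by
    exact_mod_cast h1
  have hL := Real.log_two_gt_d9
  rw [Nat.cast_add, Nat.cast_one]
  have h3 : (0 : ℝ) ≤ ((X * c / 6931471803 : ℕ) : ℝ) := Nat.cast_nonneg _
  nlinarith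

lemma num_hi (X : ℕ) :
    ((X / 6931471808 : ℕ) : ℝ) * Real.log 2 ≤ X / 10000000000 := by
  have h1 := @Nat.cast_div_le ℝ _ _ _ X 6931471808
  rw [Nat.cast_ofNat, le_div_iff₀ (by norm_num)] at h1
  have hL := Real.log_two_lt_d9
  have h3 : (0 : ℝ) ≤ ((X / 6931471808 : ℕ) : ℝ) := Nat.cast_nonneg _
  nlinarith

lemma runA_ne : loop (lcmStep testA) 14 0 1 ≠ 0 := by
  have h := Nat.le_of_ble_eq_true runA
  have h2 : 0 < Nat.pow 2 23672 := Nat.pow_pos (by norm_num)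
  exact (lt_of_lt_of_le h2 h).ne'

lemma psi_16384 : (23672 : ℝ) * Real.log 2 ≤ Chebyshev.psi (16384 : ℕ) := by
  have h := Nat.le_of_ble_eq_true runA
  rw [(lcmLoop_sound testA 14 runA_ne).1] at h
  have h2 := psi_lo_of_lcm 16384 1 23672 (by rw [pow_one]; exact h)
  simpa using h2

lemma psi_hi_small (m : ℕ) (h1 : 0 < m) (h2 : m ≤ 16384) : Chebyshev.psi m ≤ 1.11 * m := by
  have h := (lcmLoop_sound testA 14 runA_ne).2 m h1 h2
  unfold testA at h
  rw [Bool.and_eq_true] at h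
  have h3 := Nat.le_of_ble_eq_true h.1
  have h4 := psi_hi_of_lcm m 1 (m * 11100000000 / 6931471808) (by rw [pow_one]; exact h3)
  have h5 := num_hi (m * 11100000000)
  have h6 : (1 : ℝ) * Chebyshev.psi m ≤ ((m * 11100000000 : ℕ) : ℝ) / 10000000000 := by
    refine le_trans ?_ h5
    simpa using h4
  push_cast at h6
  linarith

lemma psi_lo_small (m : ℕ) (h1 : 58 ≤ m) (h2 : m ≤ 16384) :
    0.98 * ((m : ℝ) + 1) - 12 ≤ Chebyshev.psi m := by
  have h := (lcmLoop_sound testA 14 runA_ne).2 m (by omega) h2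
  unfold testA at h
  rw [Bool.and_eq_true] at h
  have h0 := h.2
  rw [Bool.eq_false_iff.mpr (fun h2 => absurd (Nat.le_of_ble_eq_true h2) (by omega)),
    cond_false] at h0
  have h3 := Nat.le_of_ble_eq_true h0
  have h4 := psi_lo_of_lcm m 1 ((98 * (m + 1) - 1200) * 100000000 / 6931471803 + 1)
    (by rw [pow_one]; exact h3)
  have h5 := (num_lo (98 * (m + 1) - 1200) 100000000).resolve_right (by norm_num)
  rw [Nat.cast_one, one_mul] at h4
  have h6 : ((98 * (m + 1) - 1200 : ℕ) : ℝ) ≤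
    Chebyshev.psi m / ((100000000 : ℕ) / 10000000000) := by
    refine h5.trans ?_
    apply div_le_div_of_nonneg_right _ (by positivity)
    exact h4
  rw [Nat.cast_sub (by omega)] at h6
  push_cast at h6
  norm_num at h6 ⊢
  linarith

lemma psi_succ (n : ℕ) : Chebyshev.psi (n + 1 : ℕ) = Chebyshev.psi n + Λ (n + 1) := by
  rw [psi_nat, psi_nat, Finset.sum_Icc_succ_top (by omega)]

lemma prime_of_coprime (m : ℕ) (h1 : 2 ≤ m) (h2 : m ≤ 65536)
    (h3 : Nat.Coprime m (Nat.factorial 256)) : m.Prime := by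
  by_contra hp
  have h4 := Nat.minFac_sq_le_self (by omega) hp
  have h5 : m.minFac ≤ 256 := by nlinarith
  have h6 := Nat.Prime.dvd_factorial (Nat.minFac_prime (by omega : m ≠ 1)) |>.mpr h5
  have h7 := Nat.dvd_gcd (Nat.minFac_dvd m) h6
  rw [h3] at h7
  exact (Nat.minFac_prime (by omega : m ≠ 1)).one_lt.ne' (Nat.dvd_one.mp h7)

lemma psiStep_sound (P c1 c2 c3 : ℕ) (hc1 : c1 = 313600000000) (hc2 : c2 = 6931471803)
    (hc3 : c3 = 3840000000000)
    (hP : ∀ m, 2 ≤ m → m ≤ 65536 → Nat.Coprime m P → m.Prime)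
    (n s : ℕ) (hn1 : 12 ≤ n) (hn : n < 65536)
    (hI : (s : ℝ) * Real.log 2 ≤ 32 * Chebyshev.psi n)
    (h : psiStep P c1 c2 c3 n s ≠ 0) :
    ((psiStep P c1 c2 c3 n s : ℕ) : ℝ) * Real.log 2 ≤ 32 * Chebyshev.psi (n + 1 : ℕ) ∧
      0.98 * (((n + 1 : ℕ) : ℝ) + 1) - 12 ≤ Chebyshev.psi (n + 1 : ℕ) := by
  have hL : 0 < Real.log 2 := Real.log_pos (by norm_num)
  cases s with
  | zero => exact absurd rfl h
  | succ s =>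
    have e : psiStep P c1 c2 c3 n (s + 1) = psiBody P c1 c2 c3 n (s + 1) := rfl
    rw [e] at h ⊢
    unfold psiBody at h ⊢
    rw [forceNat_eq, forceNat_eq] at h ⊢
    generalize hs' : (Bool.rec (s + 1) (Nat.add (s + 1)
      (ilog (Nat.pow n.succ 32) 10 0))
      (Nat.beq (Nat.gcd n.succ (Nat.mod P n.succ)) 1) : ℕ) = s' at h ⊢
    have key : (s' : ℝ) * Real.log 2 ≤ 32 * Chebyshev.psi (n + 1 : ℕ) := by
      have hge : (0 : ℝ) ≤ Λ (n + 1) := vonMangoldt_nonneg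
      cases hb : Nat.beq (Nat.gcd n.succ (Nat.mod P n.succ)) 1 with
      | false =>
        rw [hb] at hs'
        rw [psi_succ, ← hs']
        change ((s + 1 : ℕ) : ℝ) * Real.log 2 ≤ _
        linarith
      | true =>
        rw [hb] at hs'
        have hg : Nat.gcd (n + 1) (P % (n + 1)) = 1 := Nat.eq_of_beq_eq_true hb
        have hp : (n + 1).Prime := by
          apply hP _ (by omega) (by omega)
          rw [Nat.Coprime, Nat.gcd_rec, Nat.gcd_comm]
          exact hg
        rw [psi_succ, vonMangoldt_apply_prime hp, ← hs']
        have h1 := log_lo_of (n + 1) 32 (ilog (Nat.pow n.succ 32) 10 0) (by omega)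
          (ilog_lo _ _ _ (by rw [pow_zero]; exact Nat.one_le_pow _ _ (by omega)))
        change ((s + 1 + ilog (Nat.pow n.succ 32) 10 0 : ℕ) : ℝ) * Real.log 2 ≤ _
        rw [Nat.cast_add]
        generalize ilog (Nat.pow n.succ 32) 10 0 = w at *
        rw [Nat.cast_ofNat] at h1
        linarith
    cases ht : (Nat.ble (Nat.mul c1 (Nat.succ n.succ)) (Nat.add (Nat.mul c2 s') c3)) with
    | false => rw [ht] at h; exact absurd rfl h
    | true =>
      refine ⟨key, ?_⟩
      have h1 := Nat.le_of_ble_eq_true ht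
      have h2 : c1 * (n + 1 + 1) ≤ c2 * s' + c3 := h1
      have h3 : (c1 : ℝ) * ((n : ℝ) + 1 + 1) ≤ c2 * s' + c3 := by exact_mod_cast h2
      rw [hc1, hc2, hc3] at h3
      push_cast at h3 ⊢
      have hL2 := Real.log_two_gt_d9
      have h4 : (0 : ℝ) ≤ s' := Nat.cast_nonneg _
      have h5 : (s' : ℝ) * 0.6931471803 ≤ s' * Real.log 2 :=
        mul_le_mul_of_nonneg_left hL2.le h4
      push_cast at key
      linarith

lemma psi_lo_mid_aux (P c1 c2 c3 : ℕ) (hc1 : c1 = 313600000000) (hc2 : c2 = 6931471803)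
    (hc3 : c3 = 3840000000000)
    (hP : ∀ m, 2 ≤ m → m ≤ 65536 → Nat.Coprime m P → m.Prime)
    (hne : psiRun P c1 c2 c3 ≠ 0)
    (m : ℕ) (h1 : 16384 < m) (h2 : m ≤ 65536) :
    0.98 * ((m : ℝ) + 1) - 12 ≤ Chebyshev.psi m := by
  unfold psiRun at hne
  have hz : ∀ n, psiStep P c1 c2 c3 n 0 = 0 := fun n => rfl
  have hne1 : loop (psiStep P c1 c2 c3) 15 16384 757504 ≠ 0 := by
    intro h
    rw [h, loop_zero _ hz] at hne
    exact hne rfl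
  have snd := loop_sound (psiStep P c1 c2 c3) hz 65536
    (fun n s => 12 ≤ n ∧ (s : ℝ) * Real.log 2 ≤ 32 * Chebyshev.psi n)
    (fun m => 0.98 * ((m : ℝ) + 1) - 12 ≤ Chebyshev.psi m) (by
      intro n s hn hI h
      obtain ⟨a, b⟩ := psiStep_sound P c1 c2 c3 hc1 hc2 hc3 hP n s hI.1 hn hI.2 h
      exact ⟨⟨by have := hI.1; omega, a⟩, b⟩)
  obtain ⟨a1, a2⟩ := snd 15 16384 757504 (by norm_num) ⟨by norm_num, by
    have := psi_16384
    rw [Nat.cast_ofNat] at this ⊢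
    rw [Nat.cast_ofNat]
    linarith⟩ hne1
  have e1 : 16384 + 2 ^ 15 = 49152 := by norm_num
  rw [e1] at a1 a2
  obtain ⟨b1, b2⟩ := snd 14 49152 _ (by norm_num) a1 hne
  have e2 : 49152 + 2 ^ 14 = 65536 := by norm_num
  rw [e2] at b2
  rcases le_or_gt m 49152 with h | h
  · exact a2 m h1 h
  · exact b2 m h h2

lemma psi_lo_mid (m : ℕ) (h1 : 16384 < m) (h2 : m ≤ 65536) :
    0.98 * ((m : ℝ) + 1) - 12 ≤ Chebyshev.psi m := by
  have hrun := Nat.le_of_ble_eq_true runC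
  rw [forceNat_eq] at hrun
  exact psi_lo_mid_aux _ _ _ _ rfl rfl rfl prime_of_coprime
    (Nat.one_le_iff_ne_zero.mp hrun) m h1 h2

lemma psi_lo_all (m : ℕ) (h1 : 58 ≤ m) (h2 : m ≤ 65536) :
    0.98 * ((m : ℝ) + 1) - 12 ≤ Chebyshev.psi m := by
  rcases le_or_gt m 16384 with h | h
  · exact psi_lo_small m h1 h
  · exact psi_lo_mid m h h2


/-! ### The upper bound `ψ(n) ≤ 1.11 n` -/

lemma cheb_nat (k : ℕ) (hk : 1 ≤ k) :
    1 + k / 2 + k / 3 + k / 5 ≤ k + k / 30 + (if 6 ≤ k then 1 else 0) := by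
  split_ifs <;> omega

lemma cheb_sum (N : ℕ) :
    Chebyshev.psi N + Real.log ((N / 2).factorial : ℝ) + Real.log ((N / 3).factorial : ℝ) +
      Real.log ((N / 5).factorial : ℝ) ≤
    Real.log (N.factorial : ℝ) + Real.log ((N / 30).factorial : ℝ) +
      Chebyshev.psi (N / 6 : ℕ) := by
  have h0 := log_fact_div_eq N 1
  simp only [Nat.div_one] at h0
  rw [h0, log_fact_div_eq, log_fact_div_eq, log_fact_div_eq, log_fact_div_eq, psi_nat N,
    ← sum_step N 6 (by norm_num)]
  simp only [← Finset.sum_add_distrib]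
  apply Finset.sum_le_sum
  intro n hn
  rw [Finset.mem_Icc] at hn
  have hk : 1 ≤ N / n := Nat.div_pos hn.2 hn.1
  have h1 := cheb_nat (N / n) hk
  generalize N / n = k at *
  have h2 : (1 : ℝ) + ((k / 2 : ℕ) : ℝ) + ((k / 3 : ℕ) : ℝ) + ((k / 5 : ℕ) : ℝ) ≤
    (k : ℝ) + ((k / 30 : ℕ) : ℝ) + (if 6 ≤ k then (1 : ℝ) else 0) := by exact_mod_cast h1
  have h3 := mul_le_mul_of_nonneg_left h2 (vonMangoldt_nonneg (n := n))
  linarith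

lemma cheb_const : Real.log 2 / 2 + Real.log 3 / 3 + Real.log 5 / 5 - Real.log 30 / 30 ≤ 0.9214 := by
  have h3 := log_hi_of 3 200 317 (by norm_num) (by decide +kernel)
  have h5 := log_hi_of 5 59 137 (by norm_num) (by norm_num)
  have h30 : Real.log 30 = Real.log 2 + Real.log 3 + Real.log 5 := by
    rw [← Real.log_mul (by norm_num) (by norm_num), ← Real.log_mul (by norm_num) (by norm_num)]
    norm_num
  have hL := Real.log_two_lt_d9
  push_cast at h3 h5
  rw [h30]
  linarith

lemma psi_step_up (N : ℕ) (hN : 16384 ≤ N) (h : Chebyshev.psi (N / 6 : ℕ) ≤ 1.11 * (N / 6 : ℕ)) :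
    Chebyshev.psi N ≤ 1.11 * N := by
  have hs := cheb_sum N
  have e1 := (abs_le.mp (log_fact_div N 1 le_rfl (by omega))).2
  have e2 := (abs_le.mp (log_fact_div N 2 (by norm_num) (by omega))).1
  have e3 := (abs_le.mp (log_fact_div N 3 (by norm_num) (by omega))).1
  have e5 := (abs_le.mp (log_fact_div N 5 (by norm_num) (by omega))).1
  have e30 := (abs_le.mp (log_fact_div N 30 (by norm_num) (by omega))).2
  rw [Nat.div_one] at e1
  simp only [Nat.cast_one, div_one, Real.log_one, mul_zero, sub_zero] at e1
  push_cast at e2 e3 e5 e30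
  have hN0 : (16384 : ℝ) ≤ N := by exact_mod_cast hN
  have hl : Real.log N ≤ 14 * Real.log 2 - 1 + N / 16384 := by
    have h1 : Real.log ((N : ℝ) / 16384) ≤ (N : ℝ) / 16384 - 1 :=
      Real.log_le_sub_one_of_pos (by positivity)
    rw [Real.log_div (by positivity) (by norm_num)] at h1
    have h2 : Real.log 16384 = 14 * Real.log 2 := by
      rw [show (16384 : ℝ) = 2 ^ 14 by norm_num, Real.log_pow]; norm_num
    linarith
  have hc := mul_le_mul_of_nonneg_left cheb_const (by linarith : (0 : ℝ) ≤ N)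
  have h6 := @Nat.cast_div_le ℝ _ _ _ N 6
  push_cast at h6
  have hL := Real.log_two_lt_d9
  linarith

lemma psi_hi_all (n : ℕ) : Chebyshev.psi n ≤ 1.11 * n := by
  induction n using Nat.strong_induction_on with
  | _ n ih =>
    rcases Nat.eq_zero_or_pos n with h | h
    · subst h; rw [psi_nat]; simp
    rcases le_or_gt n 16384 with h2 | h2
    · exact psi_hi_small n h h2
    · exact psi_step_up n h2.le (ih _ (by omega))

/-! ### Small values -/

lemma runB_ne : loop (lcmStep testB) 6 0 1 ≠ 0 := by
  have h := Nat.le_of_ble_eq_true runB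
  omega

lemma ble_false {a b : ℕ} (h : b < a) : Nat.ble a b = false :=
  Bool.eq_false_iff.mpr (fun h2 => absurd (Nat.le_of_ble_eq_true h2) (by omega))

/-- the table of admissible errors in the upper bound, in hundredths -/
def tabU (m : ℕ) : ℕ := cond (Nat.ble m 13) 480 (cond (Nat.ble m 17) 590
  (cond (Nat.ble m 25) 854 (cond (Nat.ble m 35) 1033 1690)))

lemma tabU_le (m : ℕ) (h1 : 11 ≤ m) : tabU m ≤ 150 * m := by
  unfold tabU
  simp only [cond_eq_ite, Nat.ble_eq]
  split_ifs <;> omega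

lemma psi_hi_tiny (m : ℕ) (h1 : 11 ≤ m) (h2 : m ≤ 62) :
    Chebyshev.psi m ≤ 1.5 * m - (tabU m : ℝ) / 100 := by
  have h := (lcmLoop_sound testB 6 runB_ne).2 m (by omega) (by norm_num; omega)
  unfold testB at h
  rw [ble_false (by omega), ble_false (by omega), cond_false, cond_false, Bool.and_eq_true] at h
  have h3 := Nat.le_of_ble_eq_true h.1
  have h4 := psi_hi_of_lcm m 16 ((150 * m - tabU m) * 1600000000 / 6931471808) h3
  have h5 := num_hi ((150 * m - tabU m) * 1600000000)
  have h6 := h4.trans h5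
  rw [Nat.cast_mul, Nat.cast_sub (tabU_le m h1)] at h6
  push_cast at h6
  linarith

/-- the table of admissible errors in the lower bound, in hundredths -/
def tabL (m : ℕ) : ℕ := cond (Nat.ble m 11) 240 409

lemma tabL_le (m : ℕ) (h1 : 11 ≤ m) : tabL m ≤ 98 * (m + 1) := by
  unfold tabL
  simp only [cond_eq_ite, Nat.ble_eq]
  split_ifs <;> omega

lemma psi_lo_tiny (m : ℕ) (h1 : 11 ≤ m) (h2 : m ≤ 57) :
    0.98 * ((m : ℝ) + 1) - (tabL m : ℝ) / 100 ≤ Chebyshev.psi m := by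
  have h := (lcmLoop_sound testB 6 runB_ne).2 m (by omega) (by norm_num; omega)
  unfold testB at h
  rw [ble_false (by omega), ble_false (by omega), cond_false, cond_false, Bool.and_eq_true] at h
  have h0 := h.2
  rw [ble_false (by omega), cond_false] at h0
  have h3 := Nat.le_of_ble_eq_true h0
  have h4 := psi_lo_of_lcm m 16 ((98 * (m + 1) - tabL m) * 1600000000 / 6931471803 + 1) h3
  have h5 := (num_lo (98 * (m + 1) - tabL m) 1600000000).resolve_right (by norm_num)
  have h6 := h5.trans (div_le_div_of_nonneg_right h4 (by positivity))
  rw [Nat.cast_sub (tabL_le m h1)] at h6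
  push_cast at h6
  norm_num at h6 ⊢
  linarith


/-! ### Final assembly -/

lemma psi_le_of_lt (z : ℝ) (m : ℕ) (h : z < (m : ℝ) + 1) : Chebyshev.psi z ≤ Chebyshev.psi m := by
  rw [Chebyshev.psi_eq_psi_coe_floor z]
  apply Chebyshev.psi_mono
  have : ⌊z⌋₊ < m + 1 := by
    rw [Nat.floor_lt' (by omega)]
    push_cast
    exact h
  exact_mod_cast Nat.lt_succ_iff.mp this

lemma psi_hi_real (z : ℝ) (h : 0 ≤ z) : Chebyshev.psi z ≤ 1.11 * z := by
  rw [Chebyshev.psi_eq_psi_coe_floor z]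
  refine (psi_hi_all _).trans ?_
  have := Nat.floor_le h
  linarith

lemma v2 : Chebyshev.psi (2 : ℕ) ≤ 0.69315 := by
  have h := psi_hi_of_lcm 2 200 200 (by decide +kernel)
  have := Real.log_two_lt_d9
  push_cast at h ⊢
  linarith

lemma v3 : Chebyshev.psi (3 : ℕ) ≤ 1.7918 := by
  have h := psi_hi_of_lcm 3 200 517 (by decide +kernel)
  have := Real.log_two_lt_d9
  push_cast at h ⊢
  linarith

lemma v4 : Chebyshev.psi (4 : ℕ) ≤ 2.48494 := by
  have h := psi_hi_of_lcm 4 200 717 (by decide +kernel)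
  have := Real.log_two_lt_d9
  push_cast at h ⊢
  linarith

lemma v5 : Chebyshev.psi (5 : ℕ) ≤ 4.0966 := by
  have h := psi_hi_of_lcm 5 200 1182 (by decide +kernel)
  have := Real.log_two_lt_d9
  push_cast at h ⊢
  linarith

lemma v6 : Chebyshev.psi (6 : ℕ) ≤ 4.0966 := by
  have h := psi_hi_of_lcm 6 200 1182 (by decide +kernel)
  have := Real.log_two_lt_d9
  push_cast at h ⊢
  linarith

lemma v8 : Chebyshev.psi (8 : ℕ) ≤ 6.734 := by
  have h := psi_hi_of_lcm 8 200 1943 (by decide +kernel)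
  have := Real.log_two_lt_d9
  push_cast at h ⊢
  linarith

lemma v10 : Chebyshev.psi (10 : ℕ) ≤ 7.8326 := by
  have h := psi_hi_of_lcm 10 200 2260 (by decide +kernel)
  have := Real.log_two_lt_d9
  push_cast at h ⊢
  linarith

lemma v15 : Chebyshev.psi (15 : ℕ) ≤ 12.7955 := by
  have h := psi_hi_of_lcm 15 200 3692 (by decide +kernel)
  have := Real.log_two_lt_d9
  push_cast at h ⊢
  linarith

lemma w4 : 2.4814 ≤ Chebyshev.psi (4 : ℕ) := by
  have h := psi_lo_of_lcm 4 200 716 (by decide +kernel)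
  have := Real.log_two_gt_d9
  push_cast at h ⊢
  linarith

lemma w5 : 4.093 ≤ Chebyshev.psi (5 : ℕ) := by
  have h := psi_lo_of_lcm 5 200 1181 (by decide +kernel)
  have := Real.log_two_gt_d9
  push_cast at h ⊢
  linarith

lemma w14 : 12.79 ≤ Chebyshev.psi (14 : ℕ) := by
  have h := psi_lo_of_lcm 14 200 3691 (by decide +kernel)
  have := Real.log_two_gt_d9
  push_cast at h ⊢
  linarith

lemma upper_tiny (y : ℝ) (N m3 m5 : ℕ) (hN : (N : ℝ) ≤ y) (hy : y < N + 1) (h1 : 11 ≤ N)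
    (h2 : N ≤ 62) (h3 : (N + 1) ^ 2 ≤ (m3 + 1) ^ 3) (h5 : (N + 1) ^ 2 ≤ (m5 + 1) ^ 5)
    (hs : Chebyshev.psi m3 + Chebyshev.psi m5 < (tabU N : ℝ) / 100) :
    Chebyshev.psi y + Chebyshev.psi ((y ^ 2) ^ (3 : ℝ)⁻¹) + Chebyshev.psi ((y ^ 2) ^ (5 : ℝ)⁻¹)
      < 1.5 * y := by
  have hy0 : 0 ≤ y := le_trans (Nat.cast_nonneg _) hN
  have hlt : y ^ 2 < ((N : ℝ) + 1) ^ 2 := by gcongr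
  have h3r : ((N : ℝ) + 1) ^ 2 ≤ ((m3 : ℝ) + 1) ^ 3 := by exact_mod_cast h3
  have h5r : ((N : ℝ) + 1) ^ 2 ≤ ((m5 : ℝ) + 1) ^ 5 := by exact_mod_cast h5
  have a := psi_le_of_lt y N hy
  have b := psi_le_of_lt ((y ^ 2) ^ (3 : ℝ)⁻¹) m3 (by
    rw [Real.rpow_inv_lt_iff_of_pos (by positivity) (by positivity) (by norm_num)]
    have : ((m3 : ℝ) + 1) ^ (3 : ℝ) = ((m3 : ℝ) + 1) ^ 3 := by
      exact_mod_cast Real.rpow_natCast ((m3 : ℝ) + 1) 3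
    rw [this]; linarith)
  have c := psi_le_of_lt ((y ^ 2) ^ (5 : ℝ)⁻¹) m5 (by
    rw [Real.rpow_inv_lt_iff_of_pos (by positivity) (by positivity) (by norm_num)]
    have : ((m5 : ℝ) + 1) ^ (5 : ℝ) = ((m5 : ℝ) + 1) ^ 5 := by
      exact_mod_cast Real.rpow_natCast ((m5 : ℝ) + 1) 5
    rw [this]; linarith)
  have d := psi_hi_tiny N h1 h2
  linarith

lemma upper_all (y : ℝ) (hy : 11 ≤ y) :
    Chebyshev.psi y + Chebyshev.psi ((y ^ 2) ^ (3 : ℝ)⁻¹) + Chebyshev.psi ((y ^ 2) ^ (5 : ℝ)⁻¹)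
      < 1.5 * y := by
  have hy0 : 0 ≤ y := by linarith
  have hN := Nat.floor_le hy0
  have hN2 := Nat.lt_floor_add_one y
  have h11 : 11 ≤ ⌊y⌋₊ := Nat.le_floor (by exact_mod_cast hy)
  generalize ⌊y⌋₊ = N at hN hN2 h11
  rcases le_or_gt N 62 with h | h
  · rcases le_or_gt N 13 with g1 | g1
    · have q : (N + 1) ^ 2 ≤ 14 ^ 2 := by gcongr; omega
      refine upper_tiny y N 5 2 hN hN2 h11 h (by omega) (by omega) ?_
      have e : tabU N = 480 := by interval_cases N <;> rfl
      rw [e]; have := v5; have := v2; push_cast at *; linarith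
    rcases le_or_gt N 17 with g2 | g2
    · have q : (N + 1) ^ 2 ≤ 18 ^ 2 := by gcongr; omega
      refine upper_tiny y N 6 3 hN hN2 h11 h (by omega) (by omega) ?_
      have e : tabU N = 590 := by interval_cases N <;> rfl
      rw [e]; have := v6; have := v3; push_cast at *; linarith
    rcases le_or_gt N 25 with g3 | g3
    · have q : (N + 1) ^ 2 ≤ 26 ^ 2 := by gcongr; omega
      refine upper_tiny y N 8 3 hN hN2 h11 h (by omega) (by omega) ?_
      have e : tabU N = 854 := by interval_cases N <;> rfl
      rw [e]; have := v8; have := v3; push_cast at *; linarith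
    rcases le_or_gt N 35 with g4 | g4
    · have q : (N + 1) ^ 2 ≤ 36 ^ 2 := by gcongr; omega
      refine upper_tiny y N 10 4 hN hN2 h11 h (by omega) (by omega) ?_
      have e : tabU N = 1033 := by interval_cases N <;> rfl
      rw [e]; have := v10; have := v4; push_cast at *; linarith
    · have q : (N + 1) ^ 2 ≤ 63 ^ 2 := by gcongr; omega
      refine upper_tiny y N 15 5 hN hN2 h11 h (by omega) (by omega) ?_
      have e : tabU N = 1690 := by interval_cases N <;> rfl
      rw [e]; have := v15; have := v5; push_cast at *; linarith
  · have h63 : (63 : ℝ) ≤ y := le_trans (by exact_mod_cast h) hN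
    have a := psi_hi_real y hy0
    have b := psi_hi_real ((y ^ 2) ^ (3 : ℝ)⁻¹) (by positivity)
    have c := psi_hi_real ((y ^ 2) ^ (5 : ℝ)⁻¹) (by positivity)
    have b2 : (y ^ 2) ^ (3 : ℝ)⁻¹ ≤ y / 3.97 := by
      rw [Real.rpow_inv_le_iff_of_pos (by positivity) (by positivity) (by norm_num)]
      have : (y / 3.97) ^ (3 : ℝ) = (y / 3.97) ^ 3 := by
        exact_mod_cast Real.rpow_natCast (y / 3.97) 3
      rw [this]
      have e : (y / 3.97) ^ 3 = y ^ 2 * (y / 3.97 ^ 3) := by ring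
      rw [e]
      refine le_mul_of_one_le_right (by positivity) ?_
      rw [le_div_iff₀ (by positivity)]
      norm_num; linarith
    have c2 : (y ^ 2) ^ (5 : ℝ)⁻¹ ≤ y / 12 := by
      rw [Real.rpow_inv_le_iff_of_pos (by positivity) (by positivity) (by norm_num)]
      have : (y / 12) ^ (5 : ℝ) = (y / 12) ^ 5 := by
        exact_mod_cast Real.rpow_natCast (y / 12) 5
      rw [this]
      have e : (y / 12) ^ 5 = y ^ 2 * (y ^ 3 / 12 ^ 5) := by ring
      rw [e]
      refine le_mul_of_one_le_right (by positivity) ?_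
      rw [le_div_iff₀ (by positivity)]
      have : (63 : ℝ) ^ 3 ≤ y ^ 3 := by gcongr
      norm_num at this ⊢; linarith
    norm_num at *
    linarith

lemma psi_cbrt_ge (y : ℝ) (N m : ℕ) (hN : (N : ℝ) ≤ y) (h : m ^ 3 ≤ N ^ 2) :
    Chebyshev.psi m ≤ Chebyshev.psi ((y ^ 2) ^ (3 : ℝ)⁻¹) := by
  apply Chebyshev.psi_mono
  rw [Real.le_rpow_inv_iff_of_pos (by positivity) (by positivity) (by norm_num)]
  have : (m : ℝ) ^ (3 : ℝ) = (m : ℝ) ^ 3 := by exact_mod_cast Real.rpow_natCast (m : ℝ) 3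
  rw [this]
  have h' : (m : ℝ) ^ 3 ≤ (N : ℝ) ^ 2 := by exact_mod_cast h
  refine h'.trans ?_
  gcongr

lemma lower_all (y : ℝ) (hy : 11 ≤ y) :
    0.98 * y < Chebyshev.psi y + Chebyshev.psi ((y ^ 2) ^ (3 : ℝ)⁻¹) := by
  have hy0 : 0 ≤ y := by linarith
  have hN := Nat.floor_le hy0
  have hN2 := Nat.lt_floor_add_one y
  have h11 : 11 ≤ ⌊y⌋₊ := Nat.le_floor (by exact_mod_cast hy)
  rw [Chebyshev.psi_eq_psi_coe_floor y]
  generalize ⌊y⌋₊ = N at hN hN2 h11 ⊢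
  rcases le_or_gt N 57 with h | h
  · have a := psi_lo_tiny N h11 h
    rcases le_or_gt N 11 with g | g
    · have hN' : N = 11 := by omega
      have b := psi_cbrt_ge y N 4 hN (by subst hN'; norm_num)
      have e : tabL N = 240 := by subst hN'; rfl
      rw [e] at a
      have := w4
      push_cast at *
      linarith
    · have q : 12 ^ 2 ≤ N ^ 2 := by gcongr; omega
      have b := psi_cbrt_ge y N 5 hN (by omega)
      have e : tabL N = 409 := by interval_cases N <;> rfl
      rw [e] at a
      have := w5
      push_cast at *
      linarith
  rcases le_or_gt N 65536 with g | g
  · have a := psi_lo_all N (by omega) g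
    have q : 58 ^ 2 ≤ N ^ 2 := by gcongr; omega
    have b := psi_cbrt_ge y N 14 hN (by omega)
    have := w14
    push_cast at *
    linarith
  · have a := psi_lower_large psi_hi_all N (by omega)
    have q : 65536 ^ 2 ≤ N ^ 2 := by gcongr
    have b := psi_cbrt_ge y N 1616 hN (by omega)
    have c := psi_lo_all 1616 (by norm_num) (by norm_num)
    have hNp : (65536 : ℝ) ≤ N := by exact_mod_cast g.le
    have l1 : Real.log N ≤ Real.log 150000 + (N / 150000 - 1) := by
      have := Real.log_le_sub_one_of_pos (show (0 : ℝ) < N / 150000 by positivity)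
      rw [Real.log_div (by positivity) (by norm_num)] at this
      linarith
    have l2 := log_hi_of 150000 10 172 (by norm_num) (by decide +kernel)
    have l3 := Real.log_two_lt_d9
    push_cast at *
    norm_num at *
    linarith

end ThetaPsi

theorem theta_between_psi_bounds (x : ℝ) (hx : 121 ≤ x) :
    psi x - 1.5 * x ^ ((1:ℝ)/2) < theta x ∧
      theta x < psi x - 0.98 * x ^ ((1:ℝ)/2) := by
  have hp : psi x = Chebyshev.psi x := by
    unfold psi Chebyshev.psi
    rw [← Finset.Icc_succ_left_eq_Ioc]
    rfl
  have ht : theta x = Chebyshev.theta x := by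
    unfold theta Chebyshev.theta
    apply Finset.sum_congr _ (fun _ _ => rfl)
    ext p
    simp only [Finset.mem_filter, Finset.mem_range, Finset.mem_Ioc]
    constructor
    · rintro ⟨h1, h2⟩
      exact ⟨⟨h2.pos, by omega⟩, h2⟩
    · rintro ⟨⟨h1, h3⟩, h2⟩
      exact ⟨by omega, h2⟩
  have hx0 : 0 ≤ x := by linarith
  have hy : x ^ (2 : ℝ)⁻¹ = √x := by
    rw [Real.sqrt_eq_rpow]; norm_num
  have hy' : x ^ ((1 : ℝ) / 2) = √x := by
    rw [Real.sqrt_eq_rpow]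
  have h11 : 11 ≤ √x := by
    rw [show (11 : ℝ) = √121 by
      rw [show (121 : ℝ) = 11 ^ 2 by norm_num, Real.sqrt_sq (by norm_num)]]
    exact Real.sqrt_le_sqrt hx
  have u := Chebyshev.psi_sub_theta_le_psi_add_psi_add_psi x
  have l := Chebyshev.psi_sub_theta_ge_psi_add_psi_add_psi hx0
  have hU := ThetaPsi.upper_all _ h11
  have hL := ThetaPsi.lower_all _ h11
  rw [Real.sq_sqrt hx0] at hU hL
  have h7 := Chebyshev.psi_nonneg (x ^ (7 : ℝ)⁻¹)
  rw [hy] at u l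
  rw [hp, ht, hy']
  constructor <;> linarith
end
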